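/- Let n ≥ 5, m ≥ 1, and let u = (u_1,…,u_m) be a C⁴ solution of Δ²u_i = |u|^{p−1} u_i on ℝⁿ (1 ≤ i ≤ m) that is stable outside a compact set. If either 1 < p < (n+4)/(n−4), or (n+4)/(n−4) < p < q_c(n), where q_c(n) = ∞ for n ≤ 12 and q_c(n) = ( n + 2 − √( n² + 4 − n√(n² − 8n + 32) ) ) / ( n − 6 − √( n² + 4 − n√(n² − 8n + 32) ) ) for n ≥ 13, then u_i ≡ 0 for every i. -/

import Mathlib

open MeasureTheory Metric Filter Real Set

noncomputable section

/-- `n`-dimensional Euclidean space. -/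
abbrev Euc (n : ℕ) := EuclideanSpace ℝ (Fin n)

/-- Laplacian of a scalar function on Euclidean space. -/
def lap {n : ℕ} (f : Euc n → ℝ) (x : Euc n) : ℝ :=
  ∑ i : Fin n, iteratedFDeriv ℝ 2 f x ![EuclideanSpace.single i 1, EuclideanSpace.single i 1]

/-- Stability (quadratic form) inequality for the fourth order Lane–Emden system, tested
against families of smooth compactly supported functions whose supports lie in `S`:
`Σ_i ∫ |u|^{p−1} φ_i² + (p−1) Σ_{i,j} ∫ |u|^{p−3} u_i u_j φ_i φ_j ≤ Σ_i ∫ |Δφ_i|²`.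
(Since `‖u x‖ ^ (p−3)` is interpreted with `Real.rpow`, the term `|u|^{p−3} u_i u_j`
vanishes on the set where `u = 0`, for any `p > 1`.) -/
def Stable2 (n m : ℕ) (p : ℝ) (u : Euc n → EuclideanSpace ℝ (Fin m))
    (S : Set (Euc n)) : Prop :=
  ∀ φ : Fin m → Euc n → ℝ,
    (∀ i, ContDiff ℝ (⊤ : ℕ∞) (φ i)) → (∀ i, HasCompactSupport (φ i)) →
    (∀ i, tsupport (φ i) ⊆ S) →
    (∑ i, ∫ x, ‖u x‖ ^ (p - 1) * (φ i x) ^ 2) +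
      (p - 1) * ∑ i, ∑ j, ∫ x, ‖u x‖ ^ (p - 3) * u x i * u x j * φ i x * φ j x
      ≤ ∑ i, ∫ x, (lap (φ i) x) ^ 2

section VectorFields

variable {n : ℕ} {V : Type*} [NormedAddCommGroup V] [NormedSpace ℝ V]

/-- The punctured Euclidean space. -/
abbrev Punct (n : ℕ) : Set (Euc n) := {0}ᶜ

lemma isOpen_punct : IsOpen (Punct n) := isOpen_compl_singleton

lemma punct_mem_nhds {x : Euc n} (hx : x ∈ Punct n) : Punct n ∈ nhds x :=
  isOpen_punct.mem_nhds hx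

/-- Derivative of `f` along the linear vector field `x ↦ A x`. -/
def linField (A : Euc n →L[ℝ] Euc n) (f : Euc n → V) (x : Euc n) : V := fderiv ℝ f x (A x)

/-- The Euler field `x · ∇`. -/
abbrev euler (f : Euc n → V) : Euc n → V := linField (ContinuousLinearMap.id ℝ (Euc n)) f

/-- Infinitesimal rotation in the `(i, j)` plane. -/
def rot (i j : Fin n) : Euc n →L[ℝ] Euc n :=
  (EuclideanSpace.proj i).smulRight (EuclideanSpace.single j (1 : ℝ)) -
    (EuclideanSpace.proj j).smulRight (EuclideanSpace.single i (1 : ℝ))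

lemma rot_apply (i j : Fin n) (x : Euc n) :
    rot i j x = x i • EuclideanSpace.single j (1 : ℝ) - x j • EuclideanSpace.single i (1 : ℝ) :=
  rfl

/-- The positive angular operator `-Δ_θ`. -/
def angM (f : Euc n → V) (x : Euc n) : V :=
  -((1 / 2 : ℝ) • ∑ i : Fin n, ∑ j : Fin n, linField (rot i j) (linField (rot i j) f) x)

lemma ContDiffOn.linField {k l : WithTop ℕ∞} {f : Euc n → V} (hf : ContDiffOn ℝ l f (Punct n))
    (hkl : k + 1 ≤ l) (A : Euc n →L[ℝ] Euc n) : ContDiffOn ℝ k (linField A f) (Punct n) :=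
  (hf.fderiv_of_isOpen isOpen_punct hkl).clm_apply A.contDiff.contDiffOn

lemma ContDiffOn.angM {k l : WithTop ℕ∞} {f : Euc n → V} (hf : ContDiffOn ℝ l f (Punct n))
    (hkl : k + 1 + 1 ≤ l) : ContDiffOn ℝ k (angM f) (Punct n) := by
  unfold _root_.angM
  refine (ContDiffOn.const_smul _ ?_).neg
  refine ContDiffOn.sum fun i _ => ContDiffOn.sum fun j _ => ?_
  exact (hf.linField hkl _).linField le_rfl _

lemma ContDiff.linField {k l : WithTop ℕ∞} {f : Euc n → V} (hf : ContDiff ℝ l f)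
    (hkl : k + 1 ≤ l) (A : Euc n →L[ℝ] Euc n) : ContDiff ℝ k (linField A f) :=
  (hf.fderiv_right hkl).clm_apply A.contDiff

lemma ContDiff.angM {k l : WithTop ℕ∞} {f : Euc n → V} (hf : ContDiff ℝ l f)
    (hkl : k + 1 + 1 ≤ l) : ContDiff ℝ k (angM f) := by
  unfold _root_.angM
  refine (ContDiff.const_smul _ ?_).neg
  refine ContDiff.sum fun i _ => ContDiff.sum fun j _ => ?_
  exact (hf.linField hkl _).linField le_rfl _

lemma ContDiffOn.differentiableAt_punct {l : WithTop ℕ∞} {f : Euc n → V}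
    (hf : ContDiffOn ℝ l f (Punct n)) (hl : 1 ≤ l) {x : Euc n} (hx : x ∈ Punct n) :
    DifferentiableAt ℝ f x :=
  (hf.contDiffAt (punct_mem_nhds hx)).differentiableAt (by
    rintro rfl; simp at hl)

lemma Set.EqOn.linField {f g : Euc n → V} (h : EqOn f g (Punct n)) (A : Euc n →L[ℝ] Euc n) :
    EqOn (linField A f) (linField A g) (Punct n) := by
  intro x hx
  have : f =ᶠ[nhds x] g := Filter.eventuallyEq_of_mem (punct_mem_nhds hx) h
  simp only [_root_.linField, this.fderiv_eq]

section Pointwise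
variable {A : Euc n →L[ℝ] Euc n} {f g : Euc n → V} {x : Euc n}

lemma linField_add (hf : DifferentiableAt ℝ f x) (hg : DifferentiableAt ℝ g x) :
    linField A (fun y => f y + g y) x = linField A f x + linField A g x := by
  simp only [linField, fderiv_fun_add hf hg, add_apply]

lemma linField_const_smul (hf : DifferentiableAt ℝ f x) (c : ℝ) :
    linField A (fun y => c • f y) x = c • linField A f x := by
  simp only [linField, fderiv_fun_const_smul hf]; rfl

lemma linField_neg : linField A (fun y => - f y) x = - linField A f x := by
  simp [linField, fderiv_fun_neg]

lemma linField_sum {ι : Type*} (s : Finset ι) {F : ι → Euc n → V}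
    (hf : ∀ i ∈ s, DifferentiableAt ℝ (F i) x) :
    linField A (fun y => ∑ i ∈ s, F i y) x = ∑ i ∈ s, linField A (F i) x := by
  simp only [linField, fderiv_fun_sum hf, _root_.sum_apply]

lemma linField_smul {ρ : Euc n → ℝ} (hρ : DifferentiableAt ℝ ρ x) (hf : DifferentiableAt ℝ f x) :
    linField A (fun y => ρ y • f y) x = ρ x • linField A f x + linField A ρ x • f x := by
  simp only [linField, fderiv_fun_smul hρ hf]
  simp

lemma linField_inner {W : Type*} [NormedAddCommGroup W] [InnerProductSpace ℝ W] {f g : Euc n → W}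
    (hf : DifferentiableAt ℝ f x) (hg : DifferentiableAt ℝ g x) :
    linField A (fun y => inner ℝ (f y) (g y)) x =
      inner ℝ (linField A f x) (g x) + inner ℝ (f x) (linField A g x) := by
  simp only [linField, fderiv_inner_apply ℝ hf hg]
  ring

lemma linField_linField (hf : ContDiffAt ℝ 2 f x) (A B : Euc n →L[ℝ] Euc n) :
    linField A (linField B f) x =
      fderiv ℝ (fderiv ℝ f) x (A x) (B x) + fderiv ℝ f x (B (A x)) := by
  have h1 : DifferentiableAt ℝ (fderiv ℝ f) x :=
    (hf.fderiv_right (m := 1) (by norm_num)).differentiableAt (by simp)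
  unfold linField
  rw [fderiv_clm_apply h1 B.differentiableAt]
  simp [add_comm]

lemma linField_comm (hf : ContDiffAt ℝ 2 f x) {A B : Euc n →L[ℝ] Euc n}
    (hAB : ∀ y, A (B y) = B (A y)) :
    linField A (linField B f) x = linField B (linField A f) x := by
  rw [linField_linField hf, linField_linField hf, hAB,
    (hf.isSymmSndFDerivAt (by simp)).eq]

end Pointwise

lemma ContDiffOn.contDiffAt_punct {l : WithTop ℕ∞} {f : Euc n → V}
    (hf : ContDiffOn ℝ l f (Punct n)) {x : Euc n} (hx : x ∈ Punct n) : ContDiffAt ℝ l f x :=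
  hf.contDiffAt (punct_mem_nhds hx)

lemma euler_linField {f : Euc n → V} (hf : ContDiffOn ℝ 2 f (Punct n)) (A : Euc n →L[ℝ] Euc n) :
    EqOn (euler (linField A f)) (linField A (euler f)) (Punct n) := fun _ hx =>
  linField_comm (hf.contDiffAt_punct hx) fun _ => rfl

lemma euler_angM {f : Euc n → V} (hf : ContDiffOn ℝ 3 f (Punct n)) :
    EqOn (euler (angM f)) (angM (euler f)) (Punct n) := by
  intro x hx
  have h2 : ∀ i j : Fin n, DifferentiableAt ℝ (linField (rot i j) (linField (rot i j) f)) x :=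
    fun i j => ((hf.linField (k := 2) (by norm_num) _).linField (k := 1) (by norm_num)
      _).differentiableAt_punct le_rfl hx
  unfold angM euler
  rw [linField_neg, linField_const_smul, linField_sum]
  · congr 2
    refine Finset.sum_congr rfl fun i _ => ?_
    rw [linField_sum _ fun j _ => h2 i j]
    refine Finset.sum_congr rfl fun j _ => ?_
    refine (euler_linField (hf.linField (k := 2) (by norm_num) _) _ hx).trans ?_
    exact (euler_linField (hf.of_le (by norm_num)) _).linField _ hx
  · exact fun i _ => DifferentiableAt.fun_sum fun j _ => h2 i j
  · exact DifferentiableAt.fun_sum fun i _ => DifferentiableAt.fun_sum fun j _ => h2 i j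

/-- The radial function `h (log ‖x‖)`. -/
def rad (h : ℝ → ℝ) (x : Euc n) : ℝ := h (Real.log ‖x‖)

lemma contDiffOn_log_norm {k : WithTop ℕ∞} :
    ContDiffOn ℝ k (fun x : Euc n => Real.log ‖x‖) (Punct n) := fun _ hx =>
  ((contDiffAt_norm ℝ hx).log (norm_ne_zero_iff.2 hx)).contDiffWithinAt

lemma contDiffOn_rad {k : WithTop ℕ∞} {h : ℝ → ℝ} (hh : ContDiff ℝ k h) :
    ContDiffOn ℝ k (rad h : Euc n → ℝ) (Punct n) :=
  hh.comp_contDiffOn contDiffOn_log_norm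

lemma hasFDerivAt_rad {h : ℝ → ℝ} {h' : ℝ} {x : Euc n} (hx : x ∈ Punct n)
    (hh : HasDerivAt h h' (Real.log ‖x‖)) :
    HasFDerivAt (rad h : Euc n → ℝ) ((h' * (‖x‖ ^ 2)⁻¹) • innerSL ℝ x) x := by
  have hx0 : ‖x‖ ≠ 0 := norm_ne_zero_iff.2 hx
  have h1 : HasFDerivAt (fun y : Euc n => ‖y‖) (‖x‖⁻¹ • innerSL ℝ x) x := by
    have h2 : HasFDerivAt (fun y : Euc n => ‖y‖ ^ 2) (2 • innerSL ℝ x) x :=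
      (hasStrictFDerivAt_norm_sq x).hasFDerivAt
    have h3 := (h2.sqrt (by positivity))
    simp only [Real.sqrt_sq (norm_nonneg _)] at h3
    refine h3.congr_fderiv ?_
    ext y
    simp
    field_simp
  have h4 := hh.comp_hasFDerivAt x (h1.log hx0)
  refine h4.congr_fderiv ?_
  ext y
  simp
  field_simp

lemma euler_rad {h : ℝ → ℝ} {h' : ℝ} {x : Euc n} (hx : x ∈ Punct n)
    (hh : HasDerivAt h h' (Real.log ‖x‖)) : euler (rad h : Euc n → ℝ) x = h' := by
  have hx0 : ‖x‖ ≠ 0 := norm_ne_zero_iff.2 hx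
  simp only [euler, linField, (hasFDerivAt_rad hx hh).fderiv]
  simp
  field_simp

lemma inner_rot (i j : Fin n) (x : Euc n) : inner ℝ x (rot i j x) = 0 := by
  rw [rot_apply, inner_sub_right, inner_smul_right, inner_smul_right]
  simp [EuclideanSpace.inner_single_right]
  ring

lemma linField_rot_rad {h : ℝ → ℝ} {x : Euc n} (hx : x ∈ Punct n)
    (hh : DifferentiableAt ℝ h (Real.log ‖x‖)) (i j : Fin n) :
    linField (rot i j) (rad h : Euc n → ℝ) x = 0 := by
  simp only [linField, (hasFDerivAt_rad hx hh.hasDerivAt).fderiv]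
  simp [inner_rot]

lemma euler_rad_smul {h h' : ℝ → ℝ} (hh : ∀ t, HasDerivAt h (h' t) t) {f : Euc n → V}
    (hf : ContDiffOn ℝ 1 f (Punct n)) :
    EqOn (euler (fun x => rad h x • f x)) (fun x => rad h x • euler f x + rad h' x • f x)
      (Punct n) := by
  intro x hx
  simp only [euler]
  rw [linField_smul (hasFDerivAt_rad hx (hh _)).differentiableAt
    (hf.differentiableAt_punct le_rfl hx)]
  congr 2
  exact euler_rad hx (hh _)

lemma linField_rot_rad_smul {h : ℝ → ℝ} (hh : Differentiable ℝ h) {f : Euc n → V}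
    (hf : ContDiffOn ℝ 1 f (Punct n)) (i j : Fin n) :
    EqOn (linField (rot i j) (fun x => rad h x • f x)) (fun x => rad h x • linField (rot i j) f x)
      (Punct n) := by
  intro x hx
  rw [linField_smul (hasFDerivAt_rad hx (hh _).hasDerivAt).differentiableAt
    (hf.differentiableAt_punct le_rfl hx), linField_rot_rad hx (hh _)]
  simp

lemma angM_rad_smul {h : ℝ → ℝ} (hh : Differentiable ℝ h) {f : Euc n → V}
    (hf : ContDiffOn ℝ 2 f (Punct n)) :
    EqOn (angM (fun x => rad h x • f x)) (fun x => rad h x • angM f x) (Punct n) := by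
  intro x hx
  simp only [angM, smul_neg, Finset.smul_sum]
  congr 1
  refine Finset.sum_congr rfl fun i _ => Finset.sum_congr rfl fun j _ => ?_
  rw [(linField_rot_rad_smul hh (hf.of_le (by norm_num)) i j).linField _ hx,
    linField_rot_rad_smul hh (hf.linField (by norm_num) _) i j hx, smul_comm]

end VectorFields

section Laplacian

variable {n : ℕ} {V : Type*} [NormedAddCommGroup V] [NormedSpace ℝ V]

/-- Laplacian of a vector-valued function. -/
def lapV (f : Euc n → V) (x : Euc n) : V :=
  ∑ k : Fin n, fderiv ℝ (fderiv ℝ f) x (EuclideanSpace.single k 1) (EuclideanSpace.single k 1)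

lemma Set.EqOn.lapV {f g : Euc n → V} (h : EqOn f g (Punct n)) :
    EqOn (lapV f) (lapV g) (Punct n) := by
  intro x hx
  have : f =ᶠ[nhds x] g := Filter.eventuallyEq_of_mem (punct_mem_nhds hx) h
  simp only [_root_.lapV, this.fderiv.fderiv_eq]

lemma sum_single (x : Euc n) : x = ∑ k : Fin n, x k • EuclideanSpace.single k (1 : ℝ) := by
  ext j
  simp [Finset.sum_apply, Pi.single_apply]

lemma rot_rot_apply (i j : Fin n) (x : Euc n) :
    rot i j (rot i j x) = (x i * (if i = j then 1 else 0) - x j) • EuclideanSpace.single j (1 : ℝ)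
      - (x i - x j * (if i = j then 1 else 0)) • EuclideanSpace.single i (1 : ℝ) := by
  rw [rot_apply i j (rot i j x)]
  by_cases h : i = j
  · subst h; simp [rot_apply]
  · simp [rot_apply, h, Ne.symm h]

lemma norm_sq_smul_lapV {f : Euc n → V} {x : Euc n} (hf : ContDiffAt ℝ 2 f x) :
    ‖x‖ ^ 2 • lapV f x = euler (euler f) x + ((n : ℝ) - 2) • euler f x - angM f x := by
  simp only [angM, euler, linField_linField hf]
  set H := fderiv ℝ (fderiv ℝ f) x with hH
  set g := fderiv ℝ f x with hg
  set e : Fin n → Euc n := fun k => EuclideanSpace.single k (1 : ℝ) with he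
  have hx : x = ∑ k, x k • e k := sum_single x
  have hgx : g x = ∑ i, x i • g (e i) := by
    conv_lhs => rw [hx]
    simp
  have hHx : H x x = ∑ i, ∑ j, (x i * x j) • H (e i) (e j) := by
    conv_lhs => rw [hx]
    simp only [map_sum, map_smul, _root_.sum_apply, smul_apply, Finset.smul_sum, mul_smul]
    exact Finset.sum_comm.trans (Finset.sum_congr rfl fun i _ => Finset.sum_congr rfl fun j _ =>
      smul_comm _ _ _)
  have hterm : ∀ i j : Fin n, H (rot i j x) (rot i j x) + g (rot i j (rot i j x)) =
      (x i ^ 2) • H (e j) (e j) + (x j ^ 2) • H (e i) (e i) - (x i * x j) • H (e j) (e i)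
        - (x j * x i) • H (e i) (e j) - x j • g (e j) - x i • g (e i)
        + (if i = j then (2 * x i) • g (e i) else 0) := by
    intro i j
    rw [rot_rot_apply, rot_apply]
    by_cases h : i = j
    · subst h
      simp
      module
    · simp only [h, if_false, map_sub, map_smul, sub_apply,
        smul_apply]
      simp only [he]
      module
  have hn : ‖x‖ ^ 2 = ∑ i, x i ^ 2 := by
    simp [EuclideanSpace.norm_sq_eq]
  have hsum : ∑ i, ∑ j, (H (rot i j x) (rot i j x) + g (rot i j (rot i j x))) =
      (2 : ℝ) • (‖x‖ ^ 2 • ∑ k, H (e k) (e k)) - (2 : ℝ) • H x x - (2 * n : ℝ) • g x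
        + (2 : ℝ) • g x := by
    simp only [hterm, Finset.sum_add_distrib, Finset.sum_sub_distrib]
    have h1 : ∑ i, ∑ j, x i ^ 2 • H (e j) (e j) = ‖x‖ ^ 2 • ∑ k, H (e k) (e k) := by
      simp only [← Finset.smul_sum, hn, Finset.sum_smul]
    have h2 : ∑ i, ∑ j, x j ^ 2 • H (e i) (e i) = ‖x‖ ^ 2 • ∑ k, H (e k) (e k) := by
      rw [Finset.sum_comm]; exact h1
    have h3 : ∑ i, ∑ j, (x i * x j) • H (e j) (e i) = H x x := by
      rw [hHx, Finset.sum_comm]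
      simp only [mul_comm]
    have h4 : ∑ i, ∑ j, (x j * x i) • H (e i) (e j) = H x x := by
      rw [hHx]; simp only [mul_comm]
    have h5 : ∑ _i : Fin n, ∑ j, x j • g (e j) = (n : ℝ) • g x := by
      simp [hgx, ← Nat.cast_smul_eq_nsmul ℝ]
    have h6 : ∑ i, ∑ _j : Fin n, x i • g (e i) = (n : ℝ) • g x := by
      rw [Finset.sum_comm]; exact h5
    have h7 : ∑ i, ∑ j, (if i = j then (2 * x i) • g (e i) else 0) = (2 : ℝ) • g x := by
      simp [hgx, Finset.smul_sum, mul_smul]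
    rw [h1, h2, h3, h4, h5, h6, h7]
    module
  rw [hsum]
  simp only [lapV, linField, ContinuousLinearMap.id_apply]
  module

/-- Multiplication by `‖x‖ ^ γ` away from the origin. -/
def twist (γ : ℝ) (f : Euc n → V) (x : Euc n) : V := rad (fun t => Real.exp (γ * t)) x • f x

lemma contDiff_exp_mul (γ : ℝ) {k : WithTop ℕ∞} : ContDiff ℝ k (fun t : ℝ => Real.exp (γ * t)) := by
  fun_prop

lemma hasDerivAt_exp_mul (γ t : ℝ) :
    HasDerivAt (fun t : ℝ => Real.exp (γ * t)) (γ * Real.exp (γ * t)) t := by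
  have := ((hasDerivAt_id t).const_mul γ).exp
  simpa [mul_comm] using this

lemma ContDiffOn.twist {k : WithTop ℕ∞} {f : Euc n → V} (hf : ContDiffOn ℝ k f (Punct n)) (γ : ℝ) :
    ContDiffOn ℝ k (twist γ f) (Punct n) :=
  (contDiffOn_rad (contDiff_exp_mul γ)).smul hf

lemma Set.EqOn.twist {f g : Euc n → V} (h : EqOn f g (Punct n)) (γ : ℝ) :
    EqOn (twist γ f) (twist γ g) (Punct n) := fun x hx => by simp only [_root_.twist, h hx]

lemma twist_twist (a b : ℝ) (f : Euc n → V) : twist a (twist b f) = twist (a + b) f := by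
  ext x
  simp only [twist, rad, smul_smul, ← Real.exp_add, add_mul]

lemma twist_zero (f : Euc n → V) : twist 0 f = f := by
  ext x
  simp [twist, rad]

lemma euler_twist {f : Euc n → V} (hf : ContDiffOn ℝ 1 f (Punct n)) (γ : ℝ) :
    EqOn (euler (twist γ f)) (twist γ (fun x => euler f x + γ • f x)) (Punct n) := by
  intro x hx
  refine (euler_rad_smul (hasDerivAt_exp_mul γ) hf hx).trans ?_
  simp only [twist, rad]
  module

lemma linField_rot_twist {f : Euc n → V} (hf : ContDiffOn ℝ 1 f (Punct n)) (γ : ℝ) (i j : Fin n) :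
    EqOn (linField (rot i j) (twist γ f)) (twist γ (linField (rot i j) f)) (Punct n) :=
  linField_rot_rad_smul ((contDiff_exp_mul (k := 1) γ).differentiable (by simp)) hf i j

lemma angM_twist {f : Euc n → V} (hf : ContDiffOn ℝ 2 f (Punct n)) (γ : ℝ) :
    EqOn (angM (twist γ f)) (twist γ (angM f)) (Punct n) :=
  angM_rad_smul ((contDiff_exp_mul (k := 1) γ).differentiable (by simp)) hf

lemma linField_add_smul {f g : Euc n → V} (hf : ContDiffOn ℝ 1 f (Punct n))
    (hg : ContDiffOn ℝ 1 g (Punct n)) (A : Euc n →L[ℝ] Euc n) (c : ℝ) :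
    EqOn (linField A (fun x => f x + c • g x)) (fun x => linField A f x + c • linField A g x)
      (Punct n) := by
  intro x hx
  have h1 := hf.differentiableAt_punct le_rfl hx
  have h2 := hg.differentiableAt_punct le_rfl hx
  exact (linField_add h1 (h2.const_smul c)).trans (by
    beta_reduce; rw [← linField_const_smul h2]; rfl)

lemma euler_add_smul {f g : Euc n → V} (hf : ContDiffOn ℝ 1 f (Punct n))
    (hg : ContDiffOn ℝ 1 g (Punct n)) (c : ℝ) :
    EqOn (euler (fun x => f x + c • g x)) (fun x => euler f x + c • euler g x) (Punct n) :=
  linField_add_smul hf hg _ c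

lemma ContDiffOn.add_smul {k : WithTop ℕ∞} {f g : Euc n → V} (hf : ContDiffOn ℝ k f (Punct n))
    (hg : ContDiffOn ℝ k g (Punct n)) (c : ℝ) :
    ContDiffOn ℝ k (fun x => f x + c • g x) (Punct n) := hf.add (hg.const_smul c)

lemma angM_add_smul {f g : Euc n → V} (hf : ContDiffOn ℝ 2 f (Punct n))
    (hg : ContDiffOn ℝ 2 g (Punct n)) (c : ℝ) :
    EqOn (angM (fun x => f x + c • g x)) (fun x => angM f x + c • angM g x) (Punct n) := by
  intro x hx
  have hsum : ∀ i j, linField (rot i j) (linField (rot i j) (fun x => f x + c • g x)) x =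
      linField (rot i j) (linField (rot i j) f) x
        + c • linField (rot i j) (linField (rot i j) g) x := fun i j => by
    rw [(linField_add_smul (hf.of_le (by norm_num)) (hg.of_le (by norm_num)) _ c).linField _ hx]
    exact linField_add_smul (hf.linField (by norm_num) _) (hg.linField (by norm_num) _) _ c hx
  simp only [angM, hsum, Finset.sum_add_distrib, ← Finset.smul_sum]
  module

/-- `n (n - 4) / 4`, the bottom of the angular operator in the conformal cylinder. -/
def nzero (n : ℕ) : ℝ := (n : ℝ) * ((n : ℝ) - 4) / 4

/-- The bilaplacian in Emden–Fowler coordinates, for the exponent `(n - 4) / 2 - δ`. -/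
def cylOp (δ : ℝ) (w : Euc n → V) (x : Euc n) : V :=
  euler (euler (euler (euler w))) x + (4 * δ) • euler (euler (euler w)) x
    + (6 * δ ^ 2 - 4 - 2 * nzero n) • euler (euler w) x
    + (4 * δ ^ 3 - 8 * δ - 4 * δ * nzero n) • euler w x
    + (-2 : ℝ) • angM (euler (euler w)) x + (-4 * δ) • angM (euler w) x
    + angM (angM w) x + (2 * nzero n - 2 * δ ^ 2) • angM w x
    + (δ ^ 4 - (2 * nzero n + 4) * δ ^ 2 + nzero n ^ 2) • w x

lemma lapV_eq_twist {f : Euc n → V} (hf : ContDiffOn ℝ 2 f (Punct n)) :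
    EqOn (lapV f) (twist (-2) (fun x => (euler (euler f) x + ((n : ℝ) - 2) • euler f x)
      + (-1 : ℝ) • angM f x)) (Punct n) := by
  intro x hx
  have h := norm_sq_smul_lapV (hf.contDiffAt_punct hx)
  have hx0 : 0 < ‖x‖ := norm_pos_iff.2 hx
  have h2 : Real.exp (-2 * Real.log ‖x‖) = (‖x‖ ^ 2)⁻¹ := by
    rw [neg_mul, Real.exp_neg, show (2 : ℝ) * Real.log ‖x‖ = ((2 : ℕ) : ℝ) * Real.log ‖x‖ by simp,
      Real.exp_nat_mul, Real.exp_log hx0]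
  have h3 : lapV f x = (‖x‖ ^ 2)⁻¹ • (‖x‖ ^ 2 • lapV f x) := by
    rw [smul_smul, inv_mul_cancel₀ (by positivity), one_smul]
  rw [h3, h]
  simp only [twist, rad, h2]
  module

lemma lapV_twist {f : Euc n → V} (hf : ContDiffOn ℝ 2 f (Punct n)) (a : ℝ) :
    EqOn (lapV (twist a f)) (twist (a - 2) (fun x => euler (euler f) x
      + (2 * a + n - 2) • euler f x + (a ^ 2 + (n - 2) * a) • f x + (-1 : ℝ) • angM f x))
      (Punct n) := by
  intro x hx
  have hf1 : ContDiffOn ℝ 1 f (Punct n) := hf.of_le (by norm_num)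
  have hDf : ContDiffOn ℝ 1 (euler f) (Punct n) := hf.linField (by norm_num) _
  have e1 := euler_twist hf1 a
  have e2 : EqOn (euler (euler (twist a f))) _ (Punct n) :=
    (e1.linField _).trans (euler_twist (hDf.add_smul hf1 a) a)
  have e3 := linField_add_smul hDf hf1 (ContinuousLinearMap.id ℝ (Euc n)) a
  rw [lapV_eq_twist (hf.twist a) hx]
  simp only [twist] at *
  rw [e2 hx, e1 hx, angM_twist hf a hx]
  simp only [twist, euler] at *
  rw [e3 hx]
  have : rad (fun t => Real.exp ((a - 2) * t)) x
      = rad (fun t => Real.exp (-2 * t)) x * rad (fun t => Real.exp (a * t)) x := by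
    simp only [rad, ← Real.exp_add]; ring_nf
  rw [this]
  module

lemma bilaplacian_twist {w : Euc n → V} (hw : ContDiffOn ℝ 4 w (Punct n)) (δ : ℝ) :
    EqOn (lapV (lapV (twist (δ - ((n : ℝ) - 4) / 2) w)))
      (twist (δ - ((n : ℝ) - 4) / 2 - 4) (cylOp δ w)) (Punct n) := by
  set a : ℝ := δ - ((n : ℝ) - 4) / 2 with ha
  have hw3 : ContDiffOn ℝ 3 w (Punct n) := hw.of_le (by norm_num)
  have hw2 : ContDiffOn ℝ 2 w (Punct n) := hw.of_le (by norm_num)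
  have hw1 : ContDiffOn ℝ 1 w (Punct n) := hw.of_le (by norm_num)
  have hD : ContDiffOn ℝ 3 (euler w) (Punct n) := hw.linField (by norm_num) _
  have hD2 : ContDiffOn ℝ 2 (euler (euler w)) (Punct n) := hD.linField (by norm_num) _
  have hD3 : ContDiffOn ℝ 1 (euler (euler (euler w))) (Punct n) := hD2.linField (by norm_num) _
  have hM : ContDiffOn ℝ 2 (angM w) (Punct n) := hw.angM (by norm_num)
  have hMD : ContDiffOn ℝ 1 (angM (euler w)) (Punct n) := hD.angM (by norm_num)
  have l2 : ∀ {f : Euc n → V}, ContDiffOn ℝ 2 f (Punct n) → ContDiffOn ℝ 1 f (Punct n) :=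
    fun h => h.of_le (by norm_num)
  have hD' : ContDiffOn ℝ 2 (euler w) (Punct n) := hD.of_le (by norm_num)
  intro x hx
  have hg2 := ((hD2.add_smul hD' (2 * a + n - 2)).add_smul hw2 (a ^ 2 + (n - 2) * a)).add_smul
    hM (-1)
  rw [(lapV_twist hw2 a).lapV hx, lapV_twist hg2 (a - 2) hx]
  have e1 := euler_add_smul (l2 ((hD2.add_smul hD' (2 * a + n - 2)).add_smul hw2
    (a ^ 2 + (n - 2) * a))) (l2 hM) (-1)
  have e2 := euler_add_smul (l2 (hD2.add_smul hD' (2 * a + n - 2))) (l2 hw2)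
    (a ^ 2 + (n - 2) * a)
  have e3 := euler_add_smul (l2 hD2) (l2 hD')
    (2 * a + n - 2)
  have e4 := euler_angM hw3
  have E1 : EqOn (euler (fun x => euler (euler w) x + (2 * a + n - 2) • euler w x
      + (a ^ 2 + (n - 2) * a) • w x + (-1 : ℝ) • angM w x))
      (fun x => euler (euler (euler w)) x + (2 * a + n - 2) • euler (euler w) x
      + (a ^ 2 + (n - 2) * a) • euler w x + (-1 : ℝ) • angM (euler w) x) (Punct n) := by
    intro y hy
    refine (e1 hy).trans ?_
    beta_reduce
    rw [e4 hy]
    refine congrArg (· + _) ?_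
    refine (e2 hy).trans ?_
    beta_reduce
    rw [e3 hy]
  have e1' := euler_add_smul ((hD3.add_smul (l2 hD2) (2 * a + n - 2)).add_smul (l2 hD')
    (a ^ 2 + (n - 2) * a)) hMD (-1)
  have e2' := euler_add_smul (hD3.add_smul (l2 hD2) (2 * a + n - 2)) (l2 hD')
    (a ^ 2 + (n - 2) * a)
  have e3' := euler_add_smul hD3 (l2 hD2)
    (2 * a + n - 2)
  have e4' := euler_angM hD
  have E2 : euler (euler (fun x => euler (euler w) x + (2 * a + n - 2) • euler w x
      + (a ^ 2 + (n - 2) * a) • w x + (-1 : ℝ) • angM w x)) x =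
      euler (euler (euler (euler w))) x + (2 * a + n - 2) • euler (euler (euler w)) x
      + (a ^ 2 + (n - 2) * a) • euler (euler w) x + (-1 : ℝ) • angM (euler (euler w)) x := by
    refine (E1.linField _ hx).trans ((e1' hx).trans ?_)
    beta_reduce
    rw [e4' hx]
    refine congrArg (· + _) ?_
    refine (e2' hx).trans ?_
    beta_reduce
    rw [e3' hx]
  have m1 := angM_add_smul ((hD2.add_smul hD' (2 * a + n - 2)).add_smul hw2
    (a ^ 2 + (n - 2) * a)) hM (-1)
  have m2 := angM_add_smul (hD2.add_smul hD' (2 * a + n - 2)) hw2 (a ^ 2 + (n - 2) * a)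
  have m3 := angM_add_smul hD2 hD' (2 * a + n - 2)
  have E3 : angM (fun x => euler (euler w) x + (2 * a + n - 2) • euler w x
      + (a ^ 2 + (n - 2) * a) • w x + (-1 : ℝ) • angM w x) x =
      angM (euler (euler w)) x + (2 * a + n - 2) • angM (euler w) x
      + (a ^ 2 + (n - 2) * a) • angM w x + (-1 : ℝ) • angM (angM w) x := by
    refine (m1 hx).trans ?_
    beta_reduce
    rw [m2 hx]
    beta_reduce
    rw [m3 hx]
  have h4 : a - 2 - 2 = a - 4 := by ring
  simp only [twist, h4]
  rw [E1 hx, E2, E3]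
  congr 1
  simp only [cylOp, nzero, ha]
  module

end Laplacian

section RadialIntegrals

variable {n : ℕ} {V : Type*} [NormedAddCommGroup V]

lemma exists_bounds_of_hasCompactSupport {z : ℝ → ℝ} (hz : HasCompactSupport z) :
    ∃ A : ℝ, ∀ t, z t ≠ 0 → t ∈ Icc (-A) A := by
  obtain ⟨A, hA⟩ := hz.isCompact.isBounded.subset_closedBall 0
  refine ⟨A, fun t ht => ?_⟩
  have := hA (subset_tsupport z ht)
  simpa [Real.closedBall_eq_Icc] using this

lemma rad_ne_zero_mem {z : ℝ → ℝ} {A : ℝ} (hA : ∀ t, z t ≠ 0 → t ∈ Icc (-A) A) {x : Euc n}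
    (hx : x ∈ Punct n) (h : rad z x ≠ 0) : Real.exp (-A) ≤ ‖x‖ ∧ ‖x‖ ≤ Real.exp A := by
  have hx0 : 0 < ‖x‖ := norm_pos_iff.2 hx
  obtain ⟨h1, h2⟩ := hA _ h
  exact ⟨(Real.le_log_iff_exp_le hx0).1 h1, (Real.log_le_iff_le_exp hx0).1 h2⟩

lemma eventually_rad_smul_eq_zero [NormedSpace ℝ V] {z : ℝ → ℝ} (hz : HasCompactSupport z)
    {f : Euc n → V} (h0 : z 0 • f 0 = 0) : ∀ᶠ x in nhds (0 : Euc n), rad z x • f x = 0 := by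
  obtain ⟨A, hA⟩ := exists_bounds_of_hasCompactSupport hz
  filter_upwards [ball_mem_nhds (0 : Euc n) (Real.exp_pos (-A))] with x hx
  by_cases hx0 : x = 0
  · subst hx0; simpa [rad] using h0
  · by_contra hne
    have := (rad_ne_zero_mem hA hx0 (fun h => hne (by rw [h, zero_smul]))).1
    rw [mem_ball_zero_iff] at hx
    linarith

lemma contDiff_rad_smul [NormedSpace ℝ V] {k : WithTop ℕ∞} {z : ℝ → ℝ} (hz : ContDiff ℝ k z)
    (hzc : HasCompactSupport z) {f : Euc n → V} (hf : ContDiffOn ℝ k f (Punct n))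
    (h0 : z 0 • f 0 = 0) : ContDiff ℝ k (fun x => rad z x • f x) := by
  rw [contDiff_iff_contDiffAt]
  intro x
  by_cases hx : x = 0
  · subst hx
    exact contDiffAt_const.congr_of_eventuallyEq (eventually_rad_smul_eq_zero hzc h0)
  · exact ((contDiffOn_rad hz).smul hf).contDiffAt_punct hx

lemma continuous_rad_smul [NormedSpace ℝ V] {z : ℝ → ℝ} (hz : Continuous z)
    (hzc : HasCompactSupport z) {f : Euc n → V} (hf : ContinuousOn f (Punct n))
    (h0 : z 0 • f 0 = 0) : Continuous (fun x => rad z x • f x) :=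
  contDiff_zero.1 (contDiff_rad_smul (contDiff_zero.2 hz) hzc (contDiffOn_zero.2 hf) h0)

lemma hasCompactSupport_rad_smul [NormedSpace ℝ V] {z : ℝ → ℝ} (hzc : HasCompactSupport z)
    (f : Euc n → V) : HasCompactSupport (fun x => rad z x • f x) := by
  obtain ⟨A, hA⟩ := exists_bounds_of_hasCompactSupport hzc
  refine HasCompactSupport.intro (isCompact_closedBall (0 : Euc n) (Real.exp A)) fun x hx => ?_
  by_contra hne
  have hx0 : x ≠ 0 := by
    rintro rfl; exact hx (by simp [Real.exp_nonneg])
  exact hx (by simpa using (rad_ne_zero_mem hA hx0 (fun h => hne (by rw [h, zero_smul]))).2)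

lemma integral_linField_eq {g : Euc n → ℝ} (hg : ContDiff ℝ 1 g) (hgc : HasCompactSupport g)
    (A : Euc n →L[ℝ] Euc n) :
    ∫ x, linField A g x = -((∑ k : Fin n, A (EuclideanSpace.single k 1) k) * ∫ x, g x) := by
  have hA : ∀ k : Fin n, ContDiff ℝ 1 (fun x => A x k) := fun k =>
    ((EuclideanSpace.proj (𝕜 := ℝ) k).comp A).contDiff
  have hdA : ∀ (k : Fin n) x, fderiv ℝ (fun x => A x k) x (EuclideanSpace.single k 1)
      = A (EuclideanSpace.single k 1) k := fun k x => by
    have := ((EuclideanSpace.proj (𝕜 := ℝ) k).comp A).fderiv (x := x)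
    exact congrArg (fun L : Euc n →L[ℝ] ℝ => L (EuclideanSpace.single k 1)) this
  have hd : ∀ k : Fin n, Continuous (fun x => fderiv ℝ g x (EuclideanSpace.single k 1)) :=
    fun k => (hg.continuous_fderiv (by simp)).clm_apply continuous_const
  have hdc : ∀ k : Fin n, HasCompactSupport (fun x => fderiv ℝ g x (EuclideanSpace.single k 1)) :=
    fun k => hgc.fderiv_apply ℝ _
  have hint : ∀ k : Fin n,
      Integrable (fun x => A x k * fderiv ℝ g x (EuclideanSpace.single k 1)) := fun k =>
    ((hA k).continuous.mul (hd k)).integrable_of_hasCompactSupport (hdc k).mul_left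
  have hexp : ∀ x, linField A g x = ∑ k, A x k * fderiv ℝ g x (EuclideanSpace.single k 1) := by
    intro x
    unfold linField
    conv_lhs => rw [sum_single (A x)]
    simp
  simp only [hexp]
  rw [integral_finsetSum _ fun k _ => hint k, Finset.sum_mul, ← Finset.sum_neg_distrib]
  refine Finset.sum_congr rfl fun k _ => ?_
  rw [integral_mul_fderiv_eq_neg_fderiv_mul_of_integrable _ (hint k)
    (((hA k).continuous.mul hg.continuous).integrable_of_hasCompactSupport hgc.mul_left)
    (fun x _ => (hA k).differentiable (by simp) x) (fun x _ => hg.differentiable (by simp) x)]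
  · simp only [hdA]
    rw [integral_const_mul]
  · simp only [hdA]
    exact (hg.continuous.integrable_of_hasCompactSupport hgc).const_mul _

/-- Integration against `z (log ‖x‖) ‖x‖ ^ (-n) dx`. -/
def radInt (z : ℝ → ℝ) (q : Euc n → ℝ) : ℝ := ∫ x, rad z x • ((‖x‖ ^ n)⁻¹ * q x)

lemma contDiffOn_inv_norm_pow {k : WithTop ℕ∞} :
    ContDiffOn ℝ k (fun x : Euc n => (‖x‖ ^ n)⁻¹) (Punct n) := fun _ hx =>
  (((contDiffAt_norm ℝ hx).pow n).inv (pow_ne_zero _ (norm_ne_zero_iff.2 hx))).contDiffWithinAt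

lemma continuousOn_inv_norm_pow_mul {q : Euc n → ℝ} (hq : ContinuousOn q (Punct n)) :
    ContinuousOn (fun x : Euc n => (‖x‖ ^ n)⁻¹ * q x) (Punct n) :=
  (contDiffOn_inv_norm_pow (k := 0)).continuousOn.mul hq

lemma radInt_const_mul (z : ℝ → ℝ) (c : ℝ) (q : Euc n → ℝ) :
    radInt z (fun x => c * q x) = c * radInt z q := by
  unfold radInt
  rw [← integral_const_mul]
  congr 1; ext x; simp only [smul_eq_mul]; ring

lemma radInt_const_mul_left (z : ℝ → ℝ) (c : ℝ) (q : Euc n → ℝ) :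
    radInt (fun t => c * z t) q = c * radInt z q := by
  unfold radInt
  rw [← integral_const_mul]
  congr 1; ext x; simp only [smul_eq_mul, rad]; ring

lemma hasDerivAt_deriv_of_contDiff {z : ℝ → ℝ} (hz : ContDiff ℝ 1 z) (t : ℝ) :
    HasDerivAt z (deriv z t) t := (hz.differentiable (by simp) t).hasDerivAt

lemma norm_eq_exp_log {x : Euc n} (hx : x ∈ Punct n) :
    (‖x‖ ^ n)⁻¹ = rad (fun t => Real.exp (-(n : ℝ) * t)) x := by
  have hx0 : 0 < ‖x‖ := norm_pos_iff.2 hx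
  simp only [rad]
  rw [neg_mul, Real.exp_neg, Real.exp_nat_mul, Real.exp_log hx0]

variable [NeZero n]

lemma ae_mem_punct : ∀ᵐ x : Euc n, x ∈ Punct n := by
  have : Nonempty (Fin n) := ⟨⟨0, Nat.pos_of_ne_zero (NeZero.ne n)⟩⟩
  simp [ae_iff]

lemma inv_norm_zero_pow (q : ℝ) (c : ℝ) : c • ((‖(0 : Euc n)‖ ^ n)⁻¹ * q) = 0 := by
  simp [NeZero.ne n]

lemma integrable_radInt {z : ℝ → ℝ} (hz : Continuous z) (hzc : HasCompactSupport z)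
    {q : Euc n → ℝ} (hq : ContinuousOn q (Punct n)) :
    Integrable (fun x => rad z x • ((‖x‖ ^ n)⁻¹ * q x)) :=
  (continuous_rad_smul hz hzc (continuousOn_inv_norm_pow_mul hq)
    (inv_norm_zero_pow _ _)).integrable_of_hasCompactSupport (hasCompactSupport_rad_smul hzc _)

lemma radInt_congr {z z' : ℝ → ℝ} {q q' : Euc n → ℝ}
    (h : ∀ x ∈ Punct n, rad z x * q x = rad z' x * q' x) : radInt z q = radInt z' q' := by
  refine integral_congr_ae (Eventually.of_forall fun x => ?_)
  by_cases hx : x = 0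
  · subst hx; simp [NeZero.ne n]
  · have := h x hx
    simp only [smul_eq_mul]
    linear_combination (‖x‖ ^ n)⁻¹ * this

lemma radInt_mono {z z' : ℝ → ℝ} (hz : Continuous z) (hzc : HasCompactSupport z)
    (hz' : Continuous z') (hzc' : HasCompactSupport z') {q q' : Euc n → ℝ}
    (hq : ContinuousOn q (Punct n)) (hq' : ContinuousOn q' (Punct n))
    (h : ∀ x ∈ Punct n, rad z x * q x ≤ rad z' x * q' x) : radInt z q ≤ radInt z' q' := by
  refine integral_mono (integrable_radInt hz hzc hq) (integrable_radInt hz' hzc' hq') fun x => ?_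
  by_cases hx : x = 0
  · subst hx; simp [NeZero.ne n]
  · have h1 := mul_le_mul_of_nonneg_left (h x hx) (a := (‖x‖ ^ n)⁻¹) (by positivity)
    simp only [smul_eq_mul]
    linarith

lemma radInt_nonneg {z : ℝ → ℝ} {q : Euc n → ℝ} (h : ∀ x ∈ Punct n, 0 ≤ rad z x * q x) :
    0 ≤ radInt z q := by
  refine integral_nonneg fun x => ?_
  by_cases hx : x = 0
  · subst hx; simp [NeZero.ne n]
  · have h1 := mul_nonneg (a := (‖x‖ ^ n)⁻¹) (by positivity) (h x hx)
    simp only [smul_eq_mul, Pi.zero_apply]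
    linarith

lemma radInt_add {z : ℝ → ℝ} (hz : Continuous z) (hzc : HasCompactSupport z)
    {q q' : Euc n → ℝ} (hq : ContinuousOn q (Punct n)) (hq' : ContinuousOn q' (Punct n)) :
    radInt z (fun x => q x + q' x) = radInt z q + radInt z q' := by
  unfold radInt
  rw [← integral_add (integrable_radInt hz hzc hq) (integrable_radInt hz hzc hq')]
  simp only [smul_eq_mul, mul_add]

lemma radInt_add_left {z z' : ℝ → ℝ} (hz : Continuous z) (hzc : HasCompactSupport z)
    (hz' : Continuous z') (hzc' : HasCompactSupport z')
    {q : Euc n → ℝ} (hq : ContinuousOn q (Punct n)) :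
    radInt (fun t => z t + z' t) q = radInt z q + radInt z' q := by
  unfold radInt
  rw [← integral_add (integrable_radInt hz hzc hq) (integrable_radInt hz' hzc' hq)]
  simp only [smul_eq_mul, rad, add_mul]

lemma radInt_euler {z : ℝ → ℝ} (hz : ContDiff ℝ 1 z) (hzc : HasCompactSupport z)
    {h : Euc n → ℝ} (hh : ContDiffOn ℝ 1 h (Punct n)) :
    radInt z (euler h) = - radInt (deriv z) h := by
  set f : Euc n → ℝ := fun x => (‖x‖ ^ n)⁻¹ * h x with hf
  have hf1 : ContDiffOn ℝ 1 f (Punct n) := contDiffOn_inv_norm_pow.mul hh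
  have key := integral_linField_eq (contDiff_rad_smul hz hzc hf1 (inv_norm_zero_pow _ _))
    (hasCompactSupport_rad_smul hzc f) (ContinuousLinearMap.id ℝ (Euc n))
  have htr : ∑ k : Fin n, ContinuousLinearMap.id ℝ (Euc n) (EuclideanSpace.single k 1) k = n := by
    simp
  rw [htr] at key
  have hpt : ∀ x ∈ Punct n, euler (fun x => rad z x • f x) x =
      rad z x • ((‖x‖ ^ n)⁻¹ * euler h x) + rad (deriv z) x • ((‖x‖ ^ n)⁻¹ * h x)
        - n * (rad z x • f x) := by
    intro x hx
    have e1 := euler_rad_smul (hasDerivAt_deriv_of_contDiff hz) hf1 hx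
    have e2 : EqOn f (twist (-(n : ℝ)) h) (Punct n) := fun y hy => by
      simp only [hf, twist, norm_eq_exp_log hy, smul_eq_mul]
    have e3 := (e2.linField (ContinuousLinearMap.id ℝ (Euc n)) hx).trans
      (euler_twist hh (-(n : ℝ)) hx)
    refine e1.trans ?_
    simp only [smul_eq_mul]
    rw [show euler f x = _ from e3]
    simp only [twist, ← norm_eq_exp_log hx, smul_eq_mul, hf]
    ring
  have hcd : ContinuousOn (euler h) (Punct n) :=
    (hh.linField (k := 0) (by simp) _).continuousOn
  have i1 := integrable_radInt hz.continuous hzc hcd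
  have i2 := integrable_radInt (hz.continuous_deriv le_rfl) hzc.deriv hh.continuousOn
  have i3 := (integrable_radInt hz.continuous hzc hh.continuousOn).const_mul (n : ℝ)
  have key2 : ∫ x, euler (fun x => rad z x • f x) x =
      radInt z (euler h) + radInt (deriv z) h - n * ∫ x, rad z x • f x := by
    refine (integral_congr_ae (ae_mem_punct.mono hpt)).trans ?_
    refine (integral_sub (i1.add i2) i3).trans ?_
    rw [integral_const_mul]
    exact congrArg (· - _) (integral_add i1 i2)
  rw [key2] at key
  linarith

lemma radInt_rot {z : ℝ → ℝ} (hz : ContDiff ℝ 1 z) (hzc : HasCompactSupport z)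
    {h : Euc n → ℝ} (hh : ContDiffOn ℝ 1 h (Punct n)) (i j : Fin n) :
    radInt z (linField (rot i j) h) = 0 := by
  set f : Euc n → ℝ := fun x => (‖x‖ ^ n)⁻¹ * h x with hf
  have hf1 : ContDiffOn ℝ 1 f (Punct n) := contDiffOn_inv_norm_pow.mul hh
  have key := integral_linField_eq (contDiff_rad_smul hz hzc hf1 (inv_norm_zero_pow _ _))
    (hasCompactSupport_rad_smul hzc f) (rot i j)
  have htr : ∑ k : Fin n, rot i j (EuclideanSpace.single k 1) k = 0 := by
    simp only [rot_apply]
    by_cases h : i = j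
    · subst h; simp
    · refine Finset.sum_eq_zero fun k _ => ?_
      simp only [PiLp.single_apply, PiLp.sub_apply, PiLp.smul_apply, smul_eq_mul]
      grind
  rw [htr, zero_mul, neg_zero] at key
  rw [← key]
  refine integral_congr_ae (ae_mem_punct.mono fun x hx => ?_)
  have e1 := linField_rot_rad_smul (hz.differentiable (by simp)) hf1 i j hx
  have e2 : EqOn f (twist (-(n : ℝ)) h) (Punct n) := fun y hy => by
    simp only [hf, twist, norm_eq_exp_log hy, smul_eq_mul]
  have e3 := (e2.linField (rot i j) hx).trans (linField_rot_twist hh (-(n : ℝ)) i j hx)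
  refine Eq.trans ?_ e1.symm
  beta_reduce
  rw [e3]
  simp only [twist, ← norm_eq_exp_log hx, smul_eq_mul]

end RadialIntegrals

section Pairings

variable {n : ℕ} {V : Type*} [NormedAddCommGroup V] [InnerProductSpace ℝ V]

/-- Smooth compactly supported functions on the line. -/
structure IsCut (z : ℝ → ℝ) : Prop where
  smooth : ContDiff ℝ (⊤ : ℕ∞) z
  compact : HasCompactSupport z

lemma IsCut.deriv {z : ℝ → ℝ} (hz : IsCut z) : IsCut (deriv z) :=
  ⟨((contDiff_infty_iff_deriv).1 hz.smooth).2, hz.compact.deriv⟩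

lemma IsCut.iteratedDeriv {z : ℝ → ℝ} (hz : IsCut z) (k : ℕ) : IsCut (iteratedDeriv k z) := by
  induction k with
  | zero => simpa using hz
  | succ k ih => rw [iteratedDeriv_succ]; exact ih.deriv

lemma IsCut.contDiff {z : ℝ → ℝ} (hz : IsCut z) (k : ℕ) : ContDiff ℝ k z :=
  hz.smooth.of_le (by exact_mod_cast le_top)

lemma IsCut.continuous {z : ℝ → ℝ} (hz : IsCut z) : Continuous z := hz.smooth.continuous

/-- The weighted `L²` pairing of two fields. -/
def pair (z : ℝ → ℝ) (f g : Euc n → V) : ℝ := radInt z (fun x => inner ℝ (f x) (g x))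

/-- The carré du champ of the angular operator. -/
def angG (f g : Euc n → V) (x : Euc n) : ℝ :=
  (1 / 2) * ∑ i : Fin n, ∑ j : Fin n, inner ℝ (linField (rot i j) f x) (linField (rot i j) g x)

lemma angG_comm (f g : Euc n → V) : angG f g = angG g f := by
  ext x
  simp only [angG, real_inner_comm]

lemma angG_self_nonneg (f : Euc n → V) (x : Euc n) : 0 ≤ angG f f x :=
  mul_nonneg (by norm_num) (Finset.sum_nonneg fun _ _ => Finset.sum_nonneg fun _ _ =>
    real_inner_self_nonneg)

lemma continuousOn_angG {f g : Euc n → V} (hf : ContDiffOn ℝ 1 f (Punct n))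
    (hg : ContDiffOn ℝ 1 g (Punct n)) : ContinuousOn (angG f g) (Punct n) := by
  refine continuousOn_const.mul (continuousOn_finsetSum _ fun i _ =>
    continuousOn_finsetSum _ fun j _ => ?_)
  exact (hf.linField (k := 0) (by simp) _).continuousOn.inner
    (hg.linField (k := 0) (by simp) _).continuousOn

lemma pair_comm (z : ℝ → ℝ) (f g : Euc n → V) : pair z f g = pair z g f := by
  simp only [pair, real_inner_comm]

lemma pair_smul_right (z : ℝ → ℝ) (f g : Euc n → V) (c : ℝ) :
    pair z f (c • g) = c * pair z f g := by
  simp only [pair, Pi.smul_apply, real_inner_smul_right, radInt_const_mul]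

variable [NeZero n]

lemma pair_congr_right {z : ℝ → ℝ} {f g g' : Euc n → V} (h : EqOn g g' (Punct n)) :
    pair z f g = pair z f g' := radInt_congr fun x hx => by rw [h hx]

lemma pair_congr_left {z : ℝ → ℝ} {f f' g : Euc n → V} (h : EqOn f f' (Punct n)) :
    pair z f g = pair z f' g := radInt_congr fun x hx => by rw [h hx]

variable {z : ℝ → ℝ}

lemma pair_add_right (hz : IsCut z) {f g g' : Euc n → V} (hf : ContinuousOn f (Punct n))
    (hg : ContinuousOn g (Punct n)) (hg' : ContinuousOn g' (Punct n)) :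
    pair z f (g + g') = pair z f g + pair z f g' := by
  simp only [pair, Pi.add_apply, inner_add_right]
  exact radInt_add hz.continuous hz.compact (hf.inner hg) (hf.inner hg')

lemma pair_euler (hz : IsCut z) {f g : Euc n → V} (hf : ContDiffOn ℝ 1 f (Punct n))
    (hg : ContDiffOn ℝ 1 g (Punct n)) :
    pair z (euler f) g + pair z f (euler g) = - pair (deriv z) f g := by
  have hf0 : ContinuousOn (euler f) (Punct n) := (hf.linField (k := 0) (by simp) _).continuousOn
  have hg0 : ContinuousOn (euler g) (Punct n) := (hg.linField (k := 0) (by simp) _).continuousOn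
  have h := radInt_euler (hz.contDiff 1) hz.compact (hf.inner ℝ hg)
  simp only [pair]
  rw [← h, ← radInt_add hz.continuous hz.compact (hf0.inner hg.continuousOn)
    (hf.continuousOn.inner hg0)]
  refine radInt_congr fun x hx => congrArg (rad z x * ·) ?_
  exact (linField_inner (hf.differentiableAt_punct le_rfl hx)
    (hg.differentiableAt_punct le_rfl hx)).symm

lemma pair_iteratedDeriv_euler (hz : IsCut z) (k : ℕ) {f g : Euc n → V}
    (hf : ContDiffOn ℝ 1 f (Punct n)) (hg : ContDiffOn ℝ 1 g (Punct n)) :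
    pair (iteratedDeriv k z) (euler f) g + pair (iteratedDeriv k z) f (euler g)
      = - pair (iteratedDeriv (k + 1) z) f g := by
  rw [iteratedDeriv_succ]
  exact pair_euler (hz.iteratedDeriv k) hf hg

lemma radInt_sum {ι : Type*} (s : Finset ι) (hz : IsCut z) {q : ι → Euc n → ℝ}
    (hq : ∀ i ∈ s, ContinuousOn (q i) (Punct n)) :
    radInt z (fun x => ∑ i ∈ s, q i x) = ∑ i ∈ s, radInt z (q i) := by
  unfold radInt
  rw [← integral_finsetSum _ fun i hi => integrable_radInt hz.continuous hz.compact (hq i hi)]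
  simp only [smul_eq_mul, Finset.mul_sum]

lemma pair_angM (hz : IsCut z) {f g : Euc n → V} (hf : ContDiffOn ℝ 2 f (Punct n))
    (hg : ContDiffOn ℝ 1 g (Punct n)) : pair z (angM f) g = radInt z (angG f g) := by
  have h1 : ∀ i j : Fin n, ContDiffOn ℝ 1 (linField (rot i j) f) (Punct n) := fun i j =>
    hf.linField (by norm_num) _
  have h0 : ∀ i j : Fin n, ContinuousOn (linField (rot i j) (linField (rot i j) f)) (Punct n) :=
    fun i j => ((h1 i j).linField (k := 0) (by simp) _).continuousOn
  have g0 : ∀ i j : Fin n, ContinuousOn (linField (rot i j) g) (Punct n) :=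
    fun i j => (hg.linField (k := 0) (by simp) _).continuousOn
  have key : ∀ i j : Fin n,
      radInt z (fun x => inner ℝ (linField (rot i j) (linField (rot i j) f) x) (g x)) =
      - radInt z (fun x => inner ℝ (linField (rot i j) f x) (linField (rot i j) g x)) := by
    intro i j
    have h := radInt_rot (hz.contDiff 1) hz.compact ((h1 i j).inner ℝ hg) i j
    rw [eq_neg_iff_add_eq_zero, ← h, ← radInt_add hz.continuous hz.compact
      ((h0 i j).inner hg.continuousOn) ((h1 i j).continuousOn.inner (g0 i j))]
    refine radInt_congr fun x hx => congrArg (rad z x * ·) ?_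
    exact (linField_inner ((h1 i j).differentiableAt_punct le_rfl hx)
      (hg.differentiableAt_punct le_rfl hx)).symm
  have e1 : pair z (angM f) g = -(1 / 2) * radInt z (fun x => ∑ i : Fin n, ∑ j : Fin n,
      inner ℝ (linField (rot i j) (linField (rot i j) f) x) (g x)) := by
    rw [← radInt_const_mul]
    refine radInt_congr fun x _ => ?_
    simp only [angM, inner_neg_left, real_inner_smul_left, sum_inner]
    ring
  have e2 : radInt z (angG f g) = (1 / 2) * radInt z (fun x => ∑ i : Fin n, ∑ j : Fin n,
      inner ℝ (linField (rot i j) f x) (linField (rot i j) g x)) := by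
    rw [← radInt_const_mul]; rfl
  rw [e1, e2, radInt_sum _ hz fun i _ => continuousOn_finsetSum _ fun j _ =>
    (h0 i j).inner hg.continuousOn, radInt_sum _ hz fun i _ => continuousOn_finsetSum _ fun j _ =>
    (h1 i j).continuousOn.inner (g0 i j)]
  have e3 : ∀ i : Fin n, radInt z (fun x => ∑ j : Fin n,
      inner ℝ (linField (rot i j) (linField (rot i j) f) x) (g x)) = - radInt z (fun x =>
      ∑ j : Fin n, inner ℝ (linField (rot i j) f x) (linField (rot i j) g x)) := fun i => by
    rw [radInt_sum _ hz fun j _ => (h0 i j).inner hg.continuousOn,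
      radInt_sum _ hz fun j _ => (h1 i j).continuousOn.inner (g0 i j), ← Finset.sum_neg_distrib]
    exact Finset.sum_congr rfl fun j _ => key i j
  simp only [e3, Finset.sum_neg_distrib]
  ring

lemma pair_angM_symm (hz : IsCut z) {f g : Euc n → V} (hf : ContDiffOn ℝ 2 f (Punct n))
    (hg : ContDiffOn ℝ 2 g (Punct n)) : pair z (angM f) g = pair z f (angM g) := by
  rw [pair_angM hz hf (hg.of_le (by norm_num)), pair_comm z f, pair_angM hz hg
    (hf.of_le (by norm_num)), angG_comm]

end Pairings

section EnergyIdentities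

variable {n : ℕ} [NeZero n] {V : Type*} [NormedAddCommGroup V] [InnerProductSpace ℝ V]
  {z : ℝ → ℝ} {w : Euc n → V}

lemma pair_cylOp (hz : IsCut z) (hw : ContDiffOn ℝ 4 w (Punct n)) {f : Euc n → V}
    (hf : ContinuousOn f (Punct n)) (δ : ℝ) :
    pair z f (cylOp δ w) = pair z f (euler (euler (euler (euler w))))
      + (4 * δ) * pair z f (euler (euler (euler w)))
      + (6 * δ ^ 2 - 4 - 2 * nzero n) * pair z f (euler (euler w))
      + (4 * δ ^ 3 - 8 * δ - 4 * δ * nzero n) * pair z f (euler w)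
      - 2 * pair z f (angM (euler (euler w))) - 4 * δ * pair z f (angM (euler w))
      + pair z f (angM (angM w)) + (2 * nzero n - 2 * δ ^ 2) * pair z f (angM w)
      + (δ ^ 4 - (2 * nzero n + 4) * δ ^ 2 + nzero n ^ 2) * pair z f w := by
  have hD : ContDiffOn ℝ 3 (euler w) (Punct n) := hw.linField (by norm_num) _
  have hD2 : ContDiffOn ℝ 2 (euler (euler w)) (Punct n) := hD.linField (by norm_num) _
  have hD3 : ContDiffOn ℝ 1 (euler (euler (euler w))) (Punct n) := hD2.linField (by norm_num) _
  have hD4 : ContDiffOn ℝ 0 (euler (euler (euler (euler w)))) (Punct n) :=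
    hD3.linField (by norm_num) _
  have hM : ContDiffOn ℝ 2 (angM w) (Punct n) := hw.angM (by norm_num)
  have hMD : ContDiffOn ℝ 1 (angM (euler w)) (Punct n) := hD.angM (by norm_num)
  have hMD2 : ContDiffOn ℝ 0 (angM (euler (euler w))) (Punct n) := hD2.angM (by norm_num)
  have hMM : ContDiffOn ℝ 0 (angM (angM w)) (Punct n) := hM.angM (by norm_num)
  have c1 := hD4.continuousOn.add (hD3.continuousOn.const_smul (4 * δ))
  have c2 := c1.add (hD2.continuousOn.const_smul (6 * δ ^ 2 - 4 - 2 * nzero n))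
  have c3 := c2.add (hD.continuousOn.const_smul (4 * δ ^ 3 - 8 * δ - 4 * δ * nzero n))
  have c4 := c3.add (hMD2.continuousOn.const_smul (-2 : ℝ))
  have c5 := c4.add (hMD.continuousOn.const_smul (-4 * δ))
  have c6 := c5.add hMM.continuousOn
  have c7 := c6.add (hM.continuousOn.const_smul (2 * nzero n - 2 * δ ^ 2))
  have e : cylOp δ w = euler (euler (euler (euler w))) + (4 * δ) • euler (euler (euler w))
    + (6 * δ ^ 2 - 4 - 2 * nzero n) • euler (euler w)
    + (4 * δ ^ 3 - 8 * δ - 4 * δ * nzero n) • euler w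
    + (-2 : ℝ) • angM (euler (euler w)) + (-4 * δ) • angM (euler w)
    + angM (angM w) + (2 * nzero n - 2 * δ ^ 2) • angM w
    + (δ ^ 4 - (2 * nzero n + 4) * δ ^ 2 + nzero n ^ 2) • w := rfl
  rw [e, pair_add_right hz hf c7 (hw.continuousOn.const_smul _),
    pair_add_right hz hf c6 (hM.continuousOn.const_smul _),
    pair_add_right hz hf c5 hMM.continuousOn,
    pair_add_right hz hf c4 (hMD.continuousOn.const_smul _),
    pair_add_right hz hf c3 (hMD2.continuousOn.const_smul _),
    pair_add_right hz hf c2 (hD.continuousOn.const_smul _),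
    pair_add_right hz hf c1 (hD2.continuousOn.const_smul _),
    pair_add_right hz hf hD4.continuousOn (hD3.continuousOn.const_smul _)]
  simp only [pair_smul_right]
  ring

/-- Testing the cylinder equation with `z w`. -/
lemma pair_self_cylOp (hz : IsCut z) (hw : ContDiffOn ℝ 4 w (Punct n)) (δ : ℝ) :
    pair z w (cylOp δ w) =
      pair z (euler (euler w)) (euler (euler w)) + pair z (angM w) (angM w)
      + 2 * pair z (angM (euler w)) (euler w)
      - (6 * δ ^ 2 - 4 - 2 * nzero n) * pair z (euler w) (euler w)
      + (2 * nzero n - 2 * δ ^ 2) * pair z (angM w) w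
      + (δ ^ 4 - (2 * nzero n + 4) * δ ^ 2 + nzero n ^ 2) * pair z w w
      - 2 * pair (iteratedDeriv 2 z) (euler w) (euler w)
      + 6 * δ * pair (iteratedDeriv 1 z) (euler w) (euler w)
      + (1 / 2) * pair (iteratedDeriv 4 z) w w - 2 * δ * pair (iteratedDeriv 3 z) w w
      + (1 / 2) * (6 * δ ^ 2 - 4 - 2 * nzero n) * pair (iteratedDeriv 2 z) w w
      - (1 / 2) * (4 * δ ^ 3 - 8 * δ - 4 * δ * nzero n) * pair (iteratedDeriv 1 z) w w
      - pair (iteratedDeriv 2 z) (angM w) w + 2 * δ * pair (iteratedDeriv 1 z) (angM w) w := by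
  have hD : ContDiffOn ℝ 3 (euler w) (Punct n) := hw.linField (by norm_num) _
  have hD2 : ContDiffOn ℝ 2 (euler (euler w)) (Punct n) := hD.linField (by norm_num) _
  have hD3 : ContDiffOn ℝ 1 (euler (euler (euler w))) (Punct n) := hD2.linField (by norm_num) _
  have hM : ContDiffOn ℝ 2 (angM w) (Punct n) := hw.angM (by norm_num)
  have l1 : ContDiffOn ℝ 1 w (Punct n) := hw.of_le (by norm_num)
  have lD : ContDiffOn ℝ 1 (euler w) (Punct n) := hD.of_le (by norm_num)
  have lD2 : ContDiffOn ℝ 1 (euler (euler w)) (Punct n) := hD2.of_le (by norm_num)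
  have lM : ContDiffOn ℝ 1 (angM w) (Punct n) := hM.of_le (by norm_num)
  have l2 : ContDiffOn ℝ 2 w (Punct n) := hw.of_le (by norm_num)
  have lD' : ContDiffOn ℝ 2 (euler w) (Punct n) := hD.of_le (by norm_num)
  have hw3 : ContDiffOn ℝ 3 w (Punct n) := hw.of_le (by norm_num)
  rw [pair_cylOp hz hw hw.continuousOn]
  have E : ∀ (k : ℕ) {f g : Euc n → V}, ContDiffOn ℝ 1 f (Punct n) → ContDiffOn ℝ 1 g (Punct n) →
      pair (iteratedDeriv k z) (euler f) g + pair (iteratedDeriv k z) f (euler g)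
        = - pair (iteratedDeriv (k + 1) z) f g := fun k _ _ => pair_iteratedDeriv_euler hz k
  have s := fun k f g => pair_comm (V := V) (n := n) (iteratedDeriv k z) f g
  have b02 := E 0 l1 lD
  have b02' := E 1 l1 lD
  have b02'' := E 2 l1 lD
  have b01 := E 0 l1 l1
  have b01' := E 1 l1 l1
  have b01'' := E 2 l1 l1
  have b01''' := E 3 l1 l1
  have b11 := E 0 lD lD
  have b11' := E 1 lD lD
  have b12 := E 0 lD lD2
  have b03 := E 0 l1 lD2
  have b03' := E 1 l1 lD2
  have b04 := E 0 l1 hD3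
  have m0 := E 0 lM l1
  have m0' := E 1 lM l1
  have m1 := E 0 lM lD
  simp only [iteratedDeriv_zero, zero_add, Nat.reduceAdd] at *
  have t1 := pair_angM_symm hz l2 lD'
  have t2 := pair_angM_symm hz l2 hD2
  have t3 := pair_angM_symm hz l2 hM
  have c1 : ∀ {y : ℝ → ℝ} {g : Euc n → V}, pair y (euler (angM w)) g = pair y (angM (euler w)) g :=
    pair_congr_left (euler_angM hw3)
  have t0 := pair_angM_symm hz l2 l2
  have t1' := pair_angM_symm (hz.iteratedDeriv 1) l2 lD'
  rw [c1] at m0 m0' m1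
  have s1 := s 0 w (euler w)
  have s1' := s 1 w (euler w)
  have s1'' := s 2 w (euler w)
  have s1''' := s 3 w (euler w)
  have s2 := s 0 w (angM (euler w))
  have s3 := s 1 w (angM (euler w))
  have s4 := s 0 (euler w) (euler (euler w))
  have s4' := s 1 (euler w) (euler (euler w))
  simp only [iteratedDeriv_zero] at s1 s2 s4
  have k4 : pair z w (euler (euler (euler (euler w)))) = pair z (euler (euler w)) (euler (euler w))
      - 2 * pair (iteratedDeriv 2 z) (euler w) (euler w)
      + (1 / 2) * pair (iteratedDeriv 4 z) w w := by linarith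
  have k3 : pair z w (euler (euler (euler w))) =
      (3 / 2) * pair (iteratedDeriv 1 z) (euler w) (euler w)
      - (1 / 2) * pair (iteratedDeriv 3 z) w w := by linarith
  have k2 : pair z w (euler (euler w)) = - pair z (euler w) (euler w)
      + (1 / 2) * pair (iteratedDeriv 2 z) w w := by linarith
  have k1 : pair z w (euler w) = - (1 / 2) * pair (iteratedDeriv 1 z) w w := by linarith
  have a2 : pair z w (angM (euler (euler w))) = - pair z (angM (euler w)) (euler w)
      + (1 / 2) * pair (iteratedDeriv 2 z) (angM w) w := by linarith
  have a1 : pair z w (angM (euler w)) = - (1 / 2) * pair (iteratedDeriv 1 z) (angM w) w := by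
    linarith
  rw [k4, k3, k2, k1, a2, a1, ← t3, ← t0]
  ring

/-- Testing the cylinder equation with `z ∂ₜw`. -/
lemma pair_euler_cylOp (hz : IsCut z) (hw : ContDiffOn ℝ 4 w (Punct n)) (δ : ℝ) :
    pair z (euler w) (cylOp δ w) =
      - 4 * δ * (pair z (euler (euler w)) (euler (euler w)) + pair z (angM (euler w)) (euler w)
        + (nzero n + 2 - δ ^ 2) * pair z (euler w) (euler w))
      + (3 / 2) * pair (iteratedDeriv 1 z) (euler (euler w)) (euler (euler w))
      - (1 / 2) * pair (iteratedDeriv 3 z) (euler w) (euler w)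
      + 2 * δ * pair (iteratedDeriv 2 z) (euler w) (euler w)
      - (1 / 2) * (6 * δ ^ 2 - 4 - 2 * nzero n) * pair (iteratedDeriv 1 z) (euler w) (euler w)
      + pair (iteratedDeriv 1 z) (angM (euler w)) (euler w)
      - (1 / 2) * pair (iteratedDeriv 1 z) (angM w) (angM w)
      - (1 / 2) * (2 * nzero n - 2 * δ ^ 2) * pair (iteratedDeriv 1 z) (angM w) w
      - (1 / 2) * (δ ^ 4 - (2 * nzero n + 4) * δ ^ 2 + nzero n ^ 2)
        * pair (iteratedDeriv 1 z) w w := by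
  have hD : ContDiffOn ℝ 3 (euler w) (Punct n) := hw.linField (by norm_num) _
  have hD2 : ContDiffOn ℝ 2 (euler (euler w)) (Punct n) := hD.linField (by norm_num) _
  have hD3 : ContDiffOn ℝ 1 (euler (euler (euler w))) (Punct n) := hD2.linField (by norm_num) _
  have hM : ContDiffOn ℝ 2 (angM w) (Punct n) := hw.angM (by norm_num)
  have l1 : ContDiffOn ℝ 1 w (Punct n) := hw.of_le (by norm_num)
  have lD : ContDiffOn ℝ 1 (euler w) (Punct n) := hD.of_le (by norm_num)
  have lD2 : ContDiffOn ℝ 1 (euler (euler w)) (Punct n) := hD2.of_le (by norm_num)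
  have lM : ContDiffOn ℝ 1 (angM w) (Punct n) := hM.of_le (by norm_num)
  have lMD : ContDiffOn ℝ 1 (angM (euler w)) (Punct n) := hD.angM (by norm_num)
  have l2 : ContDiffOn ℝ 2 w (Punct n) := hw.of_le (by norm_num)
  have lD' : ContDiffOn ℝ 2 (euler w) (Punct n) := hD.of_le (by norm_num)
  have hw3 : ContDiffOn ℝ 3 w (Punct n) := hw.of_le (by norm_num)
  rw [pair_cylOp hz hw hD.continuousOn]
  have E : ∀ (k : ℕ) {f g : Euc n → V}, ContDiffOn ℝ 1 f (Punct n) → ContDiffOn ℝ 1 g (Punct n) →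
      pair (iteratedDeriv k z) (euler f) g + pair (iteratedDeriv k z) f (euler g)
        = - pair (iteratedDeriv (k + 1) z) f g := fun k _ _ => pair_iteratedDeriv_euler hz k
  have s := fun k f g => pair_comm (V := V) (n := n) (iteratedDeriv k z) f g
  have b14 := E 0 lD hD3
  have b23 := E 0 lD2 lD2
  have b13 := E 0 lD lD2
  have b13' := E 1 lD lD2
  have b12 := E 0 lD lD
  have b12' := E 1 lD lD
  have b12'' := E 2 lD lD
  have b01 := E 0 l1 l1
  have m01 := E 0 lM l1
  have m12 := E 0 lMD lD
  have mm := E 0 lM lM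
  simp only [iteratedDeriv_zero, zero_add, Nat.reduceAdd] at *
  have c1 : ∀ {y : ℝ → ℝ} {g : Euc n → V}, pair y (euler (angM w)) g = pair y (angM (euler w)) g :=
    pair_congr_left (euler_angM hw3)
  have c2 : ∀ {y : ℝ → ℝ} {g : Euc n → V},
      pair y (euler (angM (euler w))) g = pair y (angM (euler (euler w))) g :=
    pair_congr_left (euler_angM hD)
  have t1 := pair_angM_symm hz lD' hM
  have t2 := pair_angM_symm hz lD' hD2
  have t3 := pair_angM_symm hz lD' lD'
  have t4 := pair_angM_symm hz l2 lD'
  have s0 := s 0 (angM w) (euler (angM w))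
  have s1 := s 0 (euler w) (angM (euler (euler w)))
  have s2 := s 0 w (euler w)
  have s3 := s 0 (euler w) (euler (euler w))
  have s3' := s 1 (euler w) (euler (euler w))
  have s3'' := s 2 (euler w) (euler (euler w))
  have s4 := s 0 (euler (euler w)) (euler (euler (euler w)))
  have s5 := s 0 w (angM (euler w))
  have s6 := s 0 (euler w) (angM w)
  simp only [iteratedDeriv_zero] at s0 s1 s2 s3 s4 s5 s6
  rw [s0, c1] at mm
  rw [c1] at m01
  rw [c2] at m12
  have k4 : pair z (euler w) (euler (euler (euler (euler w)))) =
      (3 / 2) * pair (iteratedDeriv 1 z) (euler (euler w)) (euler (euler w))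
      - (1 / 2) * pair (iteratedDeriv 3 z) (euler w) (euler w) := by linarith
  have k3 : pair z (euler w) (euler (euler (euler w))) =
      - pair z (euler (euler w)) (euler (euler w))
      + (1 / 2) * pair (iteratedDeriv 2 z) (euler w) (euler w) := by linarith
  have k2 : pair z (euler w) (euler (euler w)) =
      - (1 / 2) * pair (iteratedDeriv 1 z) (euler w) (euler w) := by linarith
  have k0 : pair z (euler w) w = - (1 / 2) * pair (iteratedDeriv 1 z) w w := by linarith
  have a2 : pair z (euler w) (angM (euler (euler w))) =
      - (1 / 2) * pair (iteratedDeriv 1 z) (angM (euler w)) (euler w) := by linarith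
  have a0 : pair z (euler w) (angM w) = - (1 / 2) * pair (iteratedDeriv 1 z) (angM w) w := by
    linarith
  have a3 : pair z (euler w) (angM (angM w)) =
      - (1 / 2) * pair (iteratedDeriv 1 z) (angM w) (angM w) := by linarith
  rw [k4, k3, k2, k0, a2, a0, a3, ← t3]
  ring

end EnergyIdentities

section Equation

variable {n : ℕ} {V : Type*} [NormedAddCommGroup V]

/-- The potential energy density `‖x‖ ^ (2 a + 4) |u| ^ (p + 1)`. -/
def potDens (p a : ℝ) (u : Euc n → V) : Euc n → ℝ := twist (2 * a + 4) (fun x => ‖u x‖ ^ (p + 1))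

lemma potDens_nonneg (p a : ℝ) (u : Euc n → V) (x : Euc n) : 0 ≤ potDens p a u x := by
  simp only [potDens, twist, rad, smul_eq_mul]
  positivity

lemma potDens_eq_twist (p a b : ℝ) (u : Euc n → V) :
    potDens p a u = twist (2 * (a - b)) (potDens p b u) := by
  unfold potDens
  rw [twist_twist]
  ring_nf

variable [InnerProductSpace ℝ V]

lemma contDiff_norm_rpow_comp {p : ℝ} (hp : 1 < p) {u : Euc n → V} (hu : ContDiff ℝ 1 u) :
    ContDiff ℝ 1 (fun x => ‖u x‖ ^ (p + 1)) :=
  (contDiff_norm_rpow (by linarith)).comp hu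

lemma contDiffOn_potDens {p : ℝ} (hp : 1 < p) (a : ℝ) {u : Euc n → V} (hu : ContDiff ℝ 1 u) :
    ContDiffOn ℝ 1 (potDens p a u) (Punct n) :=
  (contDiff_norm_rpow_comp hp hu).contDiffOn.twist _

lemma linField_norm_rpow {p : ℝ} (hp : 1 < p) {u : Euc n → V} (hu : ContDiff ℝ 1 u)
    (A : Euc n →L[ℝ] Euc n) (x : Euc n) :
    linField A (fun x => ‖u x‖ ^ (p + 1)) x
      = (p + 1) * ‖u x‖ ^ (p - 1) * inner ℝ (u x) (linField A u x) := by
  have h := (hasFDerivAt_norm_rpow (u x) (by linarith : 1 < p + 1)).comp x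
    (hu.differentiable (by simp) x).hasFDerivAt
  simp only [linField]
  rw [show fderiv ℝ (fun x => ‖u x‖ ^ (p + 1)) x = _ from h.fderiv]
  simp [show p + 1 - 2 = p - 1 by ring]

lemma norm_rpow_mul_inner_self {p : ℝ} (hp : 1 < p) (v : V) :
    ‖v‖ ^ (p - 1) * inner ℝ v v = ‖v‖ ^ (p + 1) := by
  rw [real_inner_self_eq_norm_sq]
  by_cases h : v = 0
  · subst h
    have h1 : p + 1 ≠ 0 := by linarith
    simp [Real.zero_rpow h1]
  · rw [show p + 1 = p - 1 + 2 by ring, Real.rpow_add (norm_pos_iff.2 h)]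
    norm_cast

lemma rad_exp_add (a b : ℝ) (x : Euc n) :
    rad (fun t => Real.exp ((a + b) * t)) x
      = rad (fun t => Real.exp (a * t)) x * rad (fun t => Real.exp (b * t)) x := by
  simp only [rad, ← Real.exp_add]; ring_nf

/-- The Emden–Fowler form of the equation. -/
lemma cylOp_twist_eq {p : ℝ} {u : Euc n → V} (hu : ContDiff ℝ 4 u)
    (heq : ∀ x, lapV (lapV u) x = ‖u x‖ ^ (p - 1) • u x) (a : ℝ) :
    EqOn (cylOp (((n : ℝ) - 4) / 2 - a) (twist a u))
      (twist (a + 4) (fun x => ‖u x‖ ^ (p - 1) • u x)) (Punct n) := by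
  intro x hx
  have h := bilaplacian_twist (w := twist a u) (hu.contDiffOn.twist a) (((n : ℝ) - 4) / 2 - a)
  rw [show ((n : ℝ) - 4) / 2 - a - (n - 4) / 2 = -a by ring, twist_twist, neg_add_cancel,
    twist_zero] at h
  have h2 : lapV (lapV u) = fun x => ‖u x‖ ^ (p - 1) • u x := funext heq
  rw [h2] at h
  have h3 := h.twist (a + 4) hx
  rw [h3, twist_twist, show a + 4 + (-a - 4) = 0 by ring, twist_zero]

lemma inner_twist (a b : ℝ) (f g : Euc n → V) (x : Euc n) :
    inner ℝ (twist a f x) (twist b g x) = twist (a + b) (fun x => inner ℝ (f x) (g x)) x := by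
  simp only [twist, real_inner_smul_left, real_inner_smul_right, rad_exp_add, smul_eq_mul]
  ring

variable [NeZero n]

lemma pair_self_twist {p : ℝ} (hp : 1 < p) {u : Euc n → V} (hu : ContDiff ℝ 4 u)
    (heq : ∀ x, lapV (lapV u) x = ‖u x‖ ^ (p - 1) • u x) (a : ℝ) (z : ℝ → ℝ) :
    pair z (twist a u) (cylOp (((n : ℝ) - 4) / 2 - a) (twist a u)) = radInt z (potDens p a u) := by
  rw [pair_congr_right (cylOp_twist_eq hu heq a)]
  refine radInt_congr fun x _ => ?_
  rw [inner_twist]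
  simp only [potDens, twist, real_inner_smul_right, norm_rpow_mul_inner_self hp]
  ring_nf

lemma pair_euler_twist {p : ℝ} (hp : 1 < p) {u : Euc n → V} (hu : ContDiff ℝ 4 u)
    (heq : ∀ x, lapV (lapV u) x = ‖u x‖ ^ (p - 1) • u x) (a : ℝ) {z : ℝ → ℝ} (hz : IsCut z) :
    pair z (euler (twist a u)) (cylOp (((n : ℝ) - 4) / 2 - a) (twist a u)) =
      -(1 / (p + 1)) * radInt (iteratedDeriv 1 z) (potDens p a u)
      - (4 - a * (p - 1)) / (p + 1) * radInt z (potDens p a u) := by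
  have hu1 : ContDiff ℝ 1 u := hu.of_le (by norm_num)
  have hp1 : p + 1 ≠ 0 := by linarith
  have hq := contDiffOn_potDens hp a hu1
  have hD := radInt_euler (hz.contDiff 1) hz.compact hq
  have key : pair z (euler (twist a u)) (cylOp (((n : ℝ) - 4) / 2 - a) (twist a u)) =
      radInt z (fun x => (1 / (p + 1)) * euler (potDens p a u) x
        + (-((4 - a * (p - 1)) / (p + 1))) * potDens p a u x) := by
    rw [pair_congr_right (cylOp_twist_eq hu heq a), pair_congr_left (euler_twist hu1.contDiffOn a)]
    refine radInt_congr fun x hx => congrArg (rad z x * ·) ?_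
    have e1 : euler (potDens p a u) x = _ :=
      euler_twist (contDiff_norm_rpow_comp hp hu1).contDiffOn (2 * a + 4) hx
    rw [inner_twist, e1]
    have e2 : euler (fun x => ‖u x‖ ^ (p + 1)) x = _ := linField_norm_rpow hp hu1 _ x
    simp only [potDens, twist, smul_eq_mul, inner_add_left, real_inner_smul_left,
      real_inner_smul_right]
    rw [e2, ← norm_rpow_mul_inner_self hp (u x), show a + (a + 4) = 2 * a + 4 by ring,
      real_inner_comm (u x) (euler u x)]
    field_simp
    ring
  have c1 : ContinuousOn (fun x => (1 / (p + 1)) * euler (potDens p a u) x) (Punct n) :=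
    continuousOn_const.mul (hq.linField (k := 0) (by simp) _).continuousOn
  have c2 : ContinuousOn (fun x => (-((4 - a * (p - 1)) / (p + 1))) * potDens p a u x) (Punct n) :=
    continuousOn_const.mul hq.continuousOn
  refine key.trans ((radInt_add hz.continuous hz.compact c1 c2).trans ?_)
  rw [radInt_const_mul, radInt_const_mul, iteratedDeriv_one]
  linear_combination 1 / (p + 1) * hD

end Equation

section CutoffEnergy

variable {n : ℕ} {V : Type*} [NormedAddCommGroup V] [InnerProductSpace ℝ V]

lemma IsCut.mul {z z' : ℝ → ℝ} (hz : IsCut z) (hz' : IsCut z') : IsCut (fun t => z t * z' t) :=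
  ⟨hz.smooth.mul hz'.smooth, hz.compact.mul_right⟩

/-- Pairing with the weight `z⁽ⁱ⁾ z⁽ʲ⁾`. -/
def cutPair (z : ℝ → ℝ) (i j : ℕ) (f g : Euc n → V) : ℝ :=
  pair (fun t => iteratedDeriv i z t * iteratedDeriv j z t) f g

lemma cutPair_symm (z : ℝ → ℝ) (i j : ℕ) (f g : Euc n → V) :
    cutPair z i j f g = cutPair z j i f g := by
  simp only [cutPair, mul_comm]

lemma cutPair_comm (z : ℝ → ℝ) (i j : ℕ) (f g : Euc n → V) :
    cutPair z i j f g = cutPair z i j g f := pair_comm _ _ _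

lemma IsCut.hasDerivAt {z : ℝ → ℝ} (hz : IsCut z) (i : ℕ) (t : ℝ) :
    HasDerivAt (_root_.iteratedDeriv i z) (_root_.iteratedDeriv (i + 1) z t) t := by
  rw [iteratedDeriv_succ]
  exact (((hz.iteratedDeriv i).contDiff 1).differentiable (by simp) t).hasDerivAt

variable [NeZero n] {z : ℝ → ℝ}

lemma cutPair_euler (hz : IsCut z) (i j : ℕ) {f g : Euc n → V}
    (hf : ContDiffOn ℝ 1 f (Punct n)) (hg : ContDiffOn ℝ 1 g (Punct n)) :
    cutPair z i j (euler f) g + cutPair z i j f (euler g)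
      = - cutPair z (i + 1) j f g - cutPair z i (j + 1) f g := by
  have h := pair_euler ((hz.iteratedDeriv i).mul (hz.iteratedDeriv j)) hf hg
  have hd : deriv (fun t => iteratedDeriv i z t * iteratedDeriv j z t) = fun t =>
      iteratedDeriv (i + 1) z t * iteratedDeriv j z t
        + iteratedDeriv i z t * iteratedDeriv (j + 1) z t :=
    funext fun t => ((hz.hasDerivAt i t).mul (hz.hasDerivAt j t)).deriv
  rw [hd] at h
  have h1 := (hz.iteratedDeriv (i + 1)).mul (hz.iteratedDeriv j)
  have h2 := (hz.iteratedDeriv i).mul (hz.iteratedDeriv (j + 1))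
  unfold pair at h
  rw [radInt_add_left h1.continuous h1.compact h2.continuous h2.compact
    (hf.continuousOn.inner hg.continuousOn)] at h
  unfold cutPair pair
  linarith

lemma integral_norm_sq_sum (hz : IsCut z) {ι : Type*} [Fintype ι] (c : ι → ℝ) (k : ι → ℕ)
    {F : ι → Euc n → V} (hF : ∀ i, ContinuousOn (F i) (Punct n)) :
    ∫ x, (‖x‖ ^ n)⁻¹ * ‖∑ i, (c i * rad (iteratedDeriv (k i) z) x) • F i x‖ ^ 2
      = ∑ i, ∑ j, c i * c j * cutPair z (k i) (k j) (F i) (F j) := by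
  have hint : ∀ i j, Integrable (fun x => c i * c j *
      (rad (fun t => iteratedDeriv (k i) z t * iteratedDeriv (k j) z t) x •
        ((‖x‖ ^ n)⁻¹ * inner ℝ (F i x) (F j x)))) := fun i j => by
    have h1 := (hz.iteratedDeriv (k i)).mul (hz.iteratedDeriv (k j))
    exact (integrable_radInt h1.continuous h1.compact ((hF i).inner (hF j))).const_mul _
  have : ∀ i j, c i * c j * cutPair z (k i) (k j) (F i) (F j) = ∫ x, c i * c j *
      (rad (fun t => iteratedDeriv (k i) z t * iteratedDeriv (k j) z t) x •
        ((‖x‖ ^ n)⁻¹ * inner ℝ (F i x) (F j x))) := fun i j => by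
    rw [integral_const_mul]; rfl
  simp only [this]
  simp only [← integral_finsetSum _ fun j _ => hint _ j]
  rw [← integral_finsetSum _ fun i _ => integrable_finsetSum _ fun j _ => hint i j]
  refine integral_congr_ae (ae_of_all _ fun x => ?_)
  simp only [← real_inner_self_eq_norm_sq, sum_inner, inner_sum, Finset.mul_sum,
    real_inner_smul_left, real_inner_smul_right, rad, smul_eq_mul]
  exact Finset.sum_congr rfl fun i _ => Finset.sum_congr rfl fun j _ => by
    rw [real_inner_comm (F i x)]; ring

lemma integral_norm_sq_lapV_cut (hz : IsCut z) {w : Euc n → V} (hw : ContDiffOn ℝ 4 w (Punct n)) :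
    ∫ x, ‖lapV (twist (-(((n : ℝ) - 4) / 2)) (fun x => rad z x • w x)) x‖ ^ 2
      = ∫ x, (‖x‖ ^ n)⁻¹ * ‖rad z x • euler (euler w) x
        + (2 * (rad (iteratedDeriv 1 z) x + rad z x)) • euler w x
        + (rad (iteratedDeriv 2 z) x + 2 * rad (iteratedDeriv 1 z) x - nzero n * rad z x) • w x
        - rad z x • angM w x‖ ^ 2 := by
  refine integral_congr_ae ?_
  filter_upwards [ae_mem_punct] with x hx
  have d0 : ∀ t, HasDerivAt z (iteratedDeriv 1 z t) t := fun t => by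
    simpa using hz.hasDerivAt 0 t
  have d1 := hz.hasDerivAt 1
  have w3 : ContDiffOn ℝ 3 (euler w) (Punct n) := hw.linField (by norm_num) _
  have w1 : ContDiffOn ℝ 1 w (Punct n) := hw.of_le (by norm_num)
  have e1 := euler_rad_smul d0 w1
  have f4 : ContDiffOn ℝ 4 (fun x => rad z x • w x) (Punct n) :=
    (contDiffOn_rad (hz.contDiff 4)).smul hw
  have a1 : ContDiffOn ℝ 1 (fun x => rad z x • euler w x) (Punct n) :=
    (contDiffOn_rad (hz.contDiff 1)).smul (w3.of_le (by norm_num))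
  have a2 : ContDiffOn ℝ 1 (fun x => rad (iteratedDeriv 1 z) x • w x) (Punct n) :=
    (contDiffOn_rad ((hz.iteratedDeriv 1).contDiff 1)).smul w1
  have e2 : euler (euler (fun x => rad z x • w x)) x = euler (fun x => rad z x • euler w x) x
      + euler (fun x => rad (iteratedDeriv 1 z) x • w x) x :=
    ((e1.linField (ContinuousLinearMap.id ℝ (Euc n))) hx).trans
      (linField_add (a1.differentiableAt_punct le_rfl hx) (a2.differentiableAt_punct le_rfl hx))
  have e3 := euler_rad_smul d0 (w3.of_le (by norm_num) : ContDiffOn ℝ 1 (euler w) (Punct n)) hx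
  have e4 := euler_rad_smul d1 w1 hx
  have e5 := angM_rad_smul (hz.contDiff 1 |>.differentiable (by simp))
    (hw.of_le (by norm_num) : ContDiffOn ℝ 2 w (Punct n)) hx
  have e1' := e1 hx
  rw [lapV_twist (f4.of_le (by norm_num)) _ hx]
  simp only [twist] at *
  rw [e5, e2, e1', e3, e4, norm_smul, mul_pow, norm_eq_exp_log hx]
  congr 1
  · simp only [rad, Real.norm_eq_abs, sq_abs]
    rw [sq, ← Real.exp_add]
    ring_nf
  · congr 2
    simp only [nzero]
    match_scalars <;> ring

/-- The biharmonic energy of a cut-off field in Emden–Fowler coordinates. -/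
lemma energy_cut (hz : IsCut z) {w : Euc n → V} (hw : ContDiffOn ℝ 4 w (Punct n)) :
    ∫ x, ‖lapV (twist (-(((n : ℝ) - 4) / 2)) (fun x => rad z x • w x)) x‖ ^ 2
      = cutPair z 0 0 (euler (euler w)) (euler (euler w)) + cutPair z 0 0 (angM w) (angM w)
        + 2 * cutPair z 0 0 (angM (euler w)) (euler w)
        + (4 + 2 * nzero n) * cutPair z 0 0 (euler w) (euler w)
        + 2 * nzero n * cutPair z 0 0 (angM w) w + nzero n ^ 2 * cutPair z 0 0 w w
        + 2 * cutPair z 1 1 (euler w) (euler w) - 4 * cutPair z 0 2 (euler w) (euler w)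
        + cutPair z 0 4 w w - (4 + 2 * nzero n) * cutPair z 0 2 w w
        - 2 * cutPair z 0 2 (angM w) w := by
  rw [integral_norm_sq_lapV_cut hz hw]
  have w3 : ContDiffOn ℝ 3 (euler w) (Punct n) := hw.linField (by norm_num) _
  have w2 : ContDiffOn ℝ 2 (euler (euler w)) (Punct n) := w3.linField (by norm_num) _
  have wM : ContDiffOn ℝ 2 (angM w) (Punct n) := hw.angM (by norm_num)
  have l0 : ContDiffOn ℝ 1 w (Punct n) := hw.of_le (by norm_num)
  have l1 : ContDiffOn ℝ 1 (euler w) (Punct n) := w3.of_le (by norm_num)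
  have lM : ContDiffOn ℝ 1 (angM w) (Punct n) := wM.of_le (by norm_num)
  have key := integral_norm_sq_sum hz ![1, 2, 2, 1, 2, -nzero n, -1] ![0, 1, 0, 2, 1, 0, 0]
    (F := ![euler (euler w), euler w, euler w, w, w, w, angM w]) (by
      intro i
      fin_cases i
      exacts [w2.continuousOn, w3.continuousOn, w3.continuousOn, hw.continuousOn, hw.continuousOn,
        hw.continuousOn, wM.continuousOn])
  have lhs : ∀ x : Euc n, (∑ i : Fin 7, ((![1, 2, 2, 1, 2, -nzero n, -1] : Fin 7 → ℝ) i *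
      rad (iteratedDeriv ((![0, 1, 0, 2, 1, 0, 0] : Fin 7 → ℕ) i) z) x) •
      (![euler (euler w), euler w, euler w, w, w, w, angM w] : Fin 7 → Euc n → V) i x)
      = rad z x • euler (euler w) x
        + (2 * (rad (iteratedDeriv 1 z) x + rad z x)) • euler w x
        + (rad (iteratedDeriv 2 z) x + 2 * rad (iteratedDeriv 1 z) x - nzero n * rad z x) • w x
        - rad z x • angM w x := by
    intro x
    simp only [Fin.sum_univ_seven, Fin.isValue, Matrix.cons_val, iteratedDeriv_zero]
    module
  simp only [lhs] at key
  rw [key]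
  simp only [Fin.sum_univ_seven, Fin.isValue, Matrix.cons_val]
  have hM1 : ∀ i j (g : Euc n → V), cutPair z i j (euler (angM w)) g
      = cutPair z i j (angM (euler w)) g := fun i j g =>
    pair_congr_left (euler_angM (hw.of_le (by norm_num)))
  have hMs : ∀ i j, cutPair z i j (angM (euler w)) w = cutPair z i j (angM w) (euler w) :=
    fun i j => (pair_angM_symm ((hz.iteratedDeriv i).mul (hz.iteratedDeriv j))
      (w3.of_le (by norm_num)) (hw.of_le (by norm_num))).trans (pair_comm _ _ _)
  have r1 := cutPair_euler hz 0 0 l1 l1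
  have r2 := cutPair_euler hz 0 0 lM l0
  have r3 := cutPair_euler hz 0 0 lM l1
  have r4 := cutPair_euler hz 0 1 l0 l0
  have r5 := cutPair_euler hz 0 1 l0 l1
  have r6 := cutPair_euler hz 0 1 l1 l1
  have r7 := cutPair_euler hz 0 2 l0 l1
  have r8 := cutPair_euler hz 0 3 l0 l0
  have r9 := cutPair_euler hz 1 1 l0 l0
  have r10 := cutPair_euler hz 1 2 l0 l0
  have r11 := cutPair_euler hz 0 0 l0 l0
  have r12 := cutPair_euler hz 0 0 l0 l1
  rw [hM1] at r2 r3
  rw [hMs] at r2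
  norm_num only at *
  rw [cutPair_symm z 1 0] at *
  simp only [cutPair_symm z 1 0, cutPair_symm z 2 0, cutPair_symm z 2 1,
    cutPair_comm z _ _ (euler w) w, cutPair_comm z _ _ (euler (euler w)) w,
    cutPair_comm z _ _ (euler (euler w)) (euler w),
    cutPair_comm z _ _ (euler w) (angM w), cutPair_comm z _ _ (euler (euler w)) (angM w),
    cutPair_comm z _ _ w (angM w)] at *
  linear_combination 2 * r1 - 2 * r2 - 2 * r3 + 4 * r4 + 4 * r5 + 2 * r6 + 2 * r7 - r8
    + 2 * r9 + r10 + nzero n * (-2 * r11 - 2 * r12)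

/-- The stability inequality tested against `C⁴` vector fields. -/
def VStable (p : ℝ) (u : Euc n → V) (S : Set (Euc n)) : Prop :=
  ∀ φ : Euc n → V, ContDiff ℝ 4 φ → HasCompactSupport φ → tsupport φ ⊆ S →
    (∫ x, ‖u x‖ ^ (p - 1) * ‖φ x‖ ^ 2) + (p - 1) * ∫ x, ‖u x‖ ^ (p - 3) * inner ℝ (u x) (φ x) ^ 2
      ≤ ∫ x, ‖lapV φ x‖ ^ 2

lemma norm_rpow_mul_sq {p : ℝ} (hp : 1 < p) (v : V) (ρ : ℝ) :
    ‖v‖ ^ (p - 1) * ‖ρ • v‖ ^ 2 = ρ ^ 2 * ‖v‖ ^ (p + 1) := by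
  rw [← norm_rpow_mul_inner_self hp, real_inner_self_eq_norm_sq, norm_smul, mul_pow,
    Real.norm_eq_abs, sq_abs]
  ring

lemma norm_rpow_mul_inner_sq {p : ℝ} (hp : 1 < p) (v : V) (ρ : ℝ) :
    ‖v‖ ^ (p - 3) * inner ℝ v (ρ • v) ^ 2 = ρ ^ 2 * ‖v‖ ^ (p + 1) := by
  rw [real_inner_smul_right, real_inner_self_eq_norm_sq]
  by_cases h : v = 0
  · subst h
    have h1 : p + 1 ≠ 0 := by linarith
    simp [Real.zero_rpow h1]
  · rw [show p + 1 = p - 3 + 4 by ring, Real.rpow_add (norm_pos_iff.2 h)]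
    have : ‖v‖ ^ (4 : ℝ) = ‖v‖ ^ 4 := by norm_cast
    rw [this]
    ring

lemma stability_cut {p : ℝ} (hp : 1 < p) {u : Euc n → V} (hu : ContDiff ℝ 4 u) {R : ℝ}
    (hst : VStable p u (closure (ball (0 : Euc n) R))ᶜ) {A : ℝ} (hA : 0 < A) (hR : R < Real.exp A)
    (hz : IsCut z) (hzA : ∀ t, z t ≠ 0 → A ≤ t) (γ : ℝ) :
    p * radInt (fun t => z t * z t) (potDens p γ u)
      ≤ ∫ x, ‖lapV (twist (-(((n : ℝ) - 4) / 2)) (fun x => rad z x • twist γ u x)) x‖ ^ 2 := by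
  set b : ℝ := -(((n : ℝ) - 4) / 2) with hb
  set ζ : ℝ → ℝ := fun t => z t * Real.exp ((b + γ) * t) with hζ
  have hφ : twist b (fun x => rad z x • twist γ u x) = fun x => rad ζ x • u x := by
    ext1 x
    simp only [twist, smul_smul, hζ]
    rw [show rad (fun t => z t * Real.exp ((b + γ) * t)) x
      = rad z x * rad (fun t => Real.exp ((b + γ) * t)) x from rfl, rad_exp_add]
    congr 1
    ring
  have hz0 : z 0 = 0 := by
    by_contra h
    exact absurd (hzA 0 h) (not_le.2 hA)
  have hζc : HasCompactSupport ζ := hz.compact.mul_right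
  have hsm : ContDiff ℝ 4 (fun x => rad ζ x • u x) :=
    contDiff_rad_smul ((hz.contDiff 4).mul (contDiff_exp_mul _)) hζc hu.contDiffOn
      (by simp [hz0])
  have hsupp : tsupport (fun x => rad ζ x • u x) ⊆ (closure (ball (0 : Euc n) R))ᶜ := by
    have h1 : tsupport (fun x => rad ζ x • u x) ⊆ {x | Real.exp A ≤ ‖x‖} := by
      refine closure_minimal (fun x hx => ?_) (isClosed_le continuous_const continuous_norm)
      have hz1 : z (Real.log ‖x‖) ≠ 0 := by
        intro h
        exact hx (by simp [rad, hζ, h])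
      have hx0 : x ≠ 0 := by
        rintro rfl
        simp [hz0] at hz1
      exact (Real.le_log_iff_exp_le (norm_pos_iff.2 hx0)).1 (hzA _ hz1)
    intro x hx hx'
    have h2 := closure_ball_subset_closedBall hx'
    rw [mem_closedBall_zero_iff] at h2
    exact absurd (h1 hx) (not_le.2 (h2.trans_lt hR))
  have h := hst _ hsm (hasCompactSupport_rad_smul hζc _) hsupp
  simp only [norm_rpow_mul_sq hp, norm_rpow_mul_inner_sq hp] at h
  have hJ : ∫ x, rad ζ x ^ 2 * ‖u x‖ ^ (p + 1)
      = radInt (fun t => z t * z t) (potDens p γ u) := by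
    refine integral_congr_ae ?_
    filter_upwards [ae_mem_punct] with x hx
    rw [norm_eq_exp_log hx]
    simp only [potDens, twist, rad, hζ, smul_eq_mul]
    have e : Real.exp ((b + γ) * Real.log ‖x‖) * Real.exp ((b + γ) * Real.log ‖x‖)
        = Real.exp (-(n : ℝ) * Real.log ‖x‖) * Real.exp ((2 * γ + 4) * Real.log ‖x‖) := by
      rw [← Real.exp_add, ← Real.exp_add, hb]
      ring_nf
    linear_combination (z (Real.log ‖x‖)) ^ 2 * ‖u x‖ ^ (p + 1) * e
  rw [hφ]
  rw [hJ] at h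
  linarith

end CutoffEnergy

section Mollification

variable {n : ℕ} {V : Type*} [NormedAddCommGroup V] [InnerProductSpace ℝ V]

lemma two_le_smooth : (2 : WithTop ℕ∞) ≤ ((⊤ : ℕ∞) : WithTop ℕ∞) := by
  have h : ∀ k : ℕ, (k : WithTop ℕ∞) ≤ ((⊤ : ℕ∞) : WithTop ℕ∞) := fun k => by
    exact_mod_cast le_top
  exact h 2

lemma continuous_fderiv_fderiv_apply {g : Euc n → V} (hg : ContDiff ℝ 2 g) (e : Euc n) :
    Continuous (fun y => fderiv ℝ (fderiv ℝ g) y e e) :=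
  (((hg.fderiv_right (m := 1) (by norm_num)).continuous_fderiv one_ne_zero).clm_apply
    continuous_const).clm_apply continuous_const

lemma hasCompactSupport_fderiv_fderiv_apply {g : Euc n → V} (hgc : HasCompactSupport g)
    (e : Euc n) : HasCompactSupport (fun y => fderiv ℝ (fderiv ℝ g) y e e) :=
  ((hgc.fderiv ℝ).fderiv_apply ℝ e).comp_left (g := fun L : Euc n →L[ℝ] V => L e) (by simp)

lemma continuous_lapV {g : Euc n → V} (hg : ContDiff ℝ 2 g) : Continuous (lapV g) :=
  continuous_finsetSum _ fun _ _ => continuous_fderiv_fderiv_apply hg _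

lemma lapV_eq_zero_of_notMem_tsupport {g : Euc n → V} {x : Euc n} (hx : x ∉ tsupport g) :
    lapV g x = 0 := by
  have h : fderiv ℝ (fderiv ℝ g) x = 0 := by
    by_contra h
    exact hx (tsupport_fderiv_subset ℝ (support_fderiv_subset ℝ h))
  simp [lapV, h]

open scoped Convolution in
/-- Mollification of `g` by a normalized bump function. -/
def mollify (η : ContDiffBump (0 : Euc n)) (g : Euc n → V) : Euc n → V :=
  (η.normed volume) ⋆[ContinuousLinearMap.lsmul ℝ ℝ] g

lemma contDiff_mollify (η : ContDiffBump (0 : Euc n)) {g : Euc n → V} (hg : Continuous g) :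
    ContDiff ℝ (⊤ : ℕ∞) (mollify η g) :=
  η.hasCompactSupport_normed.contDiff_convolution_left _ η.contDiff_normed hg.locallyIntegrable

lemma fderiv_mollify (η : ContDiffBump (0 : Euc n)) {g : Euc n → V} (hg : ContDiff ℝ 1 g)
    (hgc : HasCompactSupport g) (e : Euc n) :
    (fun x => fderiv ℝ (mollify η g) x e) = mollify η (fun x => fderiv ℝ g x e) := by
  ext1 x
  have hη : LocallyIntegrable (η.normed volume) (volume : Measure (Euc n)) :=
    η.continuous_normed.locallyIntegrable
  have h := (hgc.hasFDerivAt_convolution_right (ContinuousLinearMap.lsmul ℝ ℝ) hη hg x).fderiv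
  unfold mollify
  rw [h, convolution_precompR_apply _ hη (hgc.fderiv ℝ) (hg.continuous_fderiv one_ne_zero)]

lemma fderiv_fderiv_apply {g : Euc n → V} (hg : ContDiff ℝ 2 g) (e : Euc n) (x : Euc n) :
    fderiv ℝ (fderiv ℝ g) x e e = fderiv ℝ (fun y => fderiv ℝ g y e) x e := by
  have h : DifferentiableAt ℝ (fderiv ℝ g) x :=
    ((hg.fderiv_right (m := 1) (by norm_num)).differentiable (by simp)) x
  rw [fderiv_clm_apply h (differentiableAt_const e)]
  simp

lemma lapV_mollify (η : ContDiffBump (0 : Euc n)) {g : Euc n → V} (hg : ContDiff ℝ 2 g)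
    (hgc : HasCompactSupport g) (x : Euc n) :
    lapV (mollify η g) x = ∑ k : Fin n, mollify η
      (fun y => fderiv ℝ (fderiv ℝ g) y (EuclideanSpace.single k 1) (EuclideanSpace.single k 1)) x := by
  unfold lapV
  refine Finset.sum_congr rfl fun k _ => ?_
  have h1 : ContDiff ℝ 1 (fun y => fderiv ℝ g y (EuclideanSpace.single k 1)) :=
    (hg.fderiv_right (m := 1) (by norm_num)).clm_apply contDiff_const
  have hc : HasCompactSupport (fun y => fderiv ℝ g y (EuclideanSpace.single k 1)) :=
    hgc.fderiv_apply ℝ _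
  rw [fderiv_fderiv_apply ((contDiff_mollify η hg.continuous).of_le
    two_le_smooth),
    fderiv_mollify η (hg.of_le (by norm_num)) hgc]
  have h2 := congrFun (fderiv_mollify η h1 hc (EuclideanSpace.single k 1)) x
  rw [h2]
  congr 1
  ext1 y
  rw [fderiv_fderiv_apply hg]

lemma exists_forall_norm_mollify_sub_le [CompleteSpace V] {g : Euc n → V} (hg : Continuous g)
    (hgc : HasCompactSupport g) {ε : ℝ} (hε : 0 < ε) :
    ∃ r > 0, ∀ η : ContDiffBump (0 : Euc n), η.rOut ≤ r → ∀ x, ‖mollify η g x - g x‖ ≤ ε := by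
  obtain ⟨r, hr, h⟩ := Metric.uniformContinuous_iff.1
    (hgc.uniformContinuous_of_continuous hg) ε hε
  refine ⟨r, hr, fun η hη x => ?_⟩
  rw [← dist_eq_norm]
  refine η.dist_normed_convolution_le hg.aestronglyMeasurable fun y hy => (h ?_).le
  exact (mem_ball.1 hy).trans_le hη

lemma tsupport_mollify_subset (η : ContDiffBump (0 : Euc n)) (g : Euc n → V) {r : ℝ}
    (hr : η.rOut ≤ r) : tsupport (mollify η g) ⊆ cthickening r (tsupport g) := by
  refine closure_minimal (fun x hx => ?_) isClosed_cthickening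
  obtain ⟨a, ha, b, hb, rfl⟩ := support_convolution_subset_swap _ hx
  rw [η.support_normed_eq, mem_ball_zero_iff] at hb
  refine mem_cthickening_of_dist_le _ a r _ (subset_tsupport _ ha) ?_
  simpa [dist_eq_norm] using (hb.le.trans hr)

/-- Smooth approximation of a `C²` compactly supported field, uniformly together with its
Laplacian. -/
lemma exists_smooth_approx [CompleteSpace V] {g : Euc n → V} (hg : ContDiff ℝ 2 g) (hgc : HasCompactSupport g)
    {S : Set (Euc n)} (hS : IsOpen S) (hgS : tsupport g ⊆ S) :
    ∃ K : Set (Euc n), IsCompact K ∧ K ⊆ S ∧ ∀ ε > 0, ∃ f : Euc n → V, ContDiff ℝ (⊤ : ℕ∞) f ∧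
      tsupport f ⊆ K ∧ ∀ x, ‖f x - g x‖ ≤ ε ∧ ‖lapV f x - lapV g x‖ ≤ n * ε := by
  obtain ⟨r, hr, hrS⟩ := hgc.isCompact.exists_cthickening_subset_open hS hgS
  refine ⟨cthickening r (tsupport g), hgc.isCompact.cthickening, hrS, fun ε hε => ?_⟩
  set G : Fin n → Euc n → V := fun k y =>
    fderiv ℝ (fderiv ℝ g) y (EuclideanSpace.single k 1) (EuclideanSpace.single k 1) with hG
  have hGc : ∀ k, Continuous (G k) := fun k => continuous_fderiv_fderiv_apply hg _
  have hGs : ∀ k, HasCompactSupport (G k) := fun k => hasCompactSupport_fderiv_fderiv_apply hgc _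
  obtain ⟨r0, hr0, h0⟩ := exists_forall_norm_mollify_sub_le hg.continuous hgc hε
  choose r1 hr1 h1 using fun k => exists_forall_norm_mollify_sub_le (hGc k) (hGs k) hε
  obtain ⟨ρ, hρ, hρle⟩ : ∃ ρ > 0, ρ ≤ r ∧ ρ ≤ r0 ∧ ∀ k, ρ ≤ r1 k := by
    have : ∀ᶠ ρ in nhdsWithin (0 : ℝ) (Ioi 0), ρ ≤ r ∧ ρ ≤ r0 ∧ ∀ k, ρ ≤ r1 k := by
      have aux : ∀ s : ℝ, 0 < s → ∀ᶠ ρ in nhdsWithin (0 : ℝ) (Ioi 0), ρ ≤ s := fun s hs =>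
        mem_nhdsWithin_of_mem_nhds (Iic_mem_nhds hs)
      exact (aux r hr).and ((aux r0 hr0).and (eventually_all.2 fun k => aux _ (hr1 k)))
    obtain ⟨ρ, h, h'⟩ := (this.and self_mem_nhdsWithin).exists
    exact ⟨ρ, h', h⟩
  let η : ContDiffBump (0 : Euc n) := ⟨ρ / 2, ρ, by positivity, by linarith⟩
  refine ⟨mollify η g, contDiff_mollify η hg.continuous, tsupport_mollify_subset η g hρle.1,
    fun x => ⟨h0 η hρle.2.1 x, ?_⟩⟩
  rw [lapV_mollify η hg hgc, lapV, ← Finset.sum_sub_distrib]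
  refine (norm_sum_le _ _).trans ?_
  refine (Finset.sum_le_sum fun k _ => h1 k η (hρle.2.2 k) x).trans ?_
  simp

end Mollification

section Stability

variable {n m : ℕ} {p : ℝ} {u : Euc n → EuclideanSpace ℝ (Fin m)}

lemma lapV_apply {φ : Euc n → EuclideanSpace ℝ (Fin m)} (hφ : ContDiff ℝ 2 φ) (i : Fin m)
    (x : Euc n) : lapV φ x i = lap (fun y => φ y i) x := by
  have h1 : fderiv ℝ (fun y => φ y i)
      = fun y => (EuclideanSpace.proj (𝕜 := ℝ) i).comp (fderiv ℝ φ y) := funext fun y =>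
    ((EuclideanSpace.proj (𝕜 := ℝ) i).hasFDerivAt.comp y
      ((hφ.differentiable (by simp)) y).hasFDerivAt).fderiv
  have h2 : ∀ y, fderiv ℝ (fun y => (EuclideanSpace.proj (𝕜 := ℝ) i).comp (fderiv ℝ φ y)) y
      = (ContinuousLinearMap.compL ℝ (Euc n) _ ℝ (EuclideanSpace.proj (𝕜 := ℝ) i)).comp
        (fderiv ℝ (fderiv ℝ φ) y) := fun y =>
    ((ContinuousLinearMap.compL ℝ (Euc n) _ ℝ (EuclideanSpace.proj (𝕜 := ℝ) i)).hasFDerivAt.comp y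
      (((hφ.fderiv_right (m := 1) (by norm_num)).differentiable (by simp)) y).hasFDerivAt).fderiv
  simp only [lapV, lap, iteratedFDeriv_two_apply, h1, h2]
  simp

lemma norm_rpow_mul_inner_sq_le (p : ℝ) (v φ : EuclideanSpace ℝ (Fin m)) :
    ‖v‖ ^ (p - 3) * inner ℝ v φ ^ 2 ≤ ‖v‖ ^ (p - 1) * ‖φ‖ ^ 2 := by
  by_cases h : v = 0
  · subst h
    rw [inner_zero_left, sq (0 : ℝ), mul_zero, mul_zero]
    positivity
  · have h1 : inner ℝ v φ ^ 2 ≤ (‖v‖ * ‖φ‖) ^ 2 := by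
      rw [← sq_abs]
      exact pow_le_pow_left₀ (abs_nonneg _) (abs_real_inner_le_norm v φ) 2
    calc ‖v‖ ^ (p - 3) * inner ℝ v φ ^ 2 ≤ ‖v‖ ^ (p - 3) * (‖v‖ * ‖φ‖) ^ 2 := by gcongr
      _ = ‖v‖ ^ (p - 1) * ‖φ‖ ^ 2 := by
        rw [show p - 1 = p - 3 + 2 by ring, Real.rpow_add (norm_pos_iff.2 h)]
        norm_cast
        ring

lemma continuous_norm_rpow (hp : 1 < p) (hu : Continuous u) :
    Continuous (fun x => ‖u x‖ ^ (p - 1)) :=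
  hu.norm.rpow_const fun _ => Or.inr (by linarith)

lemma Stable2.smooth_vector {S : Set (Euc n)} (h : Stable2 n m p u S) (hp : 1 < p)
    (hu : Continuous u) {φ : Euc n → EuclideanSpace ℝ (Fin m)} (hφ : ContDiff ℝ (⊤ : ℕ∞) φ)
    (hc : HasCompactSupport φ) (hS : tsupport φ ⊆ S) :
    (∫ x, ‖u x‖ ^ (p - 1) * ‖φ x‖ ^ 2) + (p - 1) * ∫ x, ‖u x‖ ^ (p - 3) * inner ℝ (u x) (φ x) ^ 2
      ≤ ∫ x, ‖lapV φ x‖ ^ 2 := by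
  have hφ2 : ContDiff ℝ 2 φ := hφ.of_le two_le_smooth
  have hci : ∀ i, HasCompactSupport (fun x => φ x i) := fun i =>
    hc.comp_left (g := fun v : EuclideanSpace ℝ (Fin m) => v i) (by simp)
  have hsi : ∀ i, ContDiff ℝ (⊤ : ℕ∞) (fun x => φ x i) := fun i =>
    (EuclideanSpace.proj (𝕜 := ℝ) i).contDiff.comp hφ
  have hsu : ∀ i, tsupport (fun x => φ x i) ⊆ tsupport φ := fun i =>
    closure_mono fun x hx h0 => hx (by simp [h0])
  have key := h (fun i x => φ x i) hsi hci fun i => (hsu i).trans hS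
  have hucont := continuous_norm_rpow hp hu
  have c1 : ∀ i, Integrable (fun x => ‖u x‖ ^ (p - 1) * φ x i ^ 2) := fun i =>
    (hucont.mul ((hsi i).continuous.pow 2)).integrable_of_hasCompactSupport
      ((hci i).mono fun x hx h0 => hx (by simp [h0]))
  have c2 : ∀ i j, Integrable
      (fun x => ‖u x‖ ^ (p - 3) * u x i * u x j * φ x i * φ x j) := fun i j => by
    have hb : Integrable (fun x => ‖u x‖ ^ (p - 1) * (‖φ x i‖ * ‖φ x j‖)) :=
      (hucont.mul ((hsi i).continuous.norm.mul (hsi j).continuous.norm)).integrable_of_hasCompactSupport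
        ((hci i).mono fun x hx h0 => hx (by simp [h0]))
    refine hb.mono' ?_ (ae_of_all _ fun x => ?_)
    · have hui : ∀ i, Measurable (fun x => u x i) := fun i =>
        ((EuclideanSpace.proj (𝕜 := ℝ) i).continuous.comp hu).measurable
      exact (((((hu.norm.measurable.pow_const _).mul (hui i)).mul (hui j)).mul
        (hsi i).continuous.measurable).mul (hsi j).continuous.measurable).aestronglyMeasurable
    · rw [norm_mul, norm_mul, norm_mul, norm_mul, Real.norm_of_nonneg (by positivity), ← mul_assoc]
      gcongr
      by_cases h0 : u x = 0
      · simp only [h0, PiLp.zero_apply, norm_zero, mul_zero]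
        positivity
      · calc ‖u x‖ ^ (p - 3) * ‖u x i‖ * ‖u x j‖ ≤ ‖u x‖ ^ (p - 3) * ‖u x‖ * ‖u x‖ := by
              gcongr <;> exact PiLp.norm_apply_le _ _
          _ = ‖u x‖ ^ (p - 1) := by
              rw [show p - 1 = p - 3 + 2 by ring, Real.rpow_add (norm_pos_iff.2 h0)]
              norm_cast
              ring
  have c3 : ∀ i, Integrable (fun x => lap (fun y => φ y i) x ^ 2) := fun i => by
    simp only [← lapV_apply hφ2]
    refine (((EuclideanSpace.proj (𝕜 := ℝ) i).continuous.comp (continuous_lapV hφ2)).pow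
      2).integrable_of_hasCompactSupport (HasCompactSupport.intro hc fun x hx => ?_)
    simp [lapV_eq_zero_of_notMem_tsupport hx]
  rw [← integral_finsetSum _ fun i _ => c1 i] at key
  simp only [← integral_finsetSum _ fun j _ => c2 _ j] at key
  rw [← integral_finsetSum _ fun i _ => integrable_finsetSum _ fun j _ => c2 i j,
    ← integral_finsetSum _ fun i _ => c3 i] at key
  have e1 : ∀ x, ‖u x‖ ^ (p - 1) * ‖φ x‖ ^ 2 = ∑ i, ‖u x‖ ^ (p - 1) * φ x i ^ 2 := fun x => by
    rw [EuclideanSpace.real_norm_sq_eq, Finset.mul_sum]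
  have e2 : ∀ x, ‖u x‖ ^ (p - 3) * inner ℝ (u x) (φ x) ^ 2
      = ∑ i, ∑ j, ‖u x‖ ^ (p - 3) * u x i * u x j * φ x i * φ x j := fun x => by
    rw [PiLp.inner_apply, sq, Finset.sum_mul_sum, Finset.mul_sum]
    refine Finset.sum_congr rfl fun i _ => ?_
    rw [Finset.mul_sum]
    refine Finset.sum_congr rfl fun j _ => ?_
    simp only [RCLike.inner_apply, conj_trivial]
    ring
  have e3 : ∀ x, ‖lapV φ x‖ ^ 2 = ∑ i, lap (fun y => φ y i) x ^ 2 := fun x => by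
    rw [EuclideanSpace.real_norm_sq_eq]
    simp only [lapV_apply hφ2]
  simp only [e1, e2, e3]
  exact key

/-- Stability against smooth scalar families implies stability against `C⁴` vector fields. -/
lemma Stable2.vStable {S : Set (Euc n)} (h : Stable2 n m p u S) (hp : 1 < p)
    (hu : Continuous u) (hS : IsOpen S) : VStable p u S := by
  intro φ hφ hc hφS
  have hφ2 : ContDiff ℝ 2 φ := hφ.of_le (by norm_num)
  obtain ⟨K, hK, hKS, happ⟩ := exists_smooth_approx hφ2 hc hS hφS
  choose f hfs hfK hf using fun k : ℕ => happ (1 / ((k : ℝ) + 1)) (by positivity)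
  have hfc : ∀ k, HasCompactSupport (f k) := fun k =>
    hK.of_isClosed_subset (isClosed_tsupport _) (hfK k)
  have hlim0 : Tendsto (fun k : ℕ => 1 / ((k : ℝ) + 1)) atTop (nhds 0) :=
    tendsto_one_div_add_atTop_nhds_zero_nat
  have hle1 : ∀ k : ℕ, 1 / ((k : ℝ) + 1) ≤ 1 := fun k => by
    rw [div_le_one (by positivity)]
    linarith [(Nat.cast_nonneg k : (0 : ℝ) ≤ k)]
  have l1 : ∀ x, Tendsto (fun k => f k x) atTop (nhds (φ x)) := fun x =>
    tendsto_iff_norm_sub_tendsto_zero.2 (squeeze_zero (fun _ => norm_nonneg _)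
      (fun k => (hf k x).1) hlim0)
  have l2 : ∀ x, Tendsto (fun k => lapV (f k) x) atTop (nhds (lapV φ x)) := fun x =>
    tendsto_iff_norm_sub_tendsto_zero.2 (squeeze_zero (fun _ => norm_nonneg _)
      (fun k => (hf k x).2) (by simpa using hlim0.const_mul (n : ℝ)))
  have b1 : ∀ k x, ‖f k x‖ ≤ ‖φ x‖ + 1 := fun k x => by
    have := norm_le_norm_add_norm_sub' (f k x) (φ x)
    linarith [(hf k x).1, hle1 k]
  have b2 : ∀ k x, ‖lapV (f k) x‖ ≤ ‖lapV φ x‖ + n := fun k x => by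
    have := norm_le_norm_add_norm_sub' (lapV (f k) x) (lapV φ x)
    have h1 : (n : ℝ) * (1 / ((k : ℝ) + 1)) ≤ n * 1 := by gcongr; exact hle1 k
    linarith [(hf k x).2]
  have z1 : ∀ k x, x ∉ K → f k x = 0 := fun k x hx =>
    image_eq_zero_of_notMem_tsupport fun h' => hx (hfK k h')
  have z2 : ∀ k x, x ∉ K → lapV (f k) x = 0 := fun k x hx =>
    lapV_eq_zero_of_notMem_tsupport fun h' => hx (hfK k h')
  have hucont := continuous_norm_rpow hp hu
  have hf2 : ∀ k, ContDiff ℝ 2 (f k) := fun k => (hfs k).of_le two_le_smooth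
  have I1 : Integrable (K.indicator fun x => ‖u x‖ ^ (p - 1) * (‖φ x‖ + 1) ^ 2) :=
    ((hucont.mul ((hφ.continuous.norm.add continuous_const).pow 2)).continuousOn.integrableOn_compact
      hK).integrable_indicator hK.measurableSet
  have I2 : Integrable (K.indicator fun x => (‖lapV φ x‖ + n) ^ 2) :=
    ((((continuous_lapV hφ2).norm.add continuous_const).pow 2).continuousOn.integrableOn_compact
      hK).integrable_indicator hK.measurableSet
  have hbd : ∀ k x, ‖u x‖ ^ (p - 1) * ‖f k x‖ ^ 2
      ≤ K.indicator (fun x => ‖u x‖ ^ (p - 1) * (‖φ x‖ + 1) ^ 2) x := fun k x => by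
    by_cases hx : x ∈ K
    · rw [indicator_of_mem hx]
      have := b1 k x
      gcongr
    · rw [indicator_of_notMem hx, z1 k x hx]
      simp
  have t1 : Tendsto (fun k => ∫ x, ‖u x‖ ^ (p - 1) * ‖f k x‖ ^ 2) atTop
      (nhds (∫ x, ‖u x‖ ^ (p - 1) * ‖φ x‖ ^ 2)) := by
    refine tendsto_integral_of_dominated_convergence _ (fun k => ?_) I1 (fun k => ?_) ?_
    · exact (hucont.mul ((hfs k).continuous.norm.pow 2)).aestronglyMeasurable
    · refine ae_of_all _ fun x => ?_
      rw [Real.norm_of_nonneg (by positivity)]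
      exact hbd k x
    · exact ae_of_all _ fun x => ((l1 x).norm.pow 2).const_mul _
  have t2 : Tendsto (fun k => ∫ x, ‖u x‖ ^ (p - 3) * inner ℝ (u x) (f k x) ^ 2) atTop
      (nhds (∫ x, ‖u x‖ ^ (p - 3) * inner ℝ (u x) (φ x) ^ 2)) := by
    refine tendsto_integral_of_dominated_convergence _ (fun k => ?_) I1 (fun k => ?_) ?_
    · exact ((hu.norm.measurable.pow_const _).mul
        ((hu.inner (hfs k).continuous).pow 2).measurable).aestronglyMeasurable
    · refine ae_of_all _ fun x => ?_
      rw [Real.norm_of_nonneg (by positivity)]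
      exact (norm_rpow_mul_inner_sq_le p _ _).trans (hbd k x)
    · exact ae_of_all _ fun x => ((tendsto_const_nhds.inner (l1 x)).pow 2).const_mul _
  have t3 : Tendsto (fun k => ∫ x, ‖lapV (f k) x‖ ^ 2) atTop (nhds (∫ x, ‖lapV φ x‖ ^ 2)) := by
    refine tendsto_integral_of_dominated_convergence _ (fun k => ?_) I2 (fun k => ?_) ?_
    · exact ((continuous_lapV (hf2 k)).norm.pow 2).aestronglyMeasurable
    · refine ae_of_all _ fun x => ?_
      rw [Real.norm_of_nonneg (by positivity)]
      by_cases hx : x ∈ K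
      · rw [indicator_of_mem hx]
        have := b2 k x
        gcongr
      · rw [indicator_of_notMem hx, z2 k x hx]
        simp
    · exact ae_of_all _ fun x => (l2 x).norm.pow 2
  exact le_of_tendsto_of_tendsto' (t1.add (t2.const_mul _)) t3 fun k =>
    h.smooth_vector hp hu (hfs k) (hfc k) ((hfK k).trans hKS)

end Stability

section Stretch

/-- Affine rescaling of a weight. -/
def stretch (F : ℝ → ℝ) (s l t : ℝ) : ℝ := F ((t - s) / l)

lemma contDiff_stretch {F : ℝ → ℝ} (hF : ContDiff ℝ (⊤ : ℕ∞) F) (s l : ℝ) :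
    ContDiff ℝ (⊤ : ℕ∞) (stretch F s l) :=
  hF.comp ((contDiff_id.sub contDiff_const).div_const l)

lemma iteratedDeriv_stretch {F : ℝ → ℝ} (hF : ContDiff ℝ (⊤ : ℕ∞) F) (s l : ℝ) (k : ℕ) (t : ℝ) :
    iteratedDeriv k (stretch F s l) t = l⁻¹ ^ k * stretch (iteratedDeriv k F) s l t := by
  have h1 : stretch F s l = fun t => (fun y => F (l⁻¹ * y)) (t - s) := by
    ext t
    simp only [stretch, div_eq_inv_mul]
  rw [h1, iteratedDeriv_comp_sub_const k (fun y => F (l⁻¹ * y)) s]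
  simp only
  rw [iteratedDeriv_comp_const_mul (hF.of_le (by exact_mod_cast le_top))]
  simp only [stretch, div_eq_inv_mul]

lemma IsCut.stretch {F : ℝ → ℝ} (hF : IsCut F) (s : ℝ) {l : ℝ} (hl : 0 < l) :
    IsCut (_root_.stretch F s l) := by
  refine ⟨contDiff_stretch hF.smooth s l, ?_⟩
  have : _root_.stretch F s l = F ∘ ((Homeomorph.subRight s).trans (Homeomorph.mulRight₀ l⁻¹ (inv_ne_zero hl.ne'))) := by
    ext t
    simp [_root_.stretch, div_eq_mul_inv]
  rw [this]
  exact hF.compact.comp_homeomorph _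

lemma IsCut.pow {z : ℝ → ℝ} (hz : IsCut z) {k : ℕ} (hk : k ≠ 0) : IsCut (fun t => z t ^ k) := by
  refine ⟨hz.smooth.pow k, hz.compact.mono fun t ht h0 => ht ?_⟩
  simp [h0, hk]

lemma IsCut.const_mul {z : ℝ → ℝ} (hz : IsCut z) (c : ℝ) : IsCut (fun t => c * z t) :=
  ⟨contDiff_const.mul hz.smooth, hz.compact.mul_left⟩

lemma IsCut.add {z z' : ℝ → ℝ} (hz : IsCut z) (hz' : IsCut z') : IsCut (fun t => z t + z' t) :=
  ⟨hz.smooth.add hz'.smooth, hz.compact.add hz'.compact⟩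

/-- Derivatives of a power of a cutoff are controlled by lower powers. -/
lemma IsCut.iteratedDeriv_pow {z : ℝ → ℝ} (hz : IsCut z) (N : ℕ) :
    ∀ j, j ≤ N → ∃ g : ℝ → ℝ, ContDiff ℝ (⊤ : ℕ∞) g ∧
      _root_.iteratedDeriv j (fun t => z t ^ N) = fun t => z t ^ (N - j) * g t := by
  intro j
  induction j with
  | zero => exact fun _ => ⟨fun _ => 1, contDiff_const, by simp⟩
  | succ j ih =>
    intro hj
    obtain ⟨g, hg, h⟩ := ih (by omega)
    obtain ⟨k, hk⟩ : ∃ k, N - j = k + 1 := ⟨N - j - 1, by omega⟩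
    refine ⟨fun t => (k + 1) * _root_.deriv z t * g t + z t * _root_.deriv g t,
      ((contDiff_const.mul hz.deriv.smooth).mul hg).add
        (hz.smooth.mul ((contDiff_infty_iff_deriv).1 hg).2), ?_⟩
    ext t
    rw [iteratedDeriv_succ, h, show N - (j + 1) = k by omega, hk]
    have h1 := hasDerivAt_deriv_of_contDiff (hz.contDiff 1) t
    have h2 := hasDerivAt_deriv_of_contDiff (hg.of_le (by exact_mod_cast le_top)) t
    have h3 := ((h1.pow (k + 1)).mul h2).deriv
    simp only [Pi.mul_def, Pi.pow_def] at h3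
    rw [h3]
    push_cast
    ring

lemma IsCut.exists_iteratedDeriv_pow_bound {z : ℝ → ℝ} (hz : IsCut z) (hz0 : ∀ t, 0 ≤ z t)
    (N j : ℕ) (hj : j ≤ N) :
    ∃ C, 0 ≤ C ∧ ∀ t, |_root_.iteratedDeriv j (fun t => z t ^ N) t| ≤ C * z t ^ (N - j) := by
  by_cases hN : N = 0
  · subst hN
    obtain rfl : j = 0 := by omega
    exact ⟨1, zero_le_one, fun t => by simp⟩
  obtain ⟨g, hg, h⟩ := hz.iteratedDeriv_pow N j hj
  obtain ⟨C, hC⟩ := hz.compact.isCompact.exists_bound_of_continuousOn hg.continuous.continuousOn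
  refine ⟨max C 0, le_max_right _ _, fun t => ?_⟩
  by_cases ht : t ∈ tsupport z
  · rw [h, abs_mul, abs_of_nonneg (pow_nonneg (hz0 t) _), mul_comm]
    gcongr
    · exact pow_nonneg (hz0 t) _
    · exact (hC t ht).trans (le_max_left _ _)
  · have h0 : _root_.iteratedDeriv j (fun t => z t ^ N) t = 0 := by
      have h1 : (fun t => z t ^ N) =ᶠ[nhds t] fun _ => 0 := by
        filter_upwards [notMem_tsupport_iff_eventuallyEq.1 ht] with s hs
        rw [hs]
        simp [hN]
      rw [h1.iteratedDeriv_eq j]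
      cases j <;> simp
    rw [h0, abs_zero]
    exact mul_nonneg (le_max_right _ _) (pow_nonneg (hz0 t) _)

end Stretch

section RadialVolume

variable {n : ℕ} [NeZero n]

lemma integral_comp_log_div (z : ℝ → ℝ) :
    ∫ y in Ioi (0 : ℝ), y⁻¹ * z (log y) = ∫ t, z t := by
  have h := integral_image_eq_integral_abs_deriv_smul (s := univ) (f := Real.exp)
    (f' := Real.exp) MeasurableSet.univ (fun x _ => (Real.hasDerivAt_exp x).hasDerivWithinAt)
    Real.exp_injective.injOn (fun y => y⁻¹ * z (log y))
  rw [image_univ, Real.range_exp, setIntegral_univ] at h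
  rw [h]
  congr 1
  ext t
  rw [abs_of_pos (Real.exp_pos t), Real.log_exp, smul_eq_mul]
  field_simp

lemma exists_radInt_one (n : ℕ) [NeZero n] :
    ∃ c, 0 ≤ c ∧ ∀ z : ℝ → ℝ, radInt (n := n) z (fun _ => 1) = c * ∫ t, z t := by
  have : Nonempty (Fin n) := ⟨⟨0, Nat.pos_of_ne_zero (NeZero.ne n)⟩⟩
  have : Nontrivial (Euc n) := inferInstance
  refine ⟨n * (volume : Measure (Euc n)).real (ball 0 1), by positivity, fun z => ?_⟩
  have h := integral_fun_norm_addHaar (volume : Measure (Euc n))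
    (fun r => z (log r) * (r ^ n)⁻¹)
  simp only [radInt, rad, smul_eq_mul, mul_one]
  rw [h, ← integral_comp_log_div z, finrank_euclideanSpace_fin, nsmul_eq_mul, smul_eq_mul,
    mul_assoc]
  congr 2
  refine setIntegral_congr_fun measurableSet_Ioi fun y hy => ?_
  have hy : 0 < y := hy
  obtain ⟨k, rfl⟩ : ∃ k, n = k + 1 := ⟨n - 1, by have := NeZero.ne n; omega⟩
  simp only [smul_eq_mul, Nat.add_sub_cancel]
  field_simp
  ring

lemma integral_stretch (F : ℝ → ℝ) (s : ℝ) {l : ℝ} (hl : 0 < l) :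
    ∫ t, stretch F s l t = l * ∫ t, F t := by
  have h1 := integral_sub_right_eq_self (μ := volume) (fun t => F (t / l)) s
  simp only [stretch]
  rw [h1, Measure.integral_comp_div, abs_of_pos hl, smul_eq_mul]

/-- The weighted volume of a stretched cutoff grows linearly. -/
lemma exists_radInt_stretch_le (n : ℕ) [NeZero n] (F : ℝ → ℝ) : ∃ C, 0 ≤ C ∧ ∀ s l : ℝ, 0 < l →
    radInt (n := n) (stretch F s l) (fun _ => 1) ≤ C * l := by
  obtain ⟨c, hc, h⟩ := exists_radInt_one n
  refine ⟨c * |∫ t, F t|, by positivity, fun s l hl => ?_⟩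
  rw [h, integral_stretch F s hl]
  calc c * (l * ∫ t, F t) ≤ c * (l * |∫ t, F t|) := by gcongr; exact le_abs_self _
    _ = _ := by ring

end RadialVolume

section Bumps

lemma exists_isCut_bump {r R : ℝ} (c : ℝ) (hr : 0 < r) (hrR : r < R) :
    ∃ z : ℝ → ℝ, IsCut z ∧ (∀ t, 0 ≤ z t) ∧ (∀ t, z t ≤ 1) ∧ (∀ t, |t - c| ≤ r → z t = 1) ∧
      ∀ t, z t ≠ 0 → |t - c| < R := by
  let b : ContDiffBump c := ⟨r, R, hr, hrR⟩
  refine ⟨b, ⟨b.contDiff, b.hasCompactSupport⟩, fun t => b.nonneg, fun t => b.le_one,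
    fun t ht => b.one_of_mem_closedBall ht, fun t ht => ?_⟩
  have : t ∈ Function.support b := ht
  rwa [b.support_eq, mem_ball, Real.dist_eq] at this

/-- A smooth step, vanishing before `1` and equal to one after `2`. -/
def step (s : ℝ) : ℝ := Real.smoothTransition (s - 1)

lemma contDiff_step : ContDiff ℝ (⊤ : ℕ∞) step :=
  Real.smoothTransition.contDiff.comp (contDiff_id.sub contDiff_const)

lemma step_nonneg (s : ℝ) : 0 ≤ step s := Real.smoothTransition.nonneg _

lemma step_le_one (s : ℝ) : step s ≤ 1 := Real.smoothTransition.le_one _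

lemma step_of_le {s : ℝ} (h : s ≤ 1) : step s = 0 :=
  Real.smoothTransition.zero_of_nonpos (by linarith)

lemma step_of_ge {s : ℝ} (h : 2 ≤ s) : step s = 1 :=
  Real.smoothTransition.one_of_one_le (by linarith)

lemma iteratedDeriv_step_eq_zero {j : ℕ} (hj : j ≠ 0) {s : ℝ} (hs : s < 1 ∨ 2 < s) :
    iteratedDeriv j step s = 0 := by
  obtain ⟨c, hc⟩ : ∃ c : ℝ, step =ᶠ[nhds s] fun _ => c := by
    rcases hs with hs | hs
    · exact ⟨0, by
        filter_upwards [Iio_mem_nhds hs] with t (ht : t < 1) using step_of_le ht.le⟩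
    · exact ⟨1, by
        filter_upwards [Ioi_mem_nhds hs] with t (ht : 2 < t) using step_of_ge ht.le⟩
  rw [hc.iteratedDeriv_eq j, iteratedDeriv_const, if_neg hj]

lemma exists_iteratedDeriv_step_bound (j : ℕ) (hj : j ≠ 0) :
    ∃ C, 0 ≤ C ∧ ∀ s, |iteratedDeriv j step s| ≤ C := by
  have hc : Continuous (iteratedDeriv j step) :=
    contDiff_step.continuous_iteratedDeriv j (by exact_mod_cast le_top)
  obtain ⟨C, hC⟩ := (isCompact_Icc (a := (1 : ℝ)) (b := 2)).exists_bound_of_continuousOn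
    hc.continuousOn
  refine ⟨max C 0, le_max_right _ _, fun s => ?_⟩
  by_cases hs : s ∈ Icc (1 : ℝ) 2
  · exact (hC s hs).trans (le_max_left _ _)
  · rw [iteratedDeriv_step_eq_zero hj, abs_zero]
    · exact le_max_right _ _
    · by_contra! h
      exact hs ⟨h.1, h.2⟩

end Bumps

section EnergyInequality

/-- Bounds for the derivatives of a cutoff and of its square. -/
structure CutBound (z m₂ m₄ : ℝ → ℝ) : Prop where
  sq_two : ∀ k, 1 ≤ k → k ≤ 2 → ∀ t, |iteratedDeriv k (fun t => z t * z t) t| ≤ m₂ t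
  sq_four : ∀ k, 1 ≤ k → k ≤ 4 → ∀ t, |iteratedDeriv k (fun t => z t * z t) t| ≤ m₄ t
  mul_two : ∀ i j, 1 ≤ i + j → i + j ≤ 2 → ∀ t,
    |iteratedDeriv i z t * iteratedDeriv j z t| ≤ m₂ t
  mul_four : ∀ i j, 1 ≤ i + j → i + j ≤ 4 → ∀ t,
    |iteratedDeriv i z t * iteratedDeriv j z t| ≤ m₄ t

lemma inv_pow_le_inv {l : ℝ} (hl : 1 ≤ l) {k : ℕ} (hk : 1 ≤ k) : l⁻¹ ^ k ≤ l⁻¹ := by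
  have h0 : 0 ≤ l⁻¹ := by positivity
  simpa using pow_le_pow_of_le_one h0 (inv_le_one_of_one_le₀ hl) hk

lemma CutBound.stretch {z m₂ m₄ : ℝ → ℝ} (hz : IsCut z) (h : CutBound z m₂ m₄) (s : ℝ) {l : ℝ}
    (hl : 1 ≤ l) : CutBound (stretch z s l) (fun t => l⁻¹ * stretch m₂ s l t)
      (fun t => l⁻¹ * stretch m₄ s l t) := by
  have h0 : 0 ≤ l⁻¹ := by positivity
  have hsq : (fun t => _root_.stretch z s l t * _root_.stretch z s l t)
      = _root_.stretch (fun t => z t * z t) s l := rfl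
  have key : ∀ (k : ℕ) (a m : ℝ), 1 ≤ k → |a| ≤ m → |l⁻¹ ^ k * a| ≤ l⁻¹ * m := by
    intro k a m hk ha
    rw [abs_mul, abs_of_nonneg (pow_nonneg h0 k)]
    exact mul_le_mul (inv_pow_le_inv hl hk) ha (abs_nonneg _) h0
  have hm : ∀ (i j : ℕ) (t : ℝ), iteratedDeriv i (_root_.stretch z s l) t
      * iteratedDeriv j (_root_.stretch z s l) t
      = l⁻¹ ^ (i + j) * (iteratedDeriv i z ((t - s) / l) * iteratedDeriv j z ((t - s) / l)) := by
    intro i j t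
    rw [iteratedDeriv_stretch hz.smooth, iteratedDeriv_stretch hz.smooth, pow_add]
    simp only [_root_.stretch]
    ring
  refine ⟨fun k hk hk' t => ?_, fun k hk hk' t => ?_, fun i j hk hk' t => ?_,
    fun i j hk hk' t => ?_⟩
  · rw [hsq, iteratedDeriv_stretch (hz.mul hz).smooth]
    exact key _ _ _ hk (h.sq_two k hk hk' _)
  · rw [hsq, iteratedDeriv_stretch (hz.mul hz).smooth]
    exact key _ _ _ hk (h.sq_four k hk hk' _)
  · rw [hm]
    exact key _ _ _ hk (h.mul_two i j hk hk' _)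
  · rw [hm]
    exact key _ _ _ hk (h.mul_four i j hk hk' _)

lemma mul_le_abs_mul {c t D : ℝ} (h : |t| ≤ D) : c * t ≤ |c| * D :=
  (le_abs_self _).trans (by rw [abs_mul]; gcongr)

variable {n : ℕ} {V : Type*} [NormedAddCommGroup V] [InnerProductSpace ℝ V]

lemma pair_self_eq (z : ℝ → ℝ) (f : Euc n → V) : pair z f f = radInt z (fun x => ‖f x‖ ^ 2) := by
  simp only [pair, real_inner_self_eq_norm_sq]

variable [NeZero n]

lemma abs_radInt_le {ζ m : ℝ → ℝ} (hζ : IsCut ζ) (hm : IsCut m) (h : ∀ t, |ζ t| ≤ m t)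
    {q Q : Euc n → ℝ} (hq : ContinuousOn q (Punct n)) (hQ : ContinuousOn Q (Punct n))
    (hqQ : ∀ x ∈ Punct n, |q x| ≤ Q x) : |radInt ζ q| ≤ radInt m Q := by
  have key : ∀ x ∈ Punct n, |rad ζ x * q x| ≤ rad m x * Q x := fun x hx => by
    rw [abs_mul]
    exact mul_le_mul (h _) (hqQ x hx) (abs_nonneg _) ((abs_nonneg _).trans (h _))
  rw [abs_le]
  constructor
  · have h1 := radInt_mono hm.continuous hm.compact hζ.continuous hζ.compact
      (q := fun x => (-1) * Q x) (continuousOn_const.mul hQ) hq fun x hx => by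
        have := (abs_le.1 (key x hx)).1
        linarith
    rw [radInt_const_mul] at h1
    linarith
  · exact radInt_mono hζ.continuous hζ.compact hm.continuous hm.compact hq hQ fun x hx =>
      (abs_le.1 (key x hx)).2

lemma pair_self_nonneg {z : ℝ → ℝ} (hz : ∀ t, 0 ≤ z t) (f : Euc n → V) : 0 ≤ pair z f f := by
  rw [pair_self_eq]
  exact radInt_nonneg fun x _ => mul_nonneg (hz _) (by positivity)

lemma pair_angM_nonneg {z : ℝ → ℝ} (hzc : IsCut z) (hz : ∀ t, 0 ≤ z t) {f : Euc n → V}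
    (hf : ContDiffOn ℝ 2 f (Punct n)) : 0 ≤ pair z (angM f) f := by
  rw [pair_angM hzc hf (hf.of_le (by norm_num))]
  exact radInt_nonneg fun x _ => mul_nonneg (hz _) (angG_self_nonneg _ _)

lemma abs_pair_self_le {ζ m : ℝ → ℝ} (hζ : IsCut ζ) (hm : IsCut m) (h : ∀ t, |ζ t| ≤ m t)
    {f : Euc n → V} (hf : ContinuousOn f (Punct n)) : |pair ζ f f| ≤ pair m f f := by
  rw [pair_self_eq, pair_self_eq]
  exact abs_radInt_le hζ hm h (hf.norm.pow 2) (hf.norm.pow 2) fun x _ => by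
    rw [abs_of_nonneg (by positivity)]

lemma abs_pair_angM_le {ζ m : ℝ → ℝ} (hζ : IsCut ζ) (hm : IsCut m) (h : ∀ t, |ζ t| ≤ m t)
    {f : Euc n → V} (hf : ContDiffOn ℝ 2 f (Punct n)) :
    |pair ζ (angM f) f| ≤ pair m (angM f) f := by
  have hf1 : ContDiffOn ℝ 1 f (Punct n) := hf.of_le (by norm_num)
  have hc := continuousOn_angG hf1 hf1
  rw [pair_angM hζ hf hf1, pair_angM hm hf hf1]
  exact abs_radInt_le hζ hm h hc hc fun x _ => by rw [abs_of_nonneg (angG_self_nonneg _ _)]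

/-- Combination of the tested equation with the stability inequality. -/
lemma exists_energy_inequality (n : ℕ) [NeZero n] (p δ : ℝ) :
    ∃ C, 0 ≤ C ∧ ∀ (w : Euc n → V), ContDiffOn ℝ 4 w (Punct n) →
      ∀ z m₂ m₄ : ℝ → ℝ, IsCut z → IsCut m₂ → IsCut m₄ → CutBound z m₂ m₄ → ∀ Q : ℝ,
      pair (fun t => z t * z t) w (cylOp δ w) = Q →
      p * Q ≤ ∫ x, ‖lapV (twist (-(((n : ℝ) - 4) / 2)) (fun x => rad z x • w x)) x‖ ^ 2 →
      ((p - 1) * (pair (fun t => z t * z t) (euler (euler w)) (euler (euler w))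
          + pair (fun t => z t * z t) (angM w) (angM w)
          + 2 * pair (fun t => z t * z t) (angM (euler w)) (euler w))
        + 2 * ((p - 1) * nzero n - p * δ ^ 2) * pair (fun t => z t * z t) (angM w) w
        + (p * (δ ^ 4 - (2 * nzero n + 4) * δ ^ 2 + nzero n ^ 2) - nzero n ^ 2)
          * pair (fun t => z t * z t) w w
        ≤ C * pair (fun t => z t * z t) (euler w) (euler w)
          + C * (pair m₂ (euler w) (euler w) + pair m₂ (angM w) w + pair m₄ w w)) ∧
      (p * Q ≤ (pair (fun t => z t * z t) (euler (euler w)) (euler (euler w))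
          + pair (fun t => z t * z t) (angM w) (angM w)
          + 2 * pair (fun t => z t * z t) (angM (euler w)) (euler w))
        + 2 * nzero n * pair (fun t => z t * z t) (angM w) w
        + nzero n ^ 2 * pair (fun t => z t * z t) w w
        + C * pair (fun t => z t * z t) (euler w) (euler w)
        + C * (pair m₂ (euler w) (euler w) + pair m₂ (angM w) w + pair m₄ w w)) := by
  refine ⟨|p * 2| + |p * (-6 * δ)| + |p * (-(1 / 2))| + |p * (2 * δ)|
    + |p * (-(1 / 2) * (6 * δ ^ 2 - 4 - 2 * nzero n))|
    + |p * ((1 / 2) * (4 * δ ^ 3 - 8 * δ - 4 * δ * nzero n))| + |p| + |p * (-2 * δ)|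
    + |2| + |-4| + |1| + |-(4 + 2 * nzero n)| + |-2|
    + |p * (6 * δ ^ 2 - 4 - 2 * nzero n) + 4 + 2 * nzero n| + |4 + 2 * nzero n|, by positivity, ?_⟩
  intro w hw z m₂ m₄ hz hm₂ hm₄ hb Q hI hII
  rw [energy_cut hz hw] at hII
  have hy : IsCut (fun t => z t * z t) := hz.mul hz
  rw [pair_self_cylOp hy hw δ] at hI
  simp only [show ∀ f g : Euc n → V, cutPair z 0 0 f g = pair (fun t => z t * z t) f g from
    fun f g => by simp only [cutPair, iteratedDeriv_zero]] at hII
  set y : ℝ → ℝ := fun t => z t * z t with hydef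
  have hD : ContDiffOn ℝ 3 (euler w) (Punct n) := hw.linField (by norm_num) _
  have hw2 : ContDiffOn ℝ 2 w (Punct n) := hw.of_le (by norm_num)
  have hy0 : ∀ t, 0 ≤ y t := fun t => mul_self_nonneg _
  obtain ⟨D, hDdef⟩ : ∃ D, D = pair m₂ (euler w) (euler w) + pair m₂ (angM w) w + pair m₄ w w :=
    ⟨_, rfl⟩
  have hm₂0 : ∀ t, 0 ≤ m₂ t := fun t => (abs_nonneg _).trans (hb.sq_two 1 le_rfl one_le_two t)
  have hm₄0 : ∀ t, 0 ≤ m₄ t := fun t => (abs_nonneg _).trans (hb.sq_four 1 le_rfl (by norm_num) t)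
  have p1 : 0 ≤ pair m₂ (euler w) (euler w) := pair_self_nonneg hm₂0 _
  have p2 : 0 ≤ pair m₂ (angM w) w := pair_angM_nonneg hm₂ hm₂0 hw2
  have p3 : 0 ≤ pair m₄ w w := pair_self_nonneg hm₄0 _
  have bD : ∀ k, 1 ≤ k → k ≤ 2 → |pair (iteratedDeriv k y) (euler w) (euler w)| ≤ D :=
    fun k h1 h2 => (abs_pair_self_le (hy.iteratedDeriv k) hm₂ (hb.sq_two k h1 h2)
      hD.continuousOn).trans (by linarith)
  have bM : ∀ k, 1 ≤ k → k ≤ 2 → |pair (iteratedDeriv k y) (angM w) w| ≤ D :=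
    fun k h1 h2 => (abs_pair_angM_le (hy.iteratedDeriv k) hm₂ (hb.sq_two k h1 h2)
      hw2).trans (by linarith)
  have bW : ∀ k, 1 ≤ k → k ≤ 4 → |pair (iteratedDeriv k y) w w| ≤ D :=
    fun k h1 h2 => (abs_pair_self_le (hy.iteratedDeriv k) hm₄ (hb.sq_four k h1 h2)
      hw.continuousOn).trans (by linarith)
  have cD : ∀ i j, 1 ≤ i + j → i + j ≤ 2 → |cutPair z i j (euler w) (euler w)| ≤ D :=
    fun i j h1 h2 => (abs_pair_self_le ((hz.iteratedDeriv i).mul (hz.iteratedDeriv j)) hm₂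
      (hb.mul_two i j h1 h2) hD.continuousOn).trans (by linarith)
  have cM : ∀ i j, 1 ≤ i + j → i + j ≤ 2 → |cutPair z i j (angM w) w| ≤ D :=
    fun i j h1 h2 => (abs_pair_angM_le ((hz.iteratedDeriv i).mul (hz.iteratedDeriv j)) hm₂
      (hb.mul_two i j h1 h2) hw2).trans (by linarith)
  have cW : ∀ i j, 1 ≤ i + j → i + j ≤ 4 → |cutPair z i j w w| ≤ D :=
    fun i j h1 h2 => (abs_pair_self_le ((hz.iteratedDeriv i).mul (hz.iteratedDeriv j)) hm₄
      (hb.mul_four i j h1 h2) hw.continuousOn).trans (by linarith)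
  have e1 := mul_le_abs_mul (c := p * 2) (bD 2 (by norm_num) le_rfl)
  have e2 := mul_le_abs_mul (c := p * (-6 * δ)) (bD 1 le_rfl (by norm_num))
  have e3 := mul_le_abs_mul (c := p * (-(1 / 2))) (bW 4 (by norm_num) le_rfl)
  have e4 := mul_le_abs_mul (c := p * (2 * δ)) (bW 3 (by norm_num) (by norm_num))
  have e5 := mul_le_abs_mul (c := p * (-(1 / 2) * (6 * δ ^ 2 - 4 - 2 * nzero n)))
    (bW 2 (by norm_num) (by norm_num))
  have e6 := mul_le_abs_mul (c := p * ((1 / 2) * (4 * δ ^ 3 - 8 * δ - 4 * δ * nzero n)))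
    (bW 1 (by norm_num) (by norm_num))
  have e7 := mul_le_abs_mul (c := p) (bM 2 (by norm_num) le_rfl)
  have e8 := mul_le_abs_mul (c := p * (-2 * δ)) (bM 1 le_rfl (by norm_num))
  have e9 := mul_le_abs_mul (c := 2) (cD 1 1 (by norm_num) (by norm_num))
  have e10 := mul_le_abs_mul (c := -4) (cD 0 2 (by norm_num) (by norm_num))
  have e11 := mul_le_abs_mul (c := 1) (cW 0 4 (by norm_num) (by norm_num))
  have e12 := mul_le_abs_mul (c := -(4 + 2 * nzero n)) (cW 0 2 (by norm_num) (by norm_num))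
  have e13 := mul_le_abs_mul (c := -2) (cM 0 2 (by norm_num) (by norm_num))
  rw [← hDdef]
  have hD0 : 0 ≤ D := by linarith
  have y1 : |pair y (euler w) (euler w)| ≤ pair y (euler w) (euler w) :=
    (abs_of_nonneg (pair_self_nonneg hy0 _)).le
  have y1' := pair_self_nonneg hy0 (euler w)
  have e14 := mul_le_abs_mul (c := p * (6 * δ ^ 2 - 4 - 2 * nzero n) + 4 + 2 * nzero n) y1
  have e15 := mul_le_abs_mul (c := 4 + 2 * nzero n) y1
  generalize pair y (euler w) (euler w) = W1 at *
  generalize pair y (euler (euler w)) (euler (euler w)) = W2 at *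
  generalize pair y (angM w) (angM w) = M0 at *
  generalize pair y (angM (euler w)) (euler w) = G1 at *
  generalize pair y (angM w) w = G0 at *
  generalize pair y w w = W0 at *
  clear bD bM bW cD cM cW
  have a1 := abs_nonneg (p * 2)
  have a2 := abs_nonneg (p * (-6 * δ))
  have a3 := abs_nonneg (p * (-(1 / 2)))
  have a4 := abs_nonneg (p * (2 * δ))
  have a5 := abs_nonneg (p * (-(1 / 2) * (6 * δ ^ 2 - 4 - 2 * nzero n)))
  have a6 := abs_nonneg (p * ((1 / 2) * (4 * δ ^ 3 - 8 * δ - 4 * δ * nzero n)))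
  have a7 := abs_nonneg p
  have a8 := abs_nonneg (p * (-2 * δ))
  have a9 := abs_nonneg (2 : ℝ)
  have a10 := abs_nonneg (-4 : ℝ)
  have a11 := abs_nonneg (1 : ℝ)
  have a12 := abs_nonneg (-(4 + 2 * nzero n))
  have a13 := abs_nonneg (-2 : ℝ)
  have a14 := abs_nonneg (p * (6 * δ ^ 2 - 4 - 2 * nzero n) + 4 + 2 * nzero n)
  have a15 := abs_nonneg (4 + 2 * nzero n)
  generalize |p * 2| = A1 at *
  generalize |p * (-6 * δ)| = A2 at *
  generalize |p * (-(1 / 2))| = A3 at *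
  generalize |p * (2 * δ)| = A4 at *
  generalize |p * (-(1 / 2) * (6 * δ ^ 2 - 4 - 2 * nzero n))| = A5 at *
  generalize |p * ((1 / 2) * (4 * δ ^ 3 - 8 * δ - 4 * δ * nzero n))| = A6 at *
  generalize |p| = A7 at *
  generalize |p * (-2 * δ)| = A8 at *
  generalize |(2 : ℝ)| = A9 at *
  generalize |(-4 : ℝ)| = A10 at *
  generalize |(1 : ℝ)| = A11 at *
  generalize |-(4 + 2 * nzero n)| = A12 at *
  generalize |(-2 : ℝ)| = A13 at *
  generalize |p * (6 * δ ^ 2 - 4 - 2 * nzero n) + 4 + 2 * nzero n| = A14 at *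
  generalize |4 + 2 * nzero n| = A15 at *
  have hpI := congrArg (fun s => p * s) hI
  have f1 : 0 ≤ (A14 + A15) * D := by positivity
  have f2 : 0 ≤ (A1 + A2 + A3 + A4 + A5 + A6 + A7 + A8) * D := by positivity
  have f3 : 0 ≤ (A1 + A2 + A3 + A4 + A5 + A6 + A7 + A8 + A9 + A10 + A11 + A12 + A13) * W1 := by
    positivity
  have f4 : 0 ≤ A14 * W1 := by positivity
  have f5 : 0 ≤ A15 * W1 := by positivity
  constructor
  · linarith
  · linarith

end EnergyInequality

section GrowthEstimate

lemma exists_young_pow {p ε : ℝ} (hp : 1 < p) (hε : 0 < ε) {N : ℕ}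
    (hN : 1 + 2 * (4 / (p - 1)) ≤ N) :
    ∃ C, 0 ≤ C ∧ ∀ s ψ : ℝ, 0 ≤ s → 0 ≤ ψ → ψ ≤ 1 →
      ψ ^ N * s ^ 2 ≤ ε * (ψ ^ (N + 4) * s ^ (p + 1)) + C * ψ := by
  have hp1 : 0 < p - 1 := by linarith
  have hγ : 0 < 4 / (p - 1) := by positivity
  have hN0 : N ≠ 0 := by
    rintro rfl
    norm_num at hN
    linarith
  refine ⟨ε⁻¹ ^ (2 / (p - 1)), by positivity, fun s ψ hs hψ hψ1 => ?_⟩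
  rcases hψ.eq_or_lt with h0 | hψ0
  · subst h0
    simp [hN0]
  rcases hs.eq_or_lt with h0 | hs0
  · subst h0
    have : (0 : ℝ) ^ (p + 1) = 0 := Real.zero_rpow (by linarith)
    rw [this]
    have : 0 ≤ ε⁻¹ ^ (2 / (p - 1)) * ψ := by positivity
    simpa using this
  have hsp : s ^ (p + 1) = s ^ 2 * s ^ (p - 1) := by
    rw [show p + 1 = 2 + (p - 1) by ring, Real.rpow_add hs0]
    norm_num
  rcases le_total 1 (ε * ψ ^ 4 * s ^ (p - 1)) with h | h
  · have h1 : ψ ^ N * s ^ 2 * 1 ≤ ψ ^ N * s ^ 2 * (ε * ψ ^ 4 * s ^ (p - 1)) := by gcongr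
    have h2 : 0 ≤ ε⁻¹ ^ (2 / (p - 1)) * ψ := by positivity
    rw [hsp, pow_add]
    nlinarith [h1, h2]
  · have h1 : s ^ (p - 1) ≤ ε⁻¹ * (ψ ^ 4)⁻¹ := by
      rw [← mul_inv, ← one_div, le_div_iff₀ (by positivity)]
      linarith
    have h2 : s ^ 2 ≤ ε⁻¹ ^ (2 / (p - 1)) * ψ ^ (-(2 * (4 / (p - 1)))) := by
      have h3 : (s ^ (p - 1)) ^ (2 / (p - 1)) ≤ (ε⁻¹ * (ψ ^ 4)⁻¹) ^ (2 / (p - 1)) := by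
        gcongr
      rw [← Real.rpow_mul hs, Real.mul_rpow (by positivity) (by positivity),
        mul_div_cancel₀ _ hp1.ne'] at h3
      have h4 : ((ψ ^ 4)⁻¹ : ℝ) ^ (2 / (p - 1)) = ψ ^ (-(2 * (4 / (p - 1)))) := by
        rw [← Real.rpow_natCast ψ 4, ← Real.rpow_neg hψ, ← Real.rpow_mul hψ]
        congr 1
        push_cast
        ring
      rw [h4] at h3
      simpa using h3
    have h5 : ψ ^ N * ψ ^ (-(2 * (4 / (p - 1)))) ≤ ψ := by
      rw [← Real.rpow_natCast ψ N, ← Real.rpow_add hψ0]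
      calc ψ ^ ((N : ℝ) + -(2 * (4 / (p - 1)))) ≤ ψ ^ (1 : ℝ) :=
            Real.rpow_le_rpow_of_exponent_ge hψ0 hψ1 (by linarith)
        _ = ψ := Real.rpow_one ψ
    have h6 : 0 ≤ ε * (ψ ^ (N + 4) * s ^ (p + 1)) := by positivity
    calc ψ ^ N * s ^ 2
        ≤ ψ ^ N * (ε⁻¹ ^ (2 / (p - 1)) * ψ ^ (-(2 * (4 / (p - 1))))) := by gcongr
      _ = ε⁻¹ ^ (2 / (p - 1)) * (ψ ^ N * ψ ^ (-(2 * (4 / (p - 1))))) := by ring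
      _ ≤ ε⁻¹ ^ (2 / (p - 1)) * ψ := by gcongr
      _ ≤ _ := by linarith

/-- The power of a cutoff has derivatives controlled by lower powers. -/
lemma exists_cutBound_pow {F : ℝ → ℝ} (hF : IsCut F) (hF0 : ∀ t, 0 ≤ F t) (hF1 : ∀ t, F t ≤ 1)
    {K : ℕ} (hK : 4 ≤ K) : ∃ C, 0 ≤ C ∧
      CutBound (fun t => F t ^ K) (fun t => C * F t ^ (2 * K - 2))
        (fun t => C * F t ^ (2 * K - 4)) := by
  choose! c hc0 hc using fun N j => hF.exists_iteratedDeriv_pow_bound hF0 N j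
  have hsq : (fun t => F t ^ K * F t ^ K) = fun t => F t ^ (2 * K) := by
    ext t
    ring
  set C : ℝ := ∑ i ∈ Finset.range 5, |c (2 * K) i|
    + ∑ i ∈ Finset.range 5, ∑ j ∈ Finset.range 5, |c K i * c K j| with hC
  have b1 : ∀ i, i ≤ 4 → c (2 * K) i ≤ C := fun i hi => by
    have h1 := Finset.single_le_sum (f := fun i => |c (2 * K) i|) (fun _ _ => abs_nonneg _)
      (Finset.mem_range.2 (Nat.lt_succ_of_le hi))
    have h2 : 0 ≤ ∑ i ∈ Finset.range 5, ∑ j ∈ Finset.range 5, |c K i * c K j| := by positivity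
    have h3 := le_abs_self (c (2 * K) i)
    linarith
  have b2 : ∀ i j, i ≤ 4 → j ≤ 4 → c K i * c K j ≤ C := fun i j hi hj => by
    have h1 := Finset.single_le_sum (f := fun j => |c K i * c K j|) (fun _ _ => abs_nonneg _)
      (Finset.mem_range.2 (Nat.lt_succ_of_le hj))
    have h4 := Finset.single_le_sum
      (f := fun i => ∑ j ∈ Finset.range 5, |c K i * c K j|)
      (fun _ _ => Finset.sum_nonneg fun _ _ => abs_nonneg _)
      (Finset.mem_range.2 (Nat.lt_succ_of_le hi))
    have h2 : 0 ≤ ∑ i ∈ Finset.range 5, |c (2 * K) i| := by positivity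
    have h3 := le_abs_self (c K i * c K j)
    linarith
  have hCn : 0 ≤ C := by positivity
  have pw : ∀ t (a b : ℕ), b ≤ a → F t ^ a ≤ F t ^ b := fun t a b hab =>
    pow_le_pow_of_le_one (hF0 t) (hF1 t) hab
  have s1 : ∀ k r, k ≤ r → r ≤ 4 → ∀ t,
      |iteratedDeriv k (fun t => F t ^ (2 * K)) t| ≤ C * F t ^ (2 * K - r) := fun k r hk hr t => by
    refine (hc (2 * K) k (by omega) t).trans ?_
    have := b1 k (by omega)
    have := pow_nonneg (hF0 t) (2 * K - k)
    exact mul_le_mul (b1 k (by omega)) (pw t _ _ (by omega)) this hCn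
  have s2 : ∀ i j r, i + j ≤ r → r ≤ 4 → ∀ t, |iteratedDeriv i (fun t => F t ^ K) t
      * iteratedDeriv j (fun t => F t ^ K) t| ≤ C * F t ^ (2 * K - r) := fun i j r hk hr t => by
    rw [abs_mul]
    refine (mul_le_mul (hc K i (by omega) t) (hc K j (by omega) t) (abs_nonneg _)
      (mul_nonneg (hc0 K i (by omega)) (pow_nonneg (hF0 t) _))).trans ?_
    have h1 : c K i * F t ^ (K - i) * (c K j * F t ^ (K - j))
        = c K i * c K j * F t ^ (2 * K - (i + j)) := by
      rw [show 2 * K - (i + j) = (K - i) + (K - j) by omega, pow_add]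
      ring
    rw [h1]
    exact mul_le_mul (b2 i j (by omega) (by omega)) (pw t _ _ (by omega))
      (pow_nonneg (hF0 t) _) hCn
  refine ⟨C, hCn, ⟨fun k _ hk t => ?_, fun k _ hk t => ?_, fun i j _ hk t => s2 i j 2 hk (by norm_num) t,
    fun i j _ hk t => s2 i j 4 hk le_rfl t⟩⟩
  · rw [hsq]
    exact s1 k 2 hk (by norm_num) t
  · rw [hsq]
    exact s1 k 4 hk le_rfl t

variable {n : ℕ} {V : Type*} [NormedAddCommGroup V] [InnerProductSpace ℝ V]

lemma pair_const_mul_left (c : ℝ) (z : ℝ → ℝ) (f g : Euc n → V) :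
    pair (fun t => c * z t) f g = c * pair z f g := radInt_const_mul_left z c _

/-- Pointwise energy density. -/
def eDens (w : Euc n → V) (x : Euc n) : ℝ :=
  ‖euler (euler w) x‖ ^ 2 + ‖angM w x‖ ^ 2 + angG (euler w) (euler w) x + ‖euler w x‖ ^ 2
    + angG w w x + ‖w x‖ ^ 2

lemma eDens_nonneg (w : Euc n → V) (x : Euc n) : 0 ≤ eDens w x := by
  have h1 := angG_self_nonneg (euler w) x
  have h2 := angG_self_nonneg w x
  unfold eDens
  positivity

lemma continuousOn_eDens {w : Euc n → V} (hw : ContDiffOn ℝ 4 w (Punct n)) :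
    ContinuousOn (eDens w) (Punct n) := by
  have hD : ContDiffOn ℝ 3 (euler w) (Punct n) := hw.linField (by norm_num) _
  have hD2 : ContDiffOn ℝ 2 (euler (euler w)) (Punct n) := hD.linField (by norm_num) _
  have hM : ContDiffOn ℝ 2 (angM w) (Punct n) := hw.angM (by norm_num)
  have hw1 : ContDiffOn ℝ 1 w (Punct n) := hw.of_le (by norm_num)
  have hD1 : ContDiffOn ℝ 1 (euler w) (Punct n) := hD.of_le (by norm_num)
  exact (((((hD2.continuousOn.norm.pow 2).add (hM.continuousOn.norm.pow 2)).add
    (continuousOn_angG hD1 hD1)).add (hD.continuousOn.norm.pow 2)).add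
    (continuousOn_angG hw1 hw1)).add (hw.continuousOn.norm.pow 2)

variable [NeZero n]

lemma radInt_eDens {z : ℝ → ℝ} (hz : IsCut z) {w : Euc n → V} (hw : ContDiffOn ℝ 4 w (Punct n))
    {q : Euc n → ℝ} (hq : ContinuousOn q (Punct n)) :
    radInt z (fun x => eDens w x + q x)
      = pair z (euler (euler w)) (euler (euler w)) + pair z (angM w) (angM w)
        + pair z (angM (euler w)) (euler w) + pair z (euler w) (euler w) + pair z (angM w) w
        + pair z w w + radInt z q := by
  have hD : ContDiffOn ℝ 3 (euler w) (Punct n) := hw.linField (by norm_num) _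
  have hD2 : ContDiffOn ℝ 2 (euler (euler w)) (Punct n) := hD.linField (by norm_num) _
  have hM : ContDiffOn ℝ 2 (angM w) (Punct n) := hw.angM (by norm_num)
  have hw1 : ContDiffOn ℝ 1 w (Punct n) := hw.of_le (by norm_num)
  have hD1 : ContDiffOn ℝ 1 (euler w) (Punct n) := hD.of_le (by norm_num)
  have c1 := hD2.continuousOn.norm.pow 2
  have c2 := hM.continuousOn.norm.pow 2
  have c3 := continuousOn_angG hD1 hD1
  have c4 := hD.continuousOn.norm.pow 2
  have c5 := continuousOn_angG hw1 hw1
  have c6 := hw.continuousOn.norm.pow 2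
  rw [radInt_add hz.continuous hz.compact (continuousOn_eDens hw) hq]
  have split_add : ∀ {A B : Euc n → ℝ} {a : ℝ}, ContinuousOn A (Punct n) → ContinuousOn B (Punct n) →
      radInt z A = a → radInt z (A + B) = a + radInt z B := fun hA hB h =>
    (radInt_add hz.continuous hz.compact hA hB).trans (by rw [h])
  have e : radInt z (eDens w) = _ := split_add ((((c1.add c2).add c3).add c4).add c5) c6
    (split_add (((c1.add c2).add c3).add c4) c5 (split_add ((c1.add c2).add c3) c4
      (split_add (c1.add c2) c3 (split_add c1 c2 rfl))))
  rw [e,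
    pair_angM hz (hD.of_le (by norm_num)) hD1, pair_angM hz (hw.of_le (by norm_num)) hw1]
  simp only [pair_self_eq]

lemma abs_pair_le_young {ρ y r : ℝ → ℝ} (hρ : IsCut ρ) (hy : IsCut y) (hr : IsCut r)
    (hρ0 : ∀ t, 0 ≤ ρ t) (hy0 : ∀ t, 0 ≤ y t) (hr0 : ∀ t, 0 ≤ r t)
    (h : ∀ t, ρ t ^ 2 = y t * r t) {ε : ℝ} (hε : 0 < ε)
    {f g : Euc n → V} (hf : ContinuousOn f (Punct n)) (hg : ContinuousOn g (Punct n)) :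
    |pair ρ f g| ≤ ε * pair y g g + ε⁻¹ * pair r f f := by
  have h1 : |pair ρ f g| ≤ radInt ρ (fun x => ‖f x‖ * ‖g x‖) :=
    abs_radInt_le hρ hρ (fun t => (abs_of_nonneg (hρ0 t)).le) (hf.inner hg)
      (hf.norm.mul hg.norm) fun x _ => abs_real_inner_le_norm _ _
  refine h1.trans ?_
  rw [← pair_const_mul_left, ← pair_const_mul_left, pair_self_eq, pair_self_eq]
  have cy := hy.const_mul ε
  have cr := hr.const_mul ε⁻¹
  have i0 := integrable_radInt hρ.continuous hρ.compact (hf.norm.mul hg.norm)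
  have i1 := integrable_radInt cy.continuous cy.compact (hg.norm.pow 2)
  have i2 := integrable_radInt cr.continuous cr.compact (hf.norm.pow 2)
  unfold radInt
  refine (integral_mono i0 (i1.add i2) fun x => ?_).trans (integral_add i1 i2).le
  simp only [Pi.add_apply, Pi.pow_apply, Pi.mul_apply, smul_eq_mul, rad]
  set t := log ‖x‖
  have hk : 0 ≤ (‖x‖ ^ n)⁻¹ := by positivity
  have key : ρ t * (‖f x‖ * ‖g x‖) ≤ ε * y t * ‖g x‖ ^ 2 + ε⁻¹ * r t * ‖f x‖ ^ 2 := by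
    have a1 : 0 ≤ ε * y t * ‖g x‖ ^ 2 := by have := hy0 t; positivity
    have a2 : 0 ≤ ε⁻¹ * r t * ‖f x‖ ^ 2 := by have := hr0 t; positivity
    have a3 : (ρ t * (‖f x‖ * ‖g x‖)) ^ 2
        = (ε * y t * ‖g x‖ ^ 2) * (ε⁻¹ * r t * ‖f x‖ ^ 2) := by
      rw [mul_pow, h]
      field_simp
    refine (abs_le_of_sq_le_sq' ?_ (by positivity)).2
    rw [a3]
    nlinarith [sq_nonneg (ε * y t * ‖g x‖ ^ 2 - ε⁻¹ * r t * ‖f x‖ ^ 2)]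
  calc ρ t * ((‖x‖ ^ n)⁻¹ * (‖f x‖ * ‖g x‖))
      = (‖x‖ ^ n)⁻¹ * (ρ t * (‖f x‖ * ‖g x‖)) := by ring
    _ ≤ (‖x‖ ^ n)⁻¹ * (ε * y t * ‖g x‖ ^ 2 + ε⁻¹ * r t * ‖f x‖ ^ 2) := by gcongr
    _ = _ := by ring

lemma pair_euler_self_eq {ρ : ℝ → ℝ} (hρ : IsCut ρ) {w : Euc n → V}
    (hw : ContDiffOn ℝ 2 w (Punct n)) :
    pair ρ (euler w) (euler w)
      = - pair ρ w (euler (euler w)) + (1 / 2) * pair (iteratedDeriv 2 ρ) w w := by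
  have hw1 : ContDiffOn ℝ 1 w (Punct n) := hw.of_le (by norm_num)
  have hD : ContDiffOn ℝ 1 (euler w) (Punct n) := hw.linField (by norm_num) _
  have h1 := pair_iteratedDeriv_euler hρ 0 hw1 hD
  have h2 := pair_iteratedDeriv_euler hρ 1 hw1 hw1
  rw [pair_comm _ (euler w) w] at h2
  rw [iteratedDeriv_zero] at h1
  norm_num at h1 h2
  linarith

end GrowthEstimate

section Growth

variable {n : ℕ} {V : Type*} [NormedAddCommGroup V] [InnerProductSpace ℝ V]

/-- A solution of the equation in cylindrical form which is stable for `log ‖x‖ ≥ A`. -/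
structure StableProfile (p δ A : ℝ) (w : Euc n → V) (q : Euc n → ℝ) : Prop where
  smooth : ContDiffOn ℝ 4 w (Punct n)
  dens_cont : ContinuousOn q (Punct n)
  dens_eq : ∀ x ∈ Punct n, q x = ‖w x‖ ^ (p + 1)
  tested : ∀ z, IsCut z → pair (fun t => z t * z t) w (cylOp δ w) = radInt (fun t => z t * z t) q
  stable : ∀ z, IsCut z → (∀ t, z t ≠ 0 → A ≤ t) → p * radInt (fun t => z t * z t) q
    ≤ ∫ x, ‖lapV (twist (-(((n : ℝ) - 4) / 2)) (fun x => rad z x • w x)) x‖ ^ 2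

variable [NeZero n]

lemma pair_self_mono {z z' : ℝ → ℝ} (hz : IsCut z) (hz' : IsCut z') (hz0 : ∀ t, 0 ≤ z t)
    (h : ∀ t, z t ≤ z' t) {f : Euc n → V} (hf : ContinuousOn f (Punct n)) :
    pair z f f ≤ pair z' f f :=
  (le_abs_self _).trans (abs_pair_self_le hz hz' (fun t => (abs_of_nonneg (hz0 t)).trans_le (h t)) hf)

lemma pair_angM_mono {z z' : ℝ → ℝ} (hz : IsCut z) (hz' : IsCut z') (hz0 : ∀ t, 0 ≤ z t)
    (h : ∀ t, z t ≤ z' t) {f : Euc n → V} (hf : ContDiffOn ℝ 2 f (Punct n)) :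
    pair z (angM f) f ≤ pair z' (angM f) f :=
  (le_abs_self _).trans (abs_pair_angM_le hz hz' (fun t => (abs_of_nonneg (hz0 t)).trans_le (h t)) hf)

lemma pair_interpolation {ρ y r : ℝ → ℝ} (hρ : IsCut ρ) (hy : IsCut y) (hr : IsCut r)
    (hρ0 : ∀ t, 0 ≤ ρ t) (hy0 : ∀ t, 0 ≤ y t) (hr0 : ∀ t, 0 ≤ r t)
    (h : ∀ t, ρ t ^ 2 = y t * r t) {c : ℝ} (hc : ∀ t, |iteratedDeriv 2 ρ t| ≤ c * r t)
    {ε : ℝ} (hε : 0 < ε) {w : Euc n → V} (hw : ContDiffOn ℝ 4 w (Punct n)) :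
    pair ρ (euler w) (euler w) + pair ρ (angM w) w
      ≤ ε * (pair y (euler (euler w)) (euler (euler w)) + pair y (angM w) (angM w))
        + (2 * ε⁻¹ + c / 2) * pair r w w := by
  have hD : ContDiffOn ℝ 3 (euler w) (Punct n) := hw.linField (by norm_num) _
  have hD2 : ContDiffOn ℝ 2 (euler (euler w)) (Punct n) := hD.linField (by norm_num) _
  have hM : ContDiffOn ℝ 2 (angM w) (Punct n) := hw.angM (by norm_num)
  have h1 := abs_le.1 (abs_pair_le_young hρ hy hr hρ0 hy0 hr0 h hε hw.continuousOn hD2.continuousOn)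
  have h2 := abs_le.1 (abs_pair_le_young hρ hy hr hρ0 hy0 hr0 h hε hw.continuousOn hM.continuousOn)
  have h3 := pair_euler_self_eq hρ (hw.of_le (by norm_num))
  have h4 := abs_le.1 (abs_pair_self_le (hρ.iteratedDeriv 2) (hr.const_mul c) hc hw.continuousOn)
  rw [pair_const_mul_left] at h4
  rw [pair_comm ρ (angM w) w]
  linarith [h1.1, h1.2, h2.1, h2.2, h4.1, h4.2]

lemma radInt_le_add {z z₁ z₂ : ℝ → ℝ} (hz : IsCut z) (hz₁ : IsCut z₁) (hz₂ : IsCut z₂)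
    {q q₁ q₂ : Euc n → ℝ} (hq : ContinuousOn q (Punct n)) (hq₁ : ContinuousOn q₁ (Punct n))
    (hq₂ : ContinuousOn q₂ (Punct n))
    (h : ∀ x ∈ Punct n, rad z x * q x ≤ rad z₁ x * q₁ x + rad z₂ x * q₂ x) :
    radInt z q ≤ radInt z₁ q₁ + radInt z₂ q₂ := by
  have i0 := integrable_radInt hz.continuous hz.compact hq
  have i1 := integrable_radInt hz₁.continuous hz₁.compact hq₁
  have i2 := integrable_radInt hz₂.continuous hz₂.compact hq₂
  refine (integral_mono i0 (i1.add i2) fun x => ?_).trans (integral_add i1 i2).le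
  simp only [Pi.add_apply, smul_eq_mul]
  by_cases hx : x = 0
  · subst hx
    simp [NeZero.ne n]
  · have hk : 0 ≤ (‖x‖ ^ n)⁻¹ := by positivity
    nlinarith [mul_le_mul_of_nonneg_left (h x hx) hk]

lemma le_of_energy_algebra {a C c k₂ k₃ i X b₁ b₂ L W₁ G₀ W₀ : ℝ} (hC : 0 ≤ C) (hc : 0 ≤ c)
    (hi1 : i ≤ 1) (h₁ : 0 ≤ b₁) (h₂ : 0 ≤ b₂) (hL : 0 ≤ L) (hG : 0 ≤ G₀) (hW : 0 ≤ W₀)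
    (hW₁ : W₁ ≤ b₁) (hG₀ : G₀ ≤ b₂) (hW₀ : W₀ ≤ L)
    (h : a * X + k₂ * G₀ + k₃ * W₀
      ≤ C * W₁ + C * (i * (c * b₁) + i * (c * b₂) + i * (c * L))) :
    a * X ≤ (C + C * c + |k₂| + |k₃|) * (b₁ + b₂) + (C + C * c + |k₂| + |k₃|) * L := by
  have e1 : -(k₂ * G₀) ≤ |k₂| * b₂ := by
    calc -(k₂ * G₀) = (-k₂) * G₀ := by ring
      _ ≤ |k₂| * G₀ := mul_le_mul_of_nonneg_right (neg_le_abs _) hG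
      _ ≤ _ := by gcongr
  have e2 : -(k₃ * W₀) ≤ |k₃| * L := by
    calc -(k₃ * W₀) = (-k₃) * W₀ := by ring
      _ ≤ |k₃| * W₀ := mul_le_mul_of_nonneg_right (neg_le_abs _) hW
      _ ≤ _ := by gcongr
  have e3 : C * W₁ ≤ C * b₁ := by gcongr
  have e4 : C * (i * (c * b₁) + i * (c * b₂) + i * (c * L)) ≤ C * (c * (b₁ + b₂ + L)) := by
    have : i * (c * (b₁ + b₂ + L)) ≤ 1 * (c * (b₁ + b₂ + L)) := by gcongr
    rw [show i * (c * b₁) + i * (c * b₂) + i * (c * L) = i * (c * (b₁ + b₂ + L)) by ring]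
    rw [one_mul] at this
    gcongr
  have p1 : 0 ≤ C * b₂ := by positivity
  have p2 : 0 ≤ C * L := by positivity
  have p3 : 0 ≤ |k₂| * b₁ := by positivity
  have p4 : 0 ≤ |k₂| * L := by positivity
  have p5 : 0 ≤ |k₃| * b₁ := by positivity
  have p6 : 0 ≤ |k₃| * b₂ := by positivity
  nlinarith

lemma growth_algebra {p D D' ε E M X b L P T : ℝ} (hp : 1 < p) (hD : 0 ≤ D) (hD' : 0 ≤ D')
    (hε : 0 < ε) (hE : 0 ≤ E) (hDε : D * ε ≤ (p - 1) / 2) (hX : 0 ≤ X) (hL : 0 ≤ L) (hP : 0 ≤ P)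
    (h₁ : (p - 1) * X ≤ D * b + D * L) (h₂ : b ≤ ε * X + E * L) (h₃ : p * P ≤ X + D' * b + D' * L)
    (hM : M = 2 * (D * E + D) / (p - 1) + D' * (ε * (2 * (D * E + D) / (p - 1)) + E) + D')
    (h₄ : L ≤ 1 / (2 * (M + 1)) * P + T) :
    X + b + L + P ≤ ((2 * (D * E + D) / (p - 1) + (ε * (2 * (D * E + D) / (p - 1)) + E) + 1) * 2
      + 2 * M) * T := by
  have hp1 : 0 < p - 1 := by linarith
  have f2 : D * b ≤ (p - 1) / 2 * X + D * E * L := by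
    calc D * b ≤ D * (ε * X + E * L) := by gcongr
      _ = D * ε * X + D * E * L := by ring
      _ ≤ _ := by gcongr
  set N : ℝ := 2 * (D * E + D) / (p - 1) with hN
  have hN0 : 0 ≤ N := by positivity
  have f3 : X ≤ N * L := by
    rw [hN, div_mul_eq_mul_div, le_div_iff₀ hp1]
    linarith
  have f4 : b ≤ (ε * N + E) * L := by
    calc b ≤ ε * X + E * L := h₂
      _ ≤ ε * (N * L) + E * L := by gcongr
      _ = _ := by ring
  have hM0 : 0 ≤ M := by rw [hM]; positivity
  have f5 : P ≤ M * L := by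
    have h5 : P ≤ p * P := le_mul_of_one_le_left hP hp.le
    have h6 : D' * b ≤ D' * ((ε * N + E) * L) := by gcongr
    rw [hM]
    linarith
  have f6 : L ≤ 2 * T := by
    have h7 : 1 / (2 * (M + 1)) * P ≤ 1 / 2 * L := by
      rw [div_mul_eq_mul_div, div_le_iff₀ (by positivity)]
      linarith
    linarith
  have f7 : X + b + L + P ≤ (N + (ε * N + E) + 1 + M) * L := by linarith
  refine f7.trans ?_
  calc (N + (ε * N + E) + 1 + M) * L ≤ (N + (ε * N + E) + 1 + M) * (2 * T) := by gcongr
    _ = _ := by ring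

set_option maxHeartbeats 2000000 in
/-- Growth estimate: the energy on a long annulus grows at most linearly in its length. -/
lemma exists_growth_bound {p δ A : ℝ} (hp : 1 < p) {w : Euc n → V} {q : Euc n → ℝ}
    (H : StableProfile p δ A w q) {F : ℝ → ℝ} (hF : IsCut F) (hF0 : ∀ t, 0 ≤ F t)
    (hF1 : ∀ t, F t ≤ 1) (hFs : ∀ t, F t ≠ 0 → 0 < t) :
    ∃ K : ℕ, 4 ≤ K ∧ ∃ C, 0 ≤ C ∧ ∀ s l : ℝ, A ≤ s → 1 ≤ l →
      radInt (stretch (fun t => F t ^ (2 * K)) s l) (fun x => eDens w x + q x) ≤ C * l := by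
  obtain ⟨K0, hK0⟩ := exists_nat_ge (1 + 2 * (4 / (p - 1)))
  set K : ℕ := K0 + 4 with hK
  refine ⟨K, by omega, ?_⟩
  have hN : 1 + 2 * (4 / (p - 1)) ≤ ((2 * K - 4 : ℕ) : ℝ) := by
    refine hK0.trans ?_
    exact_mod_cast (by omega : K0 ≤ 2 * K - 4)
  have hw := H.smooth
  obtain ⟨C₀, hC₀, henergy⟩ := exists_energy_inequality (V := V) n p δ
  obtain ⟨c, hc, hcut⟩ := exists_cutBound_pow hF hF0 hF1 (K := K) (by omega)
  obtain ⟨c', hc', hder⟩ := hF.exists_iteratedDeriv_pow_bound hF0 (2 * K - 2) 2 (by omega)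
  obtain ⟨c₁, hc₁, hone⟩ := exists_radInt_stretch_le n F
  set D : ℝ := C₀ + C₀ * c + |2 * ((p - 1) * nzero n - p * δ ^ 2)|
    + |p * (δ ^ 4 - (2 * nzero n + 4) * δ ^ 2 + nzero n ^ 2) - nzero n ^ 2| with hD
  have hD0 : 0 ≤ D := by positivity
  have hp1 : 0 < p - 1 := by linarith
  set ε : ℝ := (p - 1) / (2 * (D + 1)) with hεd
  have hε : 0 < ε := by positivity
  have hDε : D * ε ≤ (p - 1) / 2 := by
    rw [hεd, ← mul_div_assoc, div_le_div_iff₀ (by positivity) (by norm_num)]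
    nlinarith
  set E : ℝ := 2 * ε⁻¹ + c' / 2 with hE
  have hE0 : 0 ≤ E := by positivity
  set D' : ℝ := C₀ + C₀ * c + |-(2 * nzero n)| + |-(nzero n ^ 2)| with hD'
  have hD'0 : 0 ≤ D' := by positivity
  set M : ℝ := 2 * (D * E + D) / (p - 1) + D' * (ε * (2 * (D * E + D) / (p - 1)) + E) + D' with hM
  have hM0 : 0 ≤ M := by positivity
  have hε' : 0 < 1 / (2 * (M + 1)) := by positivity
  obtain ⟨C₅, hC₅, hyoung⟩ := exists_young_pow hp hε' hN
  refine ⟨((2 * (D * E + D) / (p - 1) + (ε * (2 * (D * E + D) / (p - 1)) + E) + 1) * 2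
      + 2 * M) * (C₅ * c₁), by positivity, fun s l hs hl => ?_⟩
  have hl0 : 0 < l := by linarith
  set y : ℝ → ℝ := stretch (fun t => F t ^ (2 * K)) s l with hy
  set ρ : ℝ → ℝ := stretch (fun t => F t ^ (2 * K - 2)) s l with hρ
  set r : ℝ → ℝ := stretch (fun t => F t ^ (2 * K - 4)) s l with hr
  set z : ℝ → ℝ := stretch (fun t => F t ^ K) s l with hz
  have cy : IsCut y := (hF.pow (by omega)).stretch s hl0
  have cρ : IsCut ρ := (hF.pow (by omega)).stretch s hl0
  have cr : IsCut r := (hF.pow (by omega)).stretch s hl0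
  have cz : IsCut z := (hF.pow (by omega)).stretch s hl0
  have cF : IsCut (stretch F s l) := hF.stretch s hl0
  have y0 : ∀ t, 0 ≤ y t := fun t => pow_nonneg (hF0 _) _
  have ρ0 : ∀ t, 0 ≤ ρ t := fun t => pow_nonneg (hF0 _) _
  have r0 : ∀ t, 0 ≤ r t := fun t => pow_nonneg (hF0 _) _
  have yρ : ∀ t, y t ≤ ρ t := fun t => pow_le_pow_of_le_one (hF0 _) (hF1 _) (by omega)
  have yr : ∀ t, y t ≤ r t := fun t => pow_le_pow_of_le_one (hF0 _) (hF1 _) (by omega)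
  have hzz : (fun t => z t * z t) = y := by
    ext t
    simp only [hz, hy, stretch]
    ring
  have hρyr : ∀ t, ρ t ^ 2 = y t * r t := fun t => by
    simp only [hρ, hy, hr, stretch]
    rw [← pow_mul, ← pow_add]
    congr 1
    omega
  have hρ2 : ∀ t, |iteratedDeriv 2 ρ t| ≤ c' * r t := fun t => by
    rw [hρ, iteratedDeriv_stretch (hF.pow (by omega)).smooth, abs_mul,
      abs_of_nonneg (by positivity)]
    have h1 : l⁻¹ ^ 2 ≤ 1 := pow_le_one₀ (by positivity) (inv_le_one_of_one_le₀ hl)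
    calc l⁻¹ ^ 2 * _ ≤ 1 * _ := mul_le_mul_of_nonneg_right h1 (abs_nonneg _)
      _ ≤ c' * r t := by
        rw [one_mul]
        refine (hder _).trans (le_of_eq ?_)
        rw [show 2 * K - 2 - 2 = 2 * K - 4 by omega]
        rfl
  have hl1 : l⁻¹ ≤ 1 := inv_le_one_of_one_le₀ hl
  have hl2 : 0 ≤ l⁻¹ := by positivity
  have hsupp : ∀ t, z t ≠ 0 → A ≤ t := fun t ht => by
    have h1 : F ((t - s) / l) ≠ 0 := fun h => ht (by
      change F ((t - s) / l) ^ K = 0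
      rw [h, zero_pow (by omega)])
    have h2 := hFs _ h1
    have h3 : 0 < t - s := by
      by_contra h4
      exact absurd h2 (not_lt.2 (div_nonpos_of_nonpos_of_nonneg (by linarith) hl0.le))
    linarith
  have hst := H.stable z cz hsupp
  obtain ⟨e1, e2⟩ := henergy w hw z _ _ cz ((((hF.pow (by omega)).const_mul c).stretch s hl0).const_mul
    l⁻¹) ((((hF.pow (by omega)).const_mul c).stretch s hl0).const_mul l⁻¹)
    (hcut.stretch (hF.pow (by omega)) s hl) _ (H.tested z cz) hst
  have pull : ∀ (G : ℝ → ℝ) (f g : Euc n → V), pair (fun t => l⁻¹ * stretch (fun t => c * G t) s l t) f g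
      = l⁻¹ * (c * pair (stretch G s l) f g) := fun G f g => by
    rw [pair_const_mul_left]
    congr 1
    exact pair_const_mul_left c (stretch G s l) f g
  rw [pull, pull, pull, hzz] at e1
  rw [pull, pull, pull, hzz, ← hρ, ← hr] at e2
  rw [← hρ, ← hr] at e1
  have hD1 : ContDiffOn ℝ 3 (euler w) (Punct n) := hw.linField (by norm_num) _
  have hD2 : ContDiffOn ℝ 2 (euler w) (Punct n) := hD1.of_le (by norm_num)
  have hw2 : ContDiffOn ℝ 2 w (Punct n) := hw.of_le (by norm_num)
  have B := pair_interpolation cρ cy cr ρ0 y0 r0 hρyr hρ2 hε hw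
  have W1 := pair_self_mono cy cρ y0 yρ hD1.continuousOn
  have G0 := pair_angM_mono cy cρ y0 yρ hw2
  have W0 := pair_self_mono cy cr y0 yr hw.continuousOn
  have nW2 := pair_self_nonneg y0 (euler (euler w))
  have nM0 := pair_self_nonneg y0 (angM w)
  have nG1 := pair_angM_nonneg cy y0 hD2
  have nW1 := pair_self_nonneg y0 (euler w)
  have nG0 := pair_angM_nonneg cy y0 hw2
  have nW0 := pair_self_nonneg y0 w
  have nb1 := pair_self_nonneg ρ0 (euler w)
  have nb2 := pair_angM_nonneg cρ ρ0 hw2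
  have nL := pair_self_nonneg r0 w
  have nP : 0 ≤ radInt y q := radInt_nonneg fun x hx => by
    rw [H.dens_eq x hx]
    exact mul_nonneg (y0 _) (by positivity)
  have hL : pair r w w ≤ 1 / (2 * (M + 1)) * radInt y q + C₅ * (c₁ * l) := by
    have hcw : ContinuousOn (fun x => ‖w x‖ ^ 2) (Punct n) := hw.continuousOn.norm.pow 2
    have h1 : radInt (n := n) (stretch F s l) (fun _ => 1) ≤ c₁ * l := hone s l hl0
    have h2 : pair r w w ≤ radInt (fun t => 1 / (2 * (M + 1)) * y t) q
        + radInt (n := n) (fun t => C₅ * stretch F s l t) (fun _ => 1) := by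
      rw [pair_self_eq]
      refine radInt_le_add cr (cy.const_mul _) (cF.const_mul _) hcw H.dens_cont continuousOn_const
        fun x hx => ?_
      have h3 := hyoung ‖w x‖ (F ((log ‖x‖ - s) / l)) (norm_nonneg _) (hF0 _) (hF1 _)
      rw [← H.dens_eq x hx, show 2 * K - 4 + 4 = 2 * K by omega] at h3
      simp only [rad, hr, hy, stretch]
      linarith
    rw [radInt_const_mul_left, radInt_const_mul_left] at h2
    have h3 : C₅ * radInt (n := n) (stretch F s l) (fun _ => 1) ≤ C₅ * (c₁ * l) := by gcongr
    linarith
  rw [radInt_eDens cy hw H.dens_cont]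
  set X := pair y (euler (euler w)) (euler (euler w)) + pair y (angM w) (angM w)
    + 2 * pair y (angM (euler w)) (euler w) with hX
  set L := pair r w w with hLd
  have f1 := le_of_energy_algebra hC₀ hc hl1 nb1 nb2 nL nG0 nW0 W1 G0 W0 e1
  rw [← hD] at f1
  have hX2 : pair y (euler (euler w)) (euler (euler w)) + pair y (angM w) (angM w) ≤ X := by
    linarith
  have nX : 0 ≤ X := by linarith
  have f2 := le_of_energy_algebra (a := 1) (X := p * radInt y q - X) (k₂ := -(2 * nzero n))
    (k₃ := -(nzero n ^ 2)) hC₀ hc hl1 nb1 nb2 nL nG0 nW0 W1 G0 W0 (by linarith)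
  rw [← hD', one_mul] at f2
  have f3 := growth_algebra hp hD0 hD'0 hε hE0 hDε nX nL nP f1 (B.trans (by gcongr)) (by linarith)
    hM hL
  rw [mul_assoc]
  linarith

end Growth

section Boundary

variable {n : ℕ} {V : Type*} [NormedAddCommGroup V] [InnerProductSpace ℝ V]

/-- Weighted dissipation. -/
def diss (δ : ℝ) (z : ℝ → ℝ) (w : Euc n → V) : ℝ :=
  pair z (euler (euler w)) (euler (euler w)) + pair z (angM (euler w)) (euler w)
    + (nzero n + 2 - δ ^ 2) * pair z (euler w) (euler w)

/-- The monotonicity identity up to boundary terms. -/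
lemma exists_boundary_bound (n : ℕ) [NeZero n] {p : ℝ} (hp : 1 < p) (a δ : ℝ)
    (hδ : δ = ((n : ℝ) - 4) / 2 - a) :
    ∃ C, 0 ≤ C ∧ ∀ u : Euc n → V, ContDiff ℝ 4 u →
      (∀ x, lapV (lapV u) x = ‖u x‖ ^ (p - 1) • u x) → ∀ ζ m : ℝ → ℝ, IsCut ζ → IsCut m →
      (∀ k, 1 ≤ k → k ≤ 3 → ∀ t, |iteratedDeriv k ζ t| ≤ m t) →
      |4 * δ * diss δ ζ (twist a u) - (4 - a * (p - 1)) / (p + 1) * radInt ζ (potDens p a u)|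
        ≤ C * radInt m (fun x => eDens (twist a u) x + potDens p a u x) := by
  refine ⟨3 / 2 + 1 / 2 + |2 * δ| + |(1 / 2) * (6 * δ ^ 2 - 4 - 2 * nzero n)| + 1 + 1 / 2
    + |(1 / 2) * (2 * nzero n - 2 * δ ^ 2)|
    + |(1 / 2) * (δ ^ 4 - (2 * nzero n + 4) * δ ^ 2 + nzero n ^ 2)| + |1 / (p + 1)|,
    by positivity, fun u hu heq ζ m hζ hm hb => ?_⟩
  set w := twist a u with hwd
  set q := potDens p a u with hq
  have hw : ContDiffOn ℝ 4 w (Punct n) := hu.contDiffOn.twist a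
  have hqc : ContinuousOn q (Punct n) := (contDiffOn_potDens hp a (hu.of_le (by norm_num))).continuousOn
  have hD : ContDiffOn ℝ 3 (euler w) (Punct n) := hw.linField (by norm_num) _
  have hD' : ContDiffOn ℝ 2 (euler w) (Punct n) := hD.of_le (by norm_num)
  have hw' : ContDiffOn ℝ 2 w (Punct n) := hw.of_le (by norm_num)
  have hD2 : ContDiffOn ℝ 2 (euler (euler w)) (Punct n) := hD.linField (by norm_num) _
  have hM : ContDiffOn ℝ 2 (angM w) (Punct n) := hw.angM (by norm_num)
  have h1 := pair_euler_twist hp hu heq a hζ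
  have h2 := pair_euler_cylOp hζ hw δ
  rw [← hδ] at h1
  rw [h1] at h2
  have hT := radInt_eDens hm hw hqc
  set T := radInt m (fun x => eDens w x + q x)
  have m0 : ∀ t, 0 ≤ m t := fun t => (abs_nonneg _).trans (hb 1 le_rfl (by norm_num) t)
  have q0 : ∀ x, 0 ≤ q x := potDens_nonneg p a u
  have n1 := pair_self_nonneg m0 (euler (euler w))
  have n2 := pair_self_nonneg m0 (angM w)
  have n3 := pair_angM_nonneg hm m0 hD'
  have n4 := pair_self_nonneg m0 (euler w)
  have n5 := pair_angM_nonneg hm m0 hw'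
  have n6 := pair_self_nonneg m0 w
  have n7 : 0 ≤ radInt m q := radInt_nonneg fun x _ => mul_nonneg (m0 _) (q0 x)
  have i1 := hζ.iteratedDeriv 1
  have b1 := hb 1 le_rfl (by norm_num)
  have key : ∀ c x M : ℝ, |x| ≤ M → M ≤ T → |c * x| ≤ |c| * T := fun c x M h h' => by
    rw [abs_mul]
    exact mul_le_mul_of_nonneg_left (h.trans h') (abs_nonneg _)
  have a1 := abs_le.1 (key (3 / 2) _ _ (abs_pair_self_le i1 hm b1 hD2.continuousOn) (by linarith))
  have a2 := abs_le.1 (key (1 / 2) _ _ (abs_pair_self_le (hζ.iteratedDeriv 3) hm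
    (hb 3 (by norm_num) le_rfl) hD.continuousOn) (by linarith))
  have a3 := abs_le.1 (key (2 * δ) _ _ (abs_pair_self_le (hζ.iteratedDeriv 2) hm
    (hb 2 (by norm_num) (by norm_num)) hD.continuousOn) (by linarith))
  have a4 := abs_le.1 (key ((1 / 2) * (6 * δ ^ 2 - 4 - 2 * nzero n)) _ _
    (abs_pair_self_le i1 hm b1 hD.continuousOn) (by linarith))
  have a5 := abs_le.1 (key 1 _ _ (abs_pair_angM_le i1 hm b1 hD') (by linarith))
  have a6 := abs_le.1 (key (1 / 2) _ _ (abs_pair_self_le i1 hm b1 hM.continuousOn) (by linarith))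
  have a7 := abs_le.1 (key ((1 / 2) * (2 * nzero n - 2 * δ ^ 2)) _ _
    (abs_pair_angM_le i1 hm b1 hw') (by linarith))
  have a8 := abs_le.1 (key ((1 / 2) * (δ ^ 4 - (2 * nzero n + 4) * δ ^ 2 + nzero n ^ 2)) _ _
    (abs_pair_self_le i1 hm b1 hw.continuousOn) (by linarith))
  have a9 := abs_le.1 (key (1 / (p + 1)) _ _ (abs_radInt_le i1 hm b1 hqc hqc fun x _ =>
    (abs_of_nonneg (q0 x)).le) (by linarith))
  have r1 : |(3 : ℝ) / 2| = 3 / 2 := abs_of_pos (by norm_num)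
  have r2 : |(1 : ℝ) / 2| = 1 / 2 := abs_of_pos (by norm_num)
  rw [r1] at a1
  rw [r2] at a2 a6
  rw [abs_one] at a5
  unfold diss
  rw [abs_le]
  constructor <;>
    linarith [a1.1, a1.2, a2.1, a2.2, a3.1, a3.2, a4.1, a4.2, a5.1, a5.2, a6.1, a6.2, a7.1, a7.2,
      a8.1, a8.2, a9.1, a9.2]

end Boundary

section Comparison

lemma exp_two_mul_eq (b t : ℝ) : Real.exp (b * t) ^ 2 = Real.exp (2 * b * t) := by
  rw [← Real.exp_nat_mul]
  congr 1
  push_cast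
  ring

variable {n : ℕ} {V : Type*} [NormedAddCommGroup V]

section NormedSpace

variable [NormedSpace ℝ V]

lemma norm_add_smul_sq_le (a b : V) (c : ℝ) :
    ‖a + c • b‖ ^ 2 ≤ 2 * (‖a‖ ^ 2 + c ^ 2 * ‖b‖ ^ 2) := by
  have h := norm_add_le a (c • b)
  have h2 : ‖c • b‖ ^ 2 = c ^ 2 * ‖b‖ ^ 2 := by
    rw [norm_smul, mul_pow, Real.norm_eq_abs, sq_abs]
  rw [← h2]
  nlinarith [norm_nonneg (a + c • b), norm_nonneg a, norm_nonneg (c • b),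
    sq_nonneg (‖a‖ - ‖c • b‖)]

lemma norm_twist_sq (γ : ℝ) (f : Euc n → V) (x : Euc n) :
    ‖twist γ f x‖ ^ 2 = Real.exp (γ * log ‖x‖) ^ 2 * ‖f x‖ ^ 2 := by
  simp only [twist, rad, norm_smul, mul_pow, Real.norm_eq_abs, sq_abs]

end NormedSpace

variable [InnerProductSpace ℝ V]

lemma angG_self_eq (f : Euc n → V) (x : Euc n) :
    angG f f x = (1 / 2) * ∑ i : Fin n, ∑ j : Fin n, ‖linField (rot i j) f x‖ ^ 2 := by
  simp only [angG, real_inner_self_eq_norm_sq]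

lemma angG_twist {f : Euc n → V} (hf : ContDiffOn ℝ 1 f (Punct n)) (γ : ℝ) {x : Euc n}
    (hx : x ∈ Punct n) :
    angG (twist γ f) (twist γ f) x = Real.exp (γ * log ‖x‖) ^ 2 * angG f f x := by
  rw [angG_self_eq, angG_self_eq]
  have : ∀ i j, ‖linField (rot i j) (twist γ f) x‖ ^ 2
      = Real.exp (γ * log ‖x‖) ^ 2 * ‖linField (rot i j) f x‖ ^ 2 := fun i j => by
    rw [linField_rot_twist hf γ i j hx, norm_twist_sq]
  simp only [this, ← Finset.mul_sum]
  ring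

lemma angG_congr {f g : Euc n → V} (h : EqOn f g (Punct n)) {x : Euc n} (hx : x ∈ Punct n) :
    angG f f x = angG g g x := by
  simp only [angG, h.linField _ hx]

lemma angG_add_smul_le {f g : Euc n → V} (hf : ContDiffOn ℝ 1 f (Punct n))
    (hg : ContDiffOn ℝ 1 g (Punct n)) (c : ℝ) {x : Euc n} (hx : x ∈ Punct n) :
    angG (fun x => f x + c • g x) (fun x => f x + c • g x) x
      ≤ 2 * (angG f f x + c ^ 2 * angG g g x) := by
  simp only [angG_self_eq]
  have h : ∑ i : Fin n, ∑ j : Fin n, ‖linField (rot i j) (fun x => f x + c • g x) x‖ ^ 2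
      ≤ ∑ i : Fin n, ∑ j : Fin n,
        2 * (‖linField (rot i j) f x‖ ^ 2 + c ^ 2 * ‖linField (rot i j) g x‖ ^ 2) := by
    refine Finset.sum_le_sum fun i _ => Finset.sum_le_sum fun j _ => ?_
    rw [linField_add_smul hf hg _ c hx]
    exact norm_add_smul_sq_le _ _ _
  simp only [← Finset.mul_sum, Finset.sum_add_distrib] at h
  linarith

lemma eDens_twist_le {f : Euc n → V} (hf : ContDiffOn ℝ 4 f (Punct n)) (a : ℝ) {x : Euc n}
    (hx : x ∈ Punct n) :
    eDens (twist a f) x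
      ≤ (10 + 20 * a ^ 2 + 10 * a ^ 4) * Real.exp (a * log ‖x‖) ^ 2 * eDens f x := by
  have hf1 : ContDiffOn ℝ 1 f (Punct n) := hf.of_le (by norm_num)
  have hD : ContDiffOn ℝ 3 (euler f) (Punct n) := hf.linField (by norm_num) _
  have hD1 : ContDiffOn ℝ 1 (euler f) (Punct n) := hD.of_le (by norm_num)
  have hg : ContDiffOn ℝ 1 (fun x => euler f x + a • f x) (Punct n) := hD1.add_smul hf1 a
  have e1 := euler_twist hf1 a
  have e2 : euler (euler (twist a f)) x
      = twist a (fun x => euler (fun x => euler f x + a • f x) x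
        + a • (euler f x + a • f x)) x := (e1.linField _ hx).trans (euler_twist hg a hx)
  have e3 := euler_add_smul hD1 hf1 a hx
  have b1 : ‖euler (fun x => euler f x + a • f x) x + a • (euler f x + a • f x)‖ ^ 2
      ≤ 4 * (‖euler (euler f) x‖ ^ 2 + a ^ 2 * ‖euler f x‖ ^ 2)
        + 4 * a ^ 2 * (‖euler f x‖ ^ 2 + a ^ 2 * ‖f x‖ ^ 2) := by
    rw [e3]
    have h1 := norm_add_smul_sq_le (euler (euler f) x + a • euler f x) (euler f x + a • f x) a
    have h2 := norm_add_smul_sq_le (euler (euler f) x) (euler f x) a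
    have h3 := mul_le_mul_of_nonneg_left (norm_add_smul_sq_le (euler f x) (f x) a) (sq_nonneg a)
    linarith
  have b2 := norm_add_smul_sq_le (euler f x) (f x) a
  have b3 := angG_add_smul_le hD1 hf1 a hx
  have n1 := angG_self_nonneg f x
  have n2 := angG_self_nonneg (euler f) x
  have key : eDens (twist a f) x = Real.exp (a * log ‖x‖) ^ 2 *
      (‖euler (fun x => euler f x + a • f x) x + a • (euler f x + a • f x)‖ ^ 2
        + ‖angM f x‖ ^ 2 + angG (fun x => euler f x + a • f x) (fun x => euler f x + a • f x) x
        + ‖euler f x + a • f x‖ ^ 2 + angG f f x + ‖f x‖ ^ 2) := by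
    unfold eDens
    rw [e2, norm_twist_sq, angM_twist (hf.of_le (by norm_num)) a hx, norm_twist_sq,
      angG_congr e1 hx, angG_twist hg a hx, e1 hx, norm_twist_sq, angG_twist hf1 a hx,
      norm_twist_sq]
    ring
  rw [key, mul_comm (10 + 20 * a ^ 2 + 10 * a ^ 4), mul_assoc]
  refine mul_le_mul_of_nonneg_left ?_ (sq_nonneg _)
  unfold eDens
  have p0 := sq_nonneg ‖euler (euler f) x‖
  have p1 := sq_nonneg ‖angM f x‖
  have p2 := sq_nonneg ‖euler f x‖
  have p3 := sq_nonneg ‖f x‖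
  have ha := sq_nonneg a
  have ha4 : 0 ≤ a ^ 4 := by positivity
  nlinarith [mul_nonneg ha p0, mul_nonneg ha p1, mul_nonneg ha p2, mul_nonneg ha p3,
    mul_nonneg ha n1, mul_nonneg ha n2, mul_nonneg ha4 p0, mul_nonneg ha4 p1, mul_nonneg ha4 p2,
    mul_nonneg ha4 p3, mul_nonneg ha4 n1, mul_nonneg ha4 n2]

lemma continuous_eDens {u : Euc n → V} (hu : ContDiff ℝ 4 u) : Continuous (eDens u) := by
  have hD : ContDiff ℝ 3 (euler u) := hu.linField (by norm_num) _
  have hD2 : ContDiff ℝ 2 (euler (euler u)) := hD.linField (by norm_num) _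
  have hM : ContDiff ℝ 2 (angM u) := hu.angM (by norm_num)
  have hG : ∀ {f : Euc n → V}, ContDiff ℝ 1 f → Continuous (angG f f) := fun hf =>
    continuous_const.mul (continuous_finsetSum _ fun i _ => continuous_finsetSum _ fun j _ =>
      (hf.linField (k := 0) (by simp) _).continuous.inner
        (hf.linField (k := 0) (by simp) _).continuous)
  exact (((((hD2.continuous.norm.pow 2).add (hM.continuous.norm.pow 2)).add
    (hG (hD.of_le (by norm_num)))).add (hD.continuous.norm.pow 2)).add
    (hG (hu.of_le (by norm_num)))).add (hu.continuous.norm.pow 2)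

/-- Near the origin the twisted energy density of a smooth map is small. -/
lemma exists_total_le_near_zero {p : ℝ} (hp : 1 < p) (a : ℝ) {u : Euc n → V}
    (hu : ContDiff ℝ 4 u) : ∃ C, 0 ≤ C ∧ ∀ x ∈ Punct n, ‖x‖ ≤ 1 →
      eDens (twist a u) x + potDens p a u x ≤ C * Real.exp (2 * a * log ‖x‖) := by
  have hc : Continuous fun x => (10 + 20 * a ^ 2 + 10 * a ^ 4) * eDens u x + ‖u x‖ ^ (p + 1) :=
    (continuous_const.mul (continuous_eDens hu)).add
      (hu.continuous.norm.rpow_const fun _ => Or.inr (by linarith))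
  obtain ⟨C, hC⟩ := (isCompact_closedBall (0 : Euc n) 1).exists_bound_of_continuousOn hc.continuousOn
  have hC0 : 0 ≤ C := (norm_nonneg _).trans (hC 0 (by simp))
  refine ⟨C, hC0, fun x hx hx1 => ?_⟩
  have h1 := (le_abs_self _).trans (hC x (by simpa using hx1))
  have h2 := eDens_twist_le hu.contDiffOn a hx
  have h3 := exp_two_mul_eq a (log ‖x‖)
  have hlog : log ‖x‖ ≤ 0 := Real.log_nonpos (norm_nonneg _) hx1
  have h4 : potDens p a u x ≤ Real.exp (2 * a * log ‖x‖) * ‖u x‖ ^ (p + 1) := by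
    simp only [potDens, twist, rad, smul_eq_mul]
    exact mul_le_mul_of_nonneg_right (Real.exp_le_exp.2 (by linarith)) (by positivity)
  rw [h3] at h2
  have h5 := mul_le_mul_of_nonneg_left h1 (Real.exp_pos (2 * a * log ‖x‖)).le
  linarith

lemma total_twist_le {p : ℝ} (a γ : ℝ) {u : Euc n → V} (hu : ContDiff ℝ 4 u) {x : Euc n}
    (hx : x ∈ Punct n) : eDens (twist a u) x + potDens p a u x
      ≤ (10 + 20 * (a - γ) ^ 2 + 10 * (a - γ) ^ 4) * Real.exp (2 * (a - γ) * log ‖x‖)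
        * (eDens (twist γ u) x + potDens p γ u x) := by
  have h1 := eDens_twist_le (hu.contDiffOn.twist γ) (a - γ) hx
  rw [twist_twist, sub_add_cancel, exp_two_mul_eq] at h1
  have h2 : potDens p a u x = Real.exp (2 * (a - γ) * log ‖x‖) * potDens p γ u x := by
    rw [potDens_eq_twist p a γ u]
    simp only [twist, rad, smul_eq_mul]
  have h3 : 0 ≤ Real.exp (2 * (a - γ) * log ‖x‖) * potDens p γ u x :=
    mul_nonneg (Real.exp_pos _).le (potDens_nonneg _ _ _ _)
  have h4 : Real.exp (2 * (a - γ) * log ‖x‖) * potDens p γ u x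
      ≤ (10 + 20 * (a - γ) ^ 2 + 10 * (a - γ) ^ 4)
        * (Real.exp (2 * (a - γ) * log ‖x‖) * potDens p γ u x) :=
    le_mul_of_one_le_left h3 (by nlinarith [sq_nonneg (a - γ), sq_nonneg ((a - γ) ^ 2)])
  rw [h2]
  linarith

end Comparison

section Plateau

/-- A cutoff equal to one on `[2 - S, s + l]`. -/
def plateau (S s l t : ℝ) : ℝ := stretch step (-S) 1 t - stretch step s l t

variable {S s l : ℝ}

lemma plateau_eq_one (hl : 0 < l) {t : ℝ} (h₁ : 2 - S ≤ t) (h₂ : t ≤ s + l) :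
    plateau S s l t = 1 := by
  have e1 : step ((t - -S) / 1) = 1 := step_of_ge (by linarith)
  have e2 : step ((t - s) / l) = 0 := step_of_le (by
    rw [div_le_one hl]
    linarith)
  simp only [plateau, stretch, e1, e2, sub_zero]

lemma plateau_nonneg (hS : 3 ≤ S) (hs : 0 ≤ s) (hl : 0 < l) (t : ℝ) : 0 ≤ plateau S s l t := by
  rcases le_total (2 - S) t with h | h
  · have e1 : step ((t - -S) / 1) = 1 := step_of_ge (by linarith)
    simp only [plateau, stretch, e1]
    linarith [step_le_one ((t - s) / l)]
  · have e2 : step ((t - s) / l) = 0 := step_of_le (by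
      rw [div_le_one hl]
      linarith)
    simp only [plateau, stretch, e2, sub_zero]
    exact step_nonneg _

lemma isCut_plateau (hS : 3 ≤ S) (hs : 0 ≤ s) (hl : 0 < l) : IsCut (plateau S s l) := by
  refine ⟨(contDiff_stretch contDiff_step _ _).sub (contDiff_stretch contDiff_step _ _),
    HasCompactSupport.intro (isCompact_Icc (a := 1 - S) (b := s + 2 * l)) fun t ht => ?_⟩
  have h : t < 1 - S ∨ s + 2 * l < t := by
    by_contra! h
    exact ht ⟨h.1, h.2⟩
  rcases h with h | h
  · have e1 : step ((t - -S) / 1) = 0 := step_of_le (by linarith)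
    have e2 : step ((t - s) / l) = 0 := step_of_le (by
      rw [div_le_one hl]
      linarith)
    simp only [plateau, stretch, e1, e2, sub_zero]
  · have e1 : step ((t - -S) / 1) = 1 := step_of_ge (by linarith)
    have e2 : step ((t - s) / l) = 1 := step_of_ge (by
      rw [le_div_iff₀ hl]
      linarith)
    simp only [plateau, stretch, e1, e2, sub_self]

/-- Derivatives of the step function, uniformly controlled by any weight which is one on `[1, 2]`. -/
lemma exists_iteratedDeriv_stretch_step_bound : ∃ c, 0 ≤ c ∧ ∀ G : ℝ → ℝ, (∀ t, 0 ≤ G t) →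
    (∀ t, 1 ≤ t → t ≤ 2 → G t = 1) → ∀ s l : ℝ, 1 ≤ l → ∀ k, 1 ≤ k → k ≤ 3 → ∀ t,
      |iteratedDeriv k (stretch step s l) t| ≤ c * (l⁻¹ * stretch G s l t) := by
  choose! c hc0 hc using exists_iteratedDeriv_step_bound
  refine ⟨c 1 + c 2 + c 3, by
    have := hc0 1 one_ne_zero
    have := hc0 2 two_ne_zero
    have := hc0 3 three_ne_zero
    positivity, fun G hG hG1 s l hl k hk1 hk3 t => ?_⟩
  have hk0 : k ≠ 0 := by omega
  have hck : c k ≤ c 1 + c 2 + c 3 := by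
    have := hc0 1 one_ne_zero
    have := hc0 2 two_ne_zero
    have := hc0 3 three_ne_zero
    interval_cases k <;> linarith
  have hl0 : 0 ≤ l⁻¹ := by positivity
  rw [iteratedDeriv_stretch contDiff_step, abs_mul, abs_of_nonneg (pow_nonneg hl0 k)]
  have h1 : |stretch (iteratedDeriv k step) s l t| ≤ (c 1 + c 2 + c 3) * stretch G s l t := by
    simp only [stretch]
    by_cases h : 1 ≤ (t - s) / l ∧ (t - s) / l ≤ 2
    · rw [hG1 _ h.1 h.2, mul_one]
      exact (hc k hk0 _).trans hck
    · rw [iteratedDeriv_step_eq_zero hk0 (by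
        by_contra! h'
        exact h ⟨h'.1, h'.2⟩), abs_zero]
      exact mul_nonneg ((hc0 k hk0).trans hck) (hG _)
  calc l⁻¹ ^ k * |stretch (iteratedDeriv k step) s l t|
      ≤ l⁻¹ * ((c 1 + c 2 + c 3) * stretch G s l t) :=
        mul_le_mul (inv_pow_le_inv hl hk1) h1 (abs_nonneg _) hl0
    _ = _ := by ring

variable {n : ℕ} {V : Type*} [NormedAddCommGroup V] [InnerProductSpace ℝ V]

lemma continuousOn_total {p : ℝ} (hp : 1 < p) (a : ℝ) {u : Euc n → V} (hu : ContDiff ℝ 4 u) :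
    ContinuousOn (fun x => eDens (twist a u) x + potDens p a u x) (Punct n) :=
  (continuousOn_eDens (hu.contDiffOn.twist a)).add
    (contDiffOn_potDens hp a (hu.of_le (by norm_num))).continuousOn

variable [NeZero n]

lemma exists_left_bound {p a : ℝ} (hp : 1 < p) (ha : 0 < a) {u : Euc n → V}
    (hu : ContDiff ℝ 4 u) {G : ℝ → ℝ} (hG : IsCut G) (hG0 : ∀ t, 0 ≤ G t)
    (hGs : ∀ t, G t ≠ 0 → t < 3) : ∃ C, 0 ≤ C ∧ ∀ S, 3 ≤ S →
      radInt (stretch G (-S) 1) (fun x => eDens (twist a u) x + potDens p a u x)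
        ≤ C * Real.exp (-(2 * a * S)) := by
  obtain ⟨C, hC, h⟩ := exists_total_le_near_zero hp a hu
  obtain ⟨c, hc, hone⟩ := exists_radInt_stretch_le n G
  refine ⟨C * Real.exp (6 * a) * c, by positivity, fun S hS => ?_⟩
  have hcut := hG.stretch (-S) one_pos
  have h1 : radInt (stretch G (-S) 1) (fun x => eDens (twist a u) x + potDens p a u x)
      ≤ radInt (n := n) (fun t => (C * Real.exp (6 * a) * Real.exp (-(2 * a * S)))
        * stretch G (-S) 1 t) (fun _ => 1) := by
    refine radInt_mono hcut.continuous hcut.compact (hcut.const_mul _).continuous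
      (hcut.const_mul _).compact (continuousOn_total hp a hu) continuousOn_const fun x hx => ?_
    simp only [rad, mul_one]
    by_cases h0 : stretch G (-S) 1 (log ‖x‖) = 0
    · rw [h0]
      simp
    have h2 : log ‖x‖ < 3 - S := by
      have := hGs _ h0
      linarith
    have hx0 : 0 < ‖x‖ := norm_pos_iff.2 hx
    have hx1 : ‖x‖ ≤ 1 := by
      by_contra! h3
      have := Real.log_pos h3
      linarith
    have h3 := h x hx hx1
    have h4 : Real.exp (2 * a * log ‖x‖) ≤ Real.exp (6 * a) * Real.exp (-(2 * a * S)) := by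
      rw [← Real.exp_add, Real.exp_le_exp]
      nlinarith
    have h5 : 0 ≤ stretch G (-S) 1 (log ‖x‖) := hG0 _
    calc _ ≤ stretch G (-S) 1 (log ‖x‖) * (C * (Real.exp (6 * a) * Real.exp (-(2 * a * S)))) := by
          refine mul_le_mul_of_nonneg_left (h3.trans ?_) h5
          gcongr
      _ = _ := by ring
  refine h1.trans ?_
  rw [radInt_const_mul_left]
  have h6 := hone (-S) 1 one_pos
  rw [mul_one] at h6
  calc _ ≤ C * Real.exp (6 * a) * Real.exp (-(2 * a * S)) * c := by gcongr
    _ = _ := by ring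

/-- The monotonicity identity integrated up to the origin. -/
lemma exists_monotonicity_bound {p a δ : ℝ} (hp : 1 < p) (ha : 0 < a)
    (hδ : δ = ((n : ℝ) - 4) / 2 - a) {u : Euc n → V} (hu : ContDiff ℝ 4 u)
    (heq : ∀ x, lapV (lapV u) x = ‖u x‖ ^ (p - 1) • u x) {G : ℝ → ℝ} (hG : IsCut G)
    (hG0 : ∀ t, 0 ≤ G t) (hG1 : ∀ t, 1 ≤ t → t ≤ 2 → G t = 1) {Φ : (ℝ → ℝ) → ℝ}
    (hΦ : ∀ z, IsCut z → Φ z = 4 * δ * diss δ z (twist a u)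
      - (4 - a * (p - 1)) / (p + 1) * radInt z (potDens p a u))
    (hmono : ∀ z ζ, IsCut z → IsCut ζ → (∀ t, 0 ≤ z t) → (∀ t, z t ≤ ζ t) → |Φ z| ≤ |Φ ζ|) :
    ∃ C, 0 ≤ C ∧ ∀ s l : ℝ, 0 ≤ s → 1 ≤ l → ∀ z, IsCut z → (∀ t, 0 ≤ z t) → (∀ t, z t ≤ 1) →
      (∀ t, z t ≠ 0 → t ≤ s + l) → |Φ z| ≤ C * (l⁻¹ *
        radInt (stretch G s l) (fun x => eDens (twist a u) x + potDens p a u x)) := by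
  obtain ⟨C, hC, hbd⟩ := exists_boundary_bound (V := V) n hp a δ hδ
  obtain ⟨c, hc, hstep⟩ := exists_iteratedDeriv_stretch_step_bound
  obtain ⟨χ, hχ, hχ0, -, hχ1, hχs⟩ := exists_isCut_bump (r := 1 / 2) (R := 1) (3 / 2)
    (by norm_num) (by norm_num)
  have hχ1' : ∀ t, 1 ≤ t → t ≤ 2 → χ t = 1 := fun t h1 h2 => hχ1 t (by
    rw [abs_le]
    constructor <;> linarith)
  obtain ⟨C₁, hC₁, hleft⟩ := exists_left_bound hp ha hu hχ hχ0 fun t ht => by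
    have := (abs_lt.1 (hχs t ht)).2
    linarith
  refine ⟨C * c, by positivity, fun s l hs hl z hz hz0 hz1 hzs => ?_⟩
  have hl0 : 0 < l := by linarith
  set T := radInt (stretch G s l) (fun x => eDens (twist a u) x + potDens p a u x) with hT
  obtain ⟨B, hB⟩ := hz.compact.isCompact.bddBelow
  have key : ∀ S, 3 ≤ S → 2 - B ≤ S →
      |Φ z| ≤ C * (c * (C₁ * Real.exp (-(2 * a * S)))) + C * c * (l⁻¹ * T) := fun S hS hSB => by
    have hζ := isCut_plateau hS hs hl0
    have h1 : ∀ t, z t ≤ plateau S s l t := fun t => by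
      by_cases ht : z t = 0
      · rw [ht]
        exact plateau_nonneg hS hs hl0 t
      · have hBt : B ≤ t := hB (subset_tsupport _ ht)
        rw [plateau_eq_one hl0 (by linarith) (hzs t ht)]
        exact hz1 t
    refine (hmono z _ hz hζ hz0 h1).trans ?_
    rw [hΦ _ hζ]
    have c1 := hχ.stretch (-S) one_pos
    have c2 := hG.stretch s hl0
    have h2 := hbd u hu heq (plateau S s l)
      (fun t => c * stretch χ (-S) 1 t + (c * l⁻¹) * stretch G s l t) hζ
      ((c1.const_mul c).add (c2.const_mul (c * l⁻¹))) fun k hk1 hk3 t => by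
        have d1 : ContDiffAt ℝ k (stretch step (-S) 1) t :=
          ((contDiff_stretch contDiff_step _ _).of_le (by exact_mod_cast le_top)).contDiffAt
        have d2 : ContDiffAt ℝ k (stretch step s l) t :=
          ((contDiff_stretch contDiff_step _ _).of_le (by exact_mod_cast le_top)).contDiffAt
        have e : iteratedDeriv k (plateau S s l) t = iteratedDeriv k (stretch step (-S) 1) t
            - iteratedDeriv k (stretch step s l) t := iteratedDeriv_fun_sub d1 d2
        rw [e]
        refine (abs_sub _ _).trans ?_
        have e1 := hstep χ hχ0 hχ1' (-S) 1 le_rfl k hk1 hk3 t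
        have e2 := hstep G hG0 hG1 s l hl k hk1 hk3 t
        rw [inv_one, one_mul] at e1
        linarith
    refine h2.trans ?_
    have hc1 := c1.const_mul c
    have hc2 := c2.const_mul (c * l⁻¹)
    rw [radInt_add_left hc1.continuous hc1.compact hc2.continuous hc2.compact
      (continuousOn_total hp a hu), radInt_const_mul_left, radInt_const_mul_left, mul_add]
    have h3 := hleft S hS
    have h4 : C * (c * radInt (stretch χ (-S) 1) (fun x => eDens (twist a u) x + potDens p a u x))
        ≤ C * (c * (C₁ * Real.exp (-(2 * a * S)))) := by gcongr
    linarith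
  have hlim : Tendsto (fun S : ℝ => C * (c * (C₁ * Real.exp (-(2 * a * S)))) + C * c * (l⁻¹ * T))
      atTop (nhds (C * (c * (C₁ * 0)) + C * c * (l⁻¹ * T))) := by
    have h1 : Tendsto (fun S : ℝ => Real.exp (-(2 * a * S))) atTop (nhds 0) :=
      Real.tendsto_exp_neg_atTop_nhds_zero.comp
        (tendsto_id.const_mul_atTop (by positivity : 0 < 2 * a))
    exact (((h1.const_mul _).const_mul _).const_mul _).add_const _
  have h := ge_of_tendsto hlim (by
    filter_upwards [eventually_ge_atTop (3 : ℝ), eventually_ge_atTop (2 - B)] with S h1 h2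
      using key S h1 h2)
  simpa using h

end Plateau

section Vanishing

variable {n : ℕ} [NeZero n]

lemma eq_zero_of_radInt_eq_zero {q : Euc n → ℝ} (hq : ContinuousOn q (Punct n))
    (h0 : ∀ x ∈ Punct n, 0 ≤ q x)
    (h : ∀ z, IsCut z → (∀ t, 0 ≤ z t) → (∀ t, z t ≤ 1) → radInt z q = 0) :
    ∀ x ∈ Punct n, q x = 0 := by
  intro x hx
  obtain ⟨z, hz, hz0, hz1, hzx, -⟩ := exists_isCut_bump (r := 1) (R := 2) (log ‖x‖)
    (by norm_num) (by norm_num)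
  have hc : Continuous fun y => rad z y • ((‖y‖ ^ n)⁻¹ * q y) :=
    continuous_rad_smul hz.continuous hz.compact (continuousOn_inv_norm_pow_mul hq)
      (inv_norm_zero_pow _ _)
  have hi := integrable_radInt hz.continuous hz.compact hq
  have hn : 0 ≤ fun y => rad z y • ((‖y‖ ^ n)⁻¹ * q y) := fun y => by
    by_cases hy : y = 0
    · subst hy
      simp [NeZero.ne n]
    · have := h0 y hy
      have := hz0 (log ‖y‖)
      simp only [rad, smul_eq_mul, Pi.zero_apply]
      positivity
  have h1 := (integral_eq_zero_iff_of_nonneg hn hi).1 (h z hz hz0 hz1)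
  have h2 : rad z x • ((‖x‖ ^ n)⁻¹ * q x) = (0 : ℝ) :=
    congrFun ((hc.ae_eq_iff_eq volume continuous_const).1 h1) x
  have hx0 : 0 < ‖x‖ := norm_pos_iff.2 hx
  simpa [rad, hzx (log ‖x‖) (by simp), hx0.ne'] using h2

lemma eq_zero_of_punct {V : Type*} [NormedAddCommGroup V] {u : Euc n → V}
    (hu : Continuous u) (h : ∀ x ∈ Punct n, u x = 0) (x : Euc n) :
    u x = 0 := by
  have : Nonempty (Fin n) := ⟨⟨0, Nat.pos_of_ne_zero (NeZero.ne n)⟩⟩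
  have : Nontrivial (Euc n) := inferInstance
  have hd : Dense (Punct n) := dense_compl_singleton 0
  exact congrFun (hu.ext_on hd continuous_const h) x

variable {V : Type*} [NormedAddCommGroup V] [InnerProductSpace ℝ V]

lemma stableProfile_twist {p : ℝ} (hp : 1 < p) {u : Euc n → V} (hu : ContDiff ℝ 4 u)
    (heq : ∀ x, lapV (lapV u) x = ‖u x‖ ^ (p - 1) • u x) {R A : ℝ}
    (hst : VStable p u (closure (ball (0 : Euc n) R))ᶜ) (hA : 0 < A) (hR : R < Real.exp A) :
    StableProfile p (((n : ℝ) - 4) / 2 - 4 / (p - 1)) A (twist (4 / (p - 1)) u)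
      (potDens p (4 / (p - 1)) u) where
  smooth := hu.contDiffOn.twist _
  dens_cont := (contDiffOn_potDens hp _ (hu.of_le (by norm_num))).continuousOn
  dens_eq x hx := by
    have hp1 : p - 1 ≠ 0 := by linarith
    simp only [potDens, twist, rad, norm_smul, smul_eq_mul, Real.norm_eq_abs,
      abs_of_pos (Real.exp_pos _)]
    rw [Real.mul_rpow (Real.exp_pos _).le (norm_nonneg _), ← Real.exp_mul]
    congr 2
    field_simp
    ring
  tested z _ := pair_self_twist hp hu heq _ _
  stable z hz hzA := stability_cut hp hu hst hA hR hz hzA _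

/-- If the dilation derivative of the twisted map vanishes, the map vanishes. -/
lemma eq_zero_of_euler_twist_eq_zero {γ : ℝ} (hγ : 0 < γ) {u : Euc n → V} (hu : ContDiff ℝ 4 u)
    (h : ∀ x ∈ Punct n, euler (twist γ u) x = 0) (x : Euc n) : u x = 0 := by
  refine eq_zero_of_punct hu.continuous (fun x hx => ?_) x
  have hw : ContDiffOn ℝ 4 (twist γ u) (Punct n) := hu.contDiffOn.twist γ
  have hmem : ∀ t : ℝ, Real.exp t • x ∈ Punct n := fun t =>
    smul_ne_zero (Real.exp_pos t).ne' hx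
  have hd : ∀ t : ℝ, HasDerivAt (fun t => twist γ u (Real.exp t • x)) 0 t := fun t => by
    have h1 := (hw.differentiableAt_punct (by norm_num) (hmem t)).hasFDerivAt
    have h2 := h1.comp_hasDerivAt t ((Real.hasDerivAt_exp t).smul_const x)
    have h3 := h _ (hmem t)
    simp only [linField, ContinuousLinearMap.id_apply] at h3
    rwa [h3] at h2
  have hconst : ∀ t, twist γ u (Real.exp t • x) = twist γ u x := fun t => by
    have := is_const_of_deriv_eq_zero (fun t => (hd t).differentiableAt) (fun t => (hd t).deriv) t 0
    simpa using this
  have hx0 : ‖x‖ ≠ 0 := norm_ne_zero_iff.2 hx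
  have hexp : Tendsto (fun t : ℝ => Real.exp t • x) atBot (nhds 0) := by
    simpa using Real.tendsto_exp_atBot.smul_const x
  have hu0 : Tendsto (fun t : ℝ => u (Real.exp t • x)) atBot (nhds (u 0)) :=
    (hu.continuous.tendsto 0).comp hexp
  have hs : Tendsto (fun t : ℝ => Real.exp (γ * (t + log ‖x‖))) atBot (nhds 0) :=
    Real.tendsto_exp_atBot.comp ((tendsto_atBot_add_const_right _ _ tendsto_id).const_mul_atBot hγ)
  have hlim : Tendsto (fun t : ℝ => twist γ u (Real.exp t • x)) atBot (nhds 0) := by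
    have h1 := hs.smul hu0
    rw [zero_smul] at h1
    refine h1.congr fun t => ?_
    simp only [twist, rad, norm_smul, Real.norm_eq_abs, abs_of_pos (Real.exp_pos _)]
    rw [Real.log_mul (Real.exp_pos t).ne' hx0, Real.log_exp]
  simp only [hconst] at hlim
  have h0 := tendsto_nhds_unique hlim tendsto_const_nhds
  have h1 : twist γ u x = 0 := h0.symm
  simp only [twist, rad] at h1
  exact (smul_eq_zero.1 h1).resolve_left (Real.exp_pos _).ne'

/-- Vanishing in the subcritical range. -/
lemma eq_zero_of_subcritical {p : ℝ} (hp : 1 < p) (hn : 5 ≤ n)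
    (hsub : ((n : ℝ) - 4) / 2 < 4 / (p - 1)) {u : Euc n → V} (hu : ContDiff ℝ 4 u)
    (heq : ∀ x, lapV (lapV u) x = ‖u x‖ ^ (p - 1) • u x) {R A : ℝ}
    (hst : VStable p u (closure (ball (0 : Euc n) R))ᶜ) (hA : 0 < A) (hR : R < Real.exp A)
    (x : Euc n) : u x = 0 := by
  have H := stableProfile_twist hp hu heq hst hA hR
  set γ : ℝ := 4 / (p - 1) with hγ
  set a : ℝ := ((n : ℝ) - 4) / 2 with ha
  have hn' : (5 : ℝ) ≤ n := by exact_mod_cast hn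
  have ha0 : 0 < a := by rw [ha]; linarith
  have hp1 : 0 < p - 1 := by linarith
  have hκ : 0 < (4 - a * (p - 1)) / (p + 1) := by
    have : a * (p - 1) < 4 := by
      rwa [hγ, lt_div_iff₀ hp1] at hsub
    have : 0 < 4 - a * (p - 1) := by linarith
    positivity
  obtain ⟨F, hF, hF0, hF1, hFo, hFs⟩ := exists_isCut_bump (r := 1 / 2) (R := 1) (3 / 2)
    (by norm_num) (by norm_num)
  have hFs' : ∀ t, F t ≠ 0 → 0 < t := fun t ht => by
    have := (abs_lt.1 (hFs t ht)).1
    linarith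
  obtain ⟨K, hK, C, hC, hgr⟩ := exists_growth_bound hp H hF hF0 hF1 hFs'
  have hG : IsCut fun t => F t ^ (2 * K) := hF.pow (by omega)
  have hqc := (contDiffOn_potDens hp a (hu.of_le (by norm_num) : ContDiff ℝ 1 u)).continuousOn
  have hq0 := potDens_nonneg p a u
  have hJ0 : ∀ z : ℝ → ℝ, (∀ t, 0 ≤ z t) → 0 ≤ radInt z (potDens p a u) := fun z hz =>
    radInt_nonneg fun x _ => mul_nonneg (hz _) (hq0 x)
  obtain ⟨C', hC', hmon⟩ := exists_monotonicity_bound (δ := 0) hp ha0 (by rw [ha]; ring) hu heq hG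
    (fun t => pow_nonneg (hF0 t) _) (fun t h1 h2 => by
      rw [hFo t (by rw [abs_le]; constructor <;> linarith), one_pow])
    (Φ := fun z => -((4 - a * (p - 1)) / (p + 1) * radInt z (potDens p a u)))
    (fun z _ => by ring) (fun z ζ hz hζ hz0 hzζ => by
      have h1 : radInt z (potDens p a u) ≤ radInt ζ (potDens p a u) :=
        radInt_mono hz.continuous hz.compact hζ.continuous hζ.compact hqc hqc fun x _ =>
          mul_le_mul_of_nonneg_right (hzζ _) (hq0 x)
      have h2 := hJ0 z hz0
      rw [abs_neg, abs_neg, abs_of_nonneg (by positivity), abs_of_nonneg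
        (mul_nonneg hκ.le (h2.trans h1))]
      gcongr)
  have hzero : ∀ z, IsCut z → (∀ t, 0 ≤ z t) → (∀ t, z t ≤ 1) →
      radInt z (potDens p a u) = 0 := fun z hz hz0 hz1 => by
    obtain ⟨B, hB⟩ := hz.compact.isCompact.bddAbove
    set D : ℝ := 10 + 20 * (a - γ) ^ 2 + 10 * (a - γ) ^ 4 with hD
    have hD0 : 0 ≤ D := by positivity
    have key : ∀ l, 1 ≤ l → A ≤ l → B ≤ l →
        (4 - a * (p - 1)) / (p + 1) * radInt z (potDens p a u)
          ≤ C' * (D * C) * Real.exp (-(2 * (γ - a) * l)) := fun l hl hAl hBl => by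
      have hl0 : 0 < l := by linarith
      have h1 := hmon l l (by linarith) hl z hz hz0 hz1 fun t ht => by
        have := hB (subset_tsupport _ ht)
        linarith
      rw [abs_neg] at h1
      refine (le_abs_self _).trans (h1.trans ?_)
      have hc := hG.stretch l hl0
      have h2 : radInt (stretch (fun t => F t ^ (2 * K)) l l)
          (fun x => eDens (twist a u) x + potDens p a u x)
          ≤ radInt (fun t => D * Real.exp (-(2 * (γ - a) * l)) * stretch (fun t => F t ^ (2 * K)) l l t)
            (fun x => eDens (twist γ u) x + potDens p γ u x) := by
        refine radInt_mono hc.continuous hc.compact (hc.const_mul _).continuous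
          (hc.const_mul _).compact (continuousOn_total hp a hu) (continuousOn_total hp γ hu)
          fun x hx => ?_
        simp only [rad]
        by_cases h0 : stretch (fun t => F t ^ (2 * K)) l l (log ‖x‖) = 0
        · rw [h0]
          simp
        have h3 : l ≤ log ‖x‖ := by
          have h4 : F ((log ‖x‖ - l) / l) ≠ 0 := fun h => h0 (by
            simp only [stretch, h]
            exact zero_pow (by omega))
          have h5 := (div_pos_iff_of_pos_right hl0).1 (hFs' _ h4)
          linarith
        have h6 := total_twist_le (p := p) a γ hu hx
        have h7 : Real.exp (2 * (a - γ) * log ‖x‖) ≤ Real.exp (-(2 * (γ - a) * l)) := by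
          rw [Real.exp_le_exp]
          nlinarith
        have h8 : 0 ≤ stretch (fun t => F t ^ (2 * K)) l l (log ‖x‖) := pow_nonneg (hF0 _) _
        have h9 : 0 ≤ eDens (twist γ u) x + potDens p γ u x :=
          add_nonneg (eDens_nonneg _ _) (potDens_nonneg _ _ _ _)
        calc _ ≤ stretch (fun t => F t ^ (2 * K)) l l (log ‖x‖)
              * (D * Real.exp (-(2 * (γ - a) * l)) * (eDens (twist γ u) x + potDens p γ u x)) := by
              refine mul_le_mul_of_nonneg_left (h6.trans ?_) h8
              gcongr
          _ = _ := by ring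
      rw [radInt_const_mul_left] at h2
      have h3 := hgr l l hAl hl
      calc _ ≤ C' * (l⁻¹ * (D * Real.exp (-(2 * (γ - a) * l)) * (C * l))) := by
            gcongr
            exact h2.trans (by gcongr)
        _ = _ := by
            field_simp
    have hlim : Tendsto (fun l : ℝ => C' * (D * C) * Real.exp (-(2 * (γ - a) * l))) atTop
        (nhds (C' * (D * C) * 0)) := by
      refine Tendsto.const_mul _ ?_
      exact Real.tendsto_exp_neg_atTop_nhds_zero.comp
        (tendsto_id.const_mul_atTop (by linarith : 0 < 2 * (γ - a)))
    have h := ge_of_tendsto hlim (by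
      filter_upwards [eventually_ge_atTop (1 : ℝ), eventually_ge_atTop A, eventually_ge_atTop B]
        with l h1 h2 h3 using key l h1 h2 h3)
    rw [mul_zero] at h
    have h1 := hJ0 z hz0
    nlinarith
  have hq := eq_zero_of_radInt_eq_zero hqc (fun x _ => hq0 x) hzero
  refine eq_zero_of_punct hu.continuous (fun x hx => ?_) x
  have h1 := hq x hx
  simp only [potDens, twist, rad, smul_eq_mul] at h1
  have h2 := (mul_eq_zero.1 h1).resolve_left (Real.exp_pos _).ne'
  have h3 := (Real.rpow_eq_zero (norm_nonneg _) (by linarith)).1 h2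
  exact norm_eq_zero.1 h3

end Vanishing

section Supercritical

variable {n : ℕ} {V : Type*} [NormedAddCommGroup V] [InnerProductSpace ℝ V] [NeZero n]

lemma sum_le_of_coercive {p N k₂ k₃ R B W₂ M₀ G₁ W₁ G₀ W₀ P : ℝ} (hp : 1 < p) (hk₂ : 0 < k₂)
    (hk₃ : 0 < k₃) (hN : 0 ≤ N) (nW₂ : 0 ≤ W₂) (nM₀ : 0 ≤ M₀) (nG₁ : 0 ≤ G₁) (nG₀ : 0 ≤ G₀)
    (nW₀ : 0 ≤ W₀) (nP : 0 ≤ P) (hW₁ : W₁ ≤ B)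
    (e₁ : (p - 1) * (W₂ + M₀ + 2 * G₁) + k₂ * G₀ + k₃ * W₀ ≤ R)
    (e₂ : p * P ≤ (W₂ + M₀ + 2 * G₁) + 2 * N * G₀ + N ^ 2 * W₀ + R) :
    W₂ + M₀ + G₁ + W₁ + G₀ + W₀ + P
      ≤ B + (2 * (R / (p - 1)) + (1 + 2 * N) * (R / k₂) + (1 + N ^ 2) * (R / k₃) + R) := by
  have hp1 : 0 < p - 1 := by linarith
  have nX : 0 ≤ W₂ + M₀ + 2 * G₁ := by linarith
  have b₁ : 0 ≤ (p - 1) * (W₂ + M₀ + 2 * G₁) := by positivity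
  have b₂ : 0 ≤ k₂ * G₀ := by positivity
  have b₃ : 0 ≤ k₃ * W₀ := by positivity
  have f₁ : W₂ + M₀ + 2 * G₁ ≤ R / (p - 1) := by
    rw [le_div_iff₀ hp1]
    linarith
  have f₂ : G₀ ≤ R / k₂ := by
    rw [le_div_iff₀ hk₂]
    linarith
  have f₃ : W₀ ≤ R / k₃ := by
    rw [le_div_iff₀ hk₃]
    linarith
  have f₄ : P ≤ p * P := le_mul_of_one_le_left nP hp.le
  have f₅ : (1 + 2 * N) * G₀ ≤ (1 + 2 * N) * (R / k₂) := by gcongr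
  have f₆ : (1 + N ^ 2) * W₀ ≤ (1 + N ^ 2) * (R / k₃) := by gcongr
  linarith

/-- A linear growth bound improves to a uniform bound when the dilation derivative has finite
energy and the spectral constants are positive. -/
lemma exists_uniform_bound {p δ A : ℝ} (hp : 1 < p) (hN : 0 ≤ nzero n)
    (hk₂ : 0 < (p - 1) * nzero n - p * δ ^ 2)
    (hk₃ : 0 < p * (δ ^ 4 - (2 * nzero n + 4) * δ ^ 2 + nzero n ^ 2) - nzero n ^ 2)
    {w : Euc n → V} {q : Euc n → ℝ} (H : StableProfile p δ A w q) {G F : ℝ → ℝ} (hG : IsCut G)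
    (hG0 : ∀ t, 0 ≤ G t) (hF : IsCut F) (hF0 : ∀ t, 0 ≤ F t) (hF1 : ∀ t, F t ≤ 1)
    (hFs : ∀ t, F t ≠ 0 → 0 < t) (hFG : ∀ t, F t ≠ 0 → G t = 1) {C₁ B : ℝ}
    (hgr : ∀ s l : ℝ, A ≤ s → 1 ≤ l →
      radInt (stretch G s l) (fun x => eDens w x + q x) ≤ C₁ * l)
    (hB : ∀ z, IsCut z → (∀ t, 0 ≤ z t) → (∀ t, z t ≤ 1) → pair z (euler w) (euler w) ≤ B) :
    ∃ C, ∀ s l : ℝ, A ≤ s → 1 ≤ l →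
      radInt (stretch (fun t => F t ^ (2 * 5)) s l) (fun x => eDens w x + q x) ≤ C := by
  have hw := H.smooth
  obtain ⟨C₀, hC₀, henergy⟩ := exists_energy_inequality (V := V) n p δ
  obtain ⟨c, hc, hcut⟩ := exists_cutBound_pow hF hF0 hF1 (K := 5) (by norm_num)
  set R := C₀ * B + C₀ * (c * C₁) with hRd
  refine ⟨B + (2 * (R / (p - 1)) + (1 + 2 * nzero n)
    * (R / (2 * ((p - 1) * nzero n - p * δ ^ 2))) + (1 + nzero n ^ 2)
    * (R / (p * (δ ^ 4 - (2 * nzero n + 4) * δ ^ 2 + nzero n ^ 2) - nzero n ^ 2)) + R),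
    fun s l hs hl => ?_⟩
  have hl0 : 0 < l := by linarith
  set y : ℝ → ℝ := stretch (fun t => F t ^ (2 * 5)) s l with hy
  set ρ : ℝ → ℝ := stretch (fun t => F t ^ (2 * 5 - 2)) s l with hρ
  set r : ℝ → ℝ := stretch (fun t => F t ^ (2 * 5 - 4)) s l with hr
  set z : ℝ → ℝ := stretch (fun t => F t ^ 5) s l with hz
  set g : ℝ → ℝ := stretch G s l with hg
  have cy : IsCut y := (hF.pow (by omega)).stretch s hl0
  have cρ : IsCut ρ := (hF.pow (by omega)).stretch s hl0
  have cr : IsCut r := (hF.pow (by omega)).stretch s hl0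
  have cz : IsCut z := (hF.pow (by omega)).stretch s hl0
  have cg : IsCut g := hG.stretch s hl0
  have y0 : ∀ t, 0 ≤ y t := fun t => pow_nonneg (hF0 _) _
  have ρ0 : ∀ t, 0 ≤ ρ t := fun t => pow_nonneg (hF0 _) _
  have r0 : ∀ t, 0 ≤ r t := fun t => pow_nonneg (hF0 _) _
  have g0 : ∀ t, 0 ≤ g t := fun t => hG0 _
  have hle : ∀ k, k ≠ 0 → ∀ t, F t ^ k ≤ G t := fun k hk t => by
    by_cases h : F t = 0
    · rw [h, zero_pow hk]
      exact hG0 t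
    · rw [hFG t h]
      exact pow_le_one₀ (hF0 t) (hF1 t)
  have ρg : ∀ t, ρ t ≤ g t := fun t => hle _ (by norm_num) _
  have rg : ∀ t, r t ≤ g t := fun t => hle _ (by norm_num) _
  have hzz : (fun t => z t * z t) = y := by
    ext t
    simp only [hz, hy, stretch]
    ring
  have hsupp : ∀ t, z t ≠ 0 → A ≤ t := fun t ht => by
    have h1 : F ((t - s) / l) ≠ 0 := fun h => ht (by
      change F ((t - s) / l) ^ 5 = 0
      rw [h, zero_pow (by omega)])
    have h2 := (div_pos_iff_of_pos_right hl0).1 (hFs _ h1)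
    linarith
  have hst := H.stable z cz hsupp
  obtain ⟨e1, e2⟩ := henergy w hw z _ _ cz ((((hF.pow (by omega)).const_mul c).stretch s hl0).const_mul
    l⁻¹) ((((hF.pow (by omega)).const_mul c).stretch s hl0).const_mul l⁻¹)
    (hcut.stretch (hF.pow (by omega)) s hl) _ (H.tested z cz) hst
  have pull : ∀ (G : ℝ → ℝ) (f g : Euc n → V), pair (fun t => l⁻¹ * stretch (fun t => c * G t) s l t) f g
      = l⁻¹ * (c * pair (stretch G s l) f g) := fun G f g => by
    rw [pair_const_mul_left]
    congr 1
    exact pair_const_mul_left c (stretch G s l) f g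
  rw [pull, pull, pull, hzz, ← hρ, ← hr] at e1 e2
  have hD1 : ContDiffOn ℝ 3 (euler w) (Punct n) := hw.linField (by norm_num) _
  have hD2 : ContDiffOn ℝ 2 (euler w) (Punct n) := hD1.of_le (by norm_num)
  have hw2 : ContDiffOn ℝ 2 w (Punct n) := hw.of_le (by norm_num)
  have q0 : ∀ x ∈ Punct n, 0 ≤ q x := fun x hx => by
    rw [H.dens_eq x hx]
    positivity
  have W1 := pair_self_mono cρ cg ρ0 ρg hD1.continuousOn
  have G0 := pair_angM_mono cρ cg ρ0 ρg hw2
  have W0 := pair_self_mono cr cg r0 rg hw.continuousOn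
  have hT := hgr s l hs hl
  rw [radInt_eDens cg hw H.dens_cont] at hT
  have m1 := pair_self_nonneg g0 (euler (euler w))
  have m2 := pair_self_nonneg g0 (angM w)
  have m3 := pair_angM_nonneg cg g0 hD2
  have m4 : 0 ≤ radInt g q := radInt_nonneg fun x hx => mul_nonneg (g0 _) (q0 x hx)
  have hrem : C₀ * (l⁻¹ * (c * pair ρ (euler w) (euler w)) + l⁻¹ * (c * pair ρ (angM w) w)
      + l⁻¹ * (c * pair r w w)) ≤ C₀ * (c * C₁) := by
    refine mul_le_mul_of_nonneg_left ?_ hC₀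
    calc _ = l⁻¹ * (c * (pair ρ (euler w) (euler w) + pair ρ (angM w) w + pair r w w)) := by ring
      _ ≤ l⁻¹ * (c * (C₁ * l)) := by
        gcongr
        linarith
      _ = _ := by field_simp
  have hW1 := hB y cy y0 fun t => pow_le_one₀ (hF0 _) (hF1 _)
  have hW1' : C₀ * pair y (euler w) (euler w) ≤ C₀ * B := by gcongr
  rw [radInt_eDens cy hw H.dens_cont]
  exact sum_le_of_coercive (R := R) hp (mul_pos two_pos hk₂) hk₃ hN
    (pair_self_nonneg y0 _) (pair_self_nonneg y0 _) (pair_angM_nonneg cy y0 hD2)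
    (pair_angM_nonneg cy y0 hw2) (pair_self_nonneg y0 _)
    (radInt_nonneg fun x hx => mul_nonneg (y0 _) (q0 x hx)) hW1 (by linarith) (by linarith)

/-- Vanishing in the supercritical range. -/
lemma eq_zero_of_supercritical {p δ : ℝ} (hp : 1 < p) (hN : 0 ≤ nzero n)
    (hδ : δ = ((n : ℝ) - 4) / 2 - 4 / (p - 1)) (hδ0 : 0 < δ) (hk₁ : 0 < nzero n + 2 - δ ^ 2)
    (hk₂ : 0 < (p - 1) * nzero n - p * δ ^ 2)
    (hk₃ : 0 < p * (δ ^ 4 - (2 * nzero n + 4) * δ ^ 2 + nzero n ^ 2) - nzero n ^ 2)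
    {u : Euc n → V} (hu : ContDiff ℝ 4 u)
    (heq : ∀ x, lapV (lapV u) x = ‖u x‖ ^ (p - 1) • u x) {R A : ℝ}
    (hst : VStable p u (closure (ball (0 : Euc n) R))ᶜ) (hA : 0 < A) (hR : R < Real.exp A)
    (x : Euc n) : u x = 0 := by
  have H := stableProfile_twist hp hu heq hst hA hR
  rw [← hδ] at H
  set γ : ℝ := 4 / (p - 1) with hγ
  have hp1 : 0 < p - 1 := by linarith
  have hγ0 : 0 < γ := by positivity
  have hγp : 4 - γ * (p - 1) = 0 := by
    rw [hγ]
    field_simp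
    ring
  set w := twist γ u with hw
  have hwc := H.smooth
  have hD1 : ContDiffOn ℝ 3 (euler w) (Punct n) := hwc.linField (by norm_num) _
  have hD2 : ContDiffOn ℝ 2 (euler w) (Punct n) := hD1.of_le (by norm_num)
  have hDD : ContDiffOn ℝ 2 (euler (euler w)) (Punct n) := hD1.linField (by norm_num) _
  have hle : ∀ z, IsCut z → (∀ t, 0 ≤ z t) →
      4 * δ * (nzero n + 2 - δ ^ 2) * pair z (euler w) (euler w) ≤ |4 * δ * diss δ z w| := by
    intro z hz hz0
    refine le_trans ?_ (le_abs_self _)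
    have h1 := pair_self_nonneg hz0 (euler (euler w))
    have h2 := pair_angM_nonneg hz hz0 hD2
    rw [mul_assoc]
    refine mul_le_mul_of_nonneg_left ?_ (by positivity)
    rw [diss]
    linarith
  have hmono : ∀ z ζ, IsCut z → IsCut ζ → (∀ t, 0 ≤ z t) → (∀ t, z t ≤ ζ t) →
      |4 * δ * diss δ z w| ≤ |4 * δ * diss δ ζ w| := by
    intro z ζ hz hζ hz0 hzζ
    have hζ0 : ∀ t, 0 ≤ ζ t := fun t => (hz0 t).trans (hzζ t)
    have h1 := pair_self_nonneg hz0 (euler (euler w))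
    have h2 := pair_angM_nonneg hz hz0 hD2
    have h3 := pair_self_nonneg hz0 (euler w)
    have h4 : 0 ≤ diss δ z w := by
      rw [diss]
      positivity
    have h5 : diss δ z w ≤ diss δ ζ w :=
      add_le_add (add_le_add (pair_self_mono hz hζ hz0 hzζ hDD.continuousOn)
        (pair_angM_mono hz hζ hz0 hzζ hD2)) (mul_le_mul_of_nonneg_left
          (pair_self_mono hz hζ hz0 hzζ hD1.continuousOn) hk₁.le)
    rw [abs_of_nonneg (by positivity), abs_of_nonneg (mul_nonneg (by positivity) (h4.trans h5))]
    gcongr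
  have hmon := fun (G : ℝ → ℝ) (hG : IsCut G) (hG0 : ∀ t, 0 ≤ G t)
      (hG1 : ∀ t, 1 ≤ t → t ≤ 2 → G t = 1) =>
    exists_monotonicity_bound hp hγ0 hδ hu heq hG hG0 hG1 (Φ := fun z => 4 * δ * diss δ z w)
      (fun z _ => by rw [hγp]; ring) hmono
  obtain ⟨F, hF, hF0, hF1, hFo, hFs⟩ := exists_isCut_bump (r := 1) (R := 5 / 4) (3 / 2)
    (by norm_num) (by norm_num)
  obtain ⟨χ, hχ, hχ0, hχ1, hχo, hχs⟩ := exists_isCut_bump (r := 1 / 2) (R := 1) (3 / 2)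
    (by norm_num) (by norm_num)
  obtain ⟨K, hK, C₁, hC₁, hgr⟩ := exists_growth_bound hp H hF hF0 hF1 fun t ht => by
    have := (abs_lt.1 (hFs t ht)).1
    linarith
  have hG : IsCut fun t => F t ^ (2 * K) := hF.pow (by omega)
  have hG0 : ∀ t, 0 ≤ F t ^ (2 * K) := fun t => pow_nonneg (hF0 t) _
  have hy : IsCut fun t => χ t ^ (2 * 5) := hχ.pow (by omega)
  have hy0 : ∀ t, 0 ≤ χ t ^ (2 * 5) := fun t => pow_nonneg (hχ0 t) _
  obtain ⟨C₂, hC₂, hmon₁⟩ := hmon _ hG hG0 fun t h1 h2 => by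
    rw [hFo t (by rw [abs_le]; constructor <;> linarith), one_pow]
  have hW : ∀ z, IsCut z → (∀ t, 0 ≤ z t) → (∀ t, z t ≤ 1) →
      pair z (euler w) (euler w) ≤ C₂ * C₁ / (4 * δ * (nzero n + 2 - δ ^ 2)) := by
    intro z hz hz0 hz1
    obtain ⟨B, hB⟩ := hz.compact.isCompact.bddAbove
    set l := max 1 B
    have hl : 1 ≤ l := le_max_left _ _
    have h1 := hmon₁ A l hA.le hl z hz hz0 hz1 fun t ht => by
      have := hB (subset_tsupport _ ht)
      have := le_max_right 1 B
      linarith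
    rw [le_div_iff₀ (by positivity), mul_comm]
    refine (hle z hz hz0).trans (h1.trans ?_)
    have h2 := hgr A l le_rfl hl
    calc _ ≤ C₂ * (l⁻¹ * (C₁ * l)) := by gcongr
      _ = _ := by field_simp
  obtain ⟨C₃, hC₃⟩ := exists_uniform_bound hp hN hk₂ hk₃ H hG hG0 hχ hχ0 hχ1
    (fun t ht => by
      have := (abs_lt.1 (hχs t ht)).1
      linarith)
    (fun t ht => by rw [hFo t (hχs t ht).le, one_pow]) hgr hW
  obtain ⟨C₄, hC₄, hmon₂⟩ := hmon _ hy hy0 fun t h1 h2 => by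
    rw [hχo t (by rw [abs_le]; constructor <;> linarith), one_pow]
  have hzero : ∀ z, IsCut z → (∀ t, 0 ≤ z t) → (∀ t, z t ≤ 1) →
      radInt z (fun x => ‖euler w x‖ ^ 2) = 0 := by
    intro z hz hz0 hz1
    rw [← pair_self_eq]
    refine le_antisymm ?_ (pair_self_nonneg hz0 _)
    obtain ⟨B, hB⟩ := hz.compact.isCompact.bddAbove
    have key : ∀ l, 1 ≤ l → B ≤ l → 4 * δ * (nzero n + 2 - δ ^ 2) * pair z (euler w) (euler w)
        ≤ C₄ * (l⁻¹ * C₃) := fun l hl hBl => by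
      refine (hle z hz hz0).trans ((hmon₂ A l hA.le hl z hz hz0 hz1 fun t ht => ?_).trans ?_)
      · have := hB (subset_tsupport _ ht)
        linarith
      · have := hC₃ A l le_rfl hl
        gcongr
    have hlim : Tendsto (fun l : ℝ => C₄ * (l⁻¹ * C₃)) atTop (nhds (C₄ * (0 * C₃))) :=
      (tendsto_inv_atTop_zero.mul_const C₃).const_mul C₄
    have h := ge_of_tendsto hlim (by
      filter_upwards [eventually_ge_atTop (1 : ℝ), eventually_ge_atTop B] with l h1 h2
        using key l h1 h2)
    rw [zero_mul, mul_zero] at h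
    exact (mul_nonpos_iff_pos_imp_nonpos.1 h).1 (by positivity)
  refine eq_zero_of_euler_twist_eq_zero hγ0 hu (fun x hx => ?_) x
  have h := eq_zero_of_radInt_eq_zero (hD1.continuousOn.norm.pow 2) (fun x _ => sq_nonneg _)
    hzero x hx
  simpa using h

end Supercritical

section Exponents

lemma spectral_poly_pos_of_lt {n Y : ℝ} (hn : 0 < n) (h8 : 0 ≤ n ^ 2 - 8 * n + 32)
    (hY : 4 * Y < n ^ 2 + 4 - n * √(n ^ 2 - 8 * n + 32)) :
    0 < Y ^ 2 - (2 + n ^ 2 / 2) * Y + 1 + n ^ 2 * (n - 3) / 2 := by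
  set t := √(n ^ 2 - 8 * n + 32)
  have ht : t ^ 2 = n ^ 2 - 8 * n + 32 := Real.sq_sqrt h8
  have ht0 : 0 ≤ t := Real.sqrt_nonneg _
  have hnt : 0 ≤ n * t := by positivity
  have h1 : 0 < (n ^ 2 + 4 - n * t - 4 * Y) * (n ^ 2 + 4 + n * t - 4 * Y) :=
    mul_pos (by linarith) (by linarith)
  have h2 : (n ^ 2 + 4 - n * t - 4 * Y) * (n ^ 2 + 4 + n * t - 4 * Y)
      = (n ^ 2 + 4 - 4 * Y) ^ 2 - n ^ 2 * t ^ 2 := by ring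
  rw [h2, ht] at h1
  linarith

lemma spectral_poly_pos_of_le_twelve {n : ℕ} (hn : 5 ≤ n) (hn' : n ≤ 12) {δ : ℝ} (h0 : 0 < δ)
    (h1 : δ < ((n : ℝ) - 4) / 2) :
    0 < ((δ - 1) ^ 2) ^ 2 - (2 + (n : ℝ) ^ 2 / 2) * (δ - 1) ^ 2 + 1
      + (n : ℝ) ^ 2 * ((n : ℝ) - 3) / 2 := by
  have hY : (δ - 1) ^ 2 ≤ max 1 (((n : ℝ) - 6) ^ 2 / 4) := by
    rcases le_total δ 1 with h | h
    · exact (by nlinarith : (δ - 1) ^ 2 ≤ 1).trans (le_max_left _ _)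
    · exact (by nlinarith : (δ - 1) ^ 2 ≤ ((n : ℝ) - 6) ^ 2 / 4).trans (le_max_right _ _)
  generalize (δ - 1) ^ 2 = Y at hY
  interval_cases n <;> norm_num at hY ⊢ <;> nlinarith [sq_nonneg (Y - 9)]

/-- Above thirteen dimensions, the bound on the exponent in terms of `δ`. -/
lemma sq_lt_of_lt_joseph_lundgren {n p δ : ℝ} (hn : 13 ≤ n) (hp : 1 < p)
    (hδ : δ = (n - 4) / 2 - 4 / (p - 1)) (h0 : 0 < δ)
    (h : p < (n + 2 - √(n ^ 2 + 4 - n * √(n ^ 2 - 8 * n + 32))) /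
      (n - 6 - √(n ^ 2 + 4 - n * √(n ^ 2 - 8 * n + 32)))) :
    4 * (δ - 1) ^ 2 < n ^ 2 + 4 - n * √(n ^ 2 - 8 * n + 32) := by
  set t := √(n ^ 2 - 8 * n + 32) with ht
  set s := √(n ^ 2 + 4 - n * t) with hs
  have ht2 : t ^ 2 = n ^ 2 - 8 * n + 32 := Real.sq_sqrt (by nlinarith)
  have ht0 : 0 ≤ t := Real.sqrt_nonneg _
  have htn : t < n := by nlinarith
  have hs2 : s ^ 2 = n ^ 2 + 4 - n * t := Real.sq_sqrt (by nlinarith)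
  have hs0 : 0 ≤ s := Real.sqrt_nonneg _
  have hs3 : 2 < s := by nlinarith
  have hnt : 12 * n - 32 < n * t := by
    refine lt_of_pow_lt_pow_left₀ 2 (by nlinarith) ?_
    rw [mul_pow, ht2]
    obtain ⟨k, rfl⟩ : ∃ k, n = 13 + k := ⟨n - 13, by ring⟩
    have hk : 0 ≤ k := by linarith
    have : 0 < k ^ 4 + 44 * k ^ 3 + 590 * k ^ 2 + 2588 * k + 1017 := by positivity
    nlinarith
  have hsn : s < n - 6 := by
    refine lt_of_pow_lt_pow_left₀ 2 (by linarith) ?_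
    rw [hs2]
    linarith
  have hp1 : 0 < p - 1 := by linarith
  have hd : 0 < n - 6 - s := by linarith
  rw [lt_div_iff₀ hd] at h
  have h1 : (n - 6 - s) / 2 < 4 / (p - 1) := by
    rw [div_lt_div_iff₀ two_pos hp1]
    linarith
  rw [← hs2]
  nlinarith

/-- Positivity of the spectral constants. -/
lemma spectral_pos {n p δ N : ℝ} (hn : 4 < n) (hp : 1 < p) (hN : N = n * (n - 4) / 4)
    (hδ : δ = (n - 4) / 2 - 4 / (p - 1)) (h0 : 0 < δ)
    (h : 0 < ((δ - 1) ^ 2) ^ 2 - (2 + n ^ 2 / 2) * (δ - 1) ^ 2 + 1 + n ^ 2 * (n - 3) / 2) :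
    0 < N + 2 - δ ^ 2 ∧ 0 < (p - 1) * N - p * δ ^ 2 ∧
      0 < p * (δ ^ 4 - (2 * N + 4) * δ ^ 2 + N ^ 2) - N ^ 2 := by
  have hp1 : 0 < p - 1 := by linarith
  have hγ : 0 < 4 / (p - 1) := by positivity
  have hγe : 4 / (p - 1) = (n - 4) / 2 - δ := by linarith
  have hγ' : 0 < (n - 4) / 2 - δ := hγe ▸ hγ
  have hpe : p * ((n - 4) / 2 - δ) = (n - 4) / 2 - δ + 4 := by
    have : 4 / (p - 1) * (p - 1) = 4 := by field_simp
    rw [hγe] at this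
    linarith
  have hD : 0 < N - δ ^ 2 := by
    rw [hN]
    nlinarith
  have h3 : 0 < p * (δ ^ 4 - (2 * N + 4) * δ ^ 2 + N ^ 2) - N ^ 2 := by
    have e : p * (δ ^ 4 - (2 * N + 4) * δ ^ 2 + N ^ 2)
        = p * ((n - 4) / 2 - δ) * ((n / 2 - δ) * (n / 2 + δ) * ((n - 4) / 2 + δ)) := by
      rw [hN]
      ring
    rw [e, hpe, hN]
    convert h using 1
    ring
  refine ⟨by linarith, ?_, h3⟩
  have hN0 : 0 ≤ N := by nlinarith
  have h4 : N ^ 2 < (p * (N - δ ^ 2)) ^ 2 := by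
    have h5 : p * (N - δ ^ 2) ^ 2 ≤ p * (p * (N - δ ^ 2) ^ 2) :=
      le_mul_of_one_le_left (by positivity) hp.le
    nlinarith [sq_nonneg δ]
  have h6 := lt_of_pow_lt_pow_left₀ 2 (by positivity) h4
  linarith

end Exponents

section System

variable {n m : ℕ}

lemma ContDiff.lapV_two {V : Type*} [NormedAddCommGroup V] [NormedSpace ℝ V] {u : Euc n → V}
    (hu : ContDiff ℝ 4 u) : ContDiff ℝ 2 (lapV u) := by
  unfold lapV
  have h1 : ContDiff ℝ 3 (fderiv ℝ u) := hu.fderiv_right (by norm_num)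
  have h2 : ContDiff ℝ 2 (fderiv ℝ (fderiv ℝ u)) := h1.fderiv_right (by norm_num)
  exact ContDiff.sum fun k _ => (h2.clm_apply contDiff_const).clm_apply contDiff_const

lemma lapV_lapV_eq {p : ℝ} {u : Euc n → EuclideanSpace ℝ (Fin m)} (hu : ContDiff ℝ 4 u)
    (h : ∀ (i : Fin m) (x : Euc n),
      lap (fun z => lap (fun w => u w i) z) x = ‖u x‖ ^ (p - 1) * u x i) (x : Euc n) :
    lapV (lapV u) x = ‖u x‖ ^ (p - 1) • u x := by
  ext i
  rw [lapV_apply hu.lapV_two]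
  simp only [lapV_apply (hu.of_le (by norm_num))]
  exact h i x

end System

/-- Liouville theorem for finite Morse index (stable outside a compact set) solutions of
the fourth order Lane–Emden system `Δ²u_i = |u|^{p−1} u_i` in the noncritical ranges
(noncritical part of Theorem 3.1). -/
theorem statement9 (n m : ℕ) (hn : 5 ≤ n) (hm : 1 ≤ m) (p : ℝ) (hp : 1 < p)
    (hrange :
      p < ((n : ℝ) + 4) / ((n : ℝ) - 4) ∨
      (((n : ℝ) + 4) / ((n : ℝ) - 4) < p ∧
        (13 ≤ n →
          p < ((n : ℝ) + 2 -
                Real.sqrt ((n : ℝ) ^ 2 + 4 - (n : ℝ) * Real.sqrt ((n : ℝ) ^ 2 - 8 * n + 32))) /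
              ((n : ℝ) - 6 -
                Real.sqrt ((n : ℝ) ^ 2 + 4 - (n : ℝ) * Real.sqrt ((n : ℝ) ^ 2 - 8 * n + 32))))))
    (u : Euc n → EuclideanSpace ℝ (Fin m)) (hreg : ContDiff ℝ 4 u)
    (hsol : ∀ (i : Fin m) (x : Euc n),
      lap (fun z => lap (fun w => u w i) z) x = ‖u x‖ ^ (p - 1) * u x i)
    (hstab : ∃ R₀ : ℝ, 0 < R₀ ∧ Stable2 n m p u (closure (ball (0 : Euc n) R₀))ᶜ) :
    ∀ (i : Fin m) (x : Euc n), u x i = 0 := by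
  have : NeZero n := ⟨by omega⟩
  have hn' : (5 : ℝ) ≤ n := by exact_mod_cast hn
  have hn4 : (0 : ℝ) < n - 4 := by linarith
  have hp1 : 0 < p - 1 := by linarith
  obtain ⟨R, hR0, hst⟩ := hstab
  have hst' := hst.vStable hp hreg.continuous isClosed_closure.isOpen_compl
  have heq := lapV_lapV_eq hreg hsol
  have hA : R < Real.exp R := by linarith [Real.add_one_le_exp R]
  suffices h : ∀ x, u x = 0 from fun i x => by simp [h x]
  rcases hrange with hsub | ⟨hsup, hJL⟩
  · refine eq_zero_of_subcritical hp hn ?_ hreg heq hst' hR0 hA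
    rw [lt_div_iff₀ hn4] at hsub
    rw [div_lt_div_iff₀ two_pos hp1]
    linarith
  · obtain ⟨δ, hδ⟩ : ∃ δ : ℝ, δ = ((n : ℝ) - 4) / 2 - 4 / (p - 1) := ⟨_, rfl⟩
    have hδ0 : 0 < δ := by
      rw [div_lt_iff₀ hn4] at hsup
      rw [hδ, sub_pos, div_lt_div_iff₀ hp1 two_pos]
      linarith
    have hpoly : 0 < ((δ - 1) ^ 2) ^ 2 - (2 + (n : ℝ) ^ 2 / 2) * (δ - 1) ^ 2 + 1
        + (n : ℝ) ^ 2 * ((n : ℝ) - 3) / 2 := by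
      rcases le_or_gt n 12 with h | h
      · have : 0 < 4 / (p - 1) := by positivity
        exact spectral_poly_pos_of_le_twelve hn h hδ0 (by linarith)
      · have h13 : (13 : ℝ) ≤ n := by exact_mod_cast h
        exact spectral_poly_pos_of_lt (by linarith) (by nlinarith)
          (sq_lt_of_lt_joseph_lundgren h13 hp hδ hδ0 (hJL h))
    obtain ⟨h1, h2, h3⟩ := spectral_pos (N := nzero n) (by linarith) hp rfl hδ hδ0 hpoly
    have hN : 0 ≤ nzero n := by
      unfold nzero
      positivity
    exact eq_zero_of_supercritical hp hN hδ hδ0 h1 h2 h3 hreg heq hst' hR0 hA
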